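/- arXiv:1604.07707 — 6 statements merged into one kernel-verified Lean document; each statement's English description precedes it below -/
import Mathlib

section
/- (Theorem 1, exponential ergodicity implies spatial mixing.) Let the updating family (p_k)_{k∈ℤ^d} be non-degenerate, local, translation invariant and attractive, and let P be the associated PCA dynamics on S^{ℤ^d}. Assume there exist a probability measure ν on S^{ℤ^d}, λ > 0 and n₁ ∈ ℕ* such that for every n ≥ n₁ and every local function f on S^{ℤ^d}: sup_{σ ∈ S^{ℤ^d}} | ∫ f d(δ_σ P^{(n)}) − ∫ f dν | ≤ 2 |||f||| e^{−λ n}. Then there exist C > 0, M > 0 and L₁ ∈ ℕ* such that for every integer L ≥ L₁ and every pair of probability measures ν_{B_L}^{+̂}, ν_{B_L}^{−̂} on S^{B_L} that are stationary for the finite-volume dynamics P_{B_L}^{+̂} and P_{B_L}^{−̂} respectively: ∫ σ₀ dν_{B_L}^{+̂} − ∫ σ₀ dν_{B_L}^{−̂} ≤ C e^{−M L}. -/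
open MeasureTheory ProbabilityTheory

namespace Stmt3

/-- Sites of the lattice `ℤ^d`. -/
abbrev Site (d : ℕ) := Fin d → ℤ

/-- Configuration space `S^{ℤ^d}`, the spin space being a finite subset `S ⊂ ℝ`. -/
abbrev Config (d : ℕ) (S : Finset ℝ) := Site d → ↥S

variable {d : ℕ} {S : Finset ℝ}

/-- The ball `B_L = {k : Σᵢ |kᵢ| ≤ L}` for the ℓ¹ norm on `ℤ^d`. -/
noncomputable def ball (d L : ℕ) : Finset (Site d) :=
  (Finset.Icc (fun _ => -(L : ℤ)) (fun _ => (L : ℤ))).filter fun k => ∑ i, |k i| ≤ (L : ℤ)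

lemma zero_mem_ball (d L : ℕ) : (0 : Site d) ∈ ball d L := by
  simp [ball, Finset.mem_filter, Finset.mem_Icc, Pi.le_def]

/-- `patch Λ η τ` is the configuration `η_Λ τ_{Λᶜ}`. -/
def patch (Λ : Finset (Site d)) (η : ↥Λ → ↥S) (τ : Config d S) : Config d S :=
  fun j => if h : j ∈ Λ then η ⟨j, h⟩ else τ j

/-- The cylinder set of configurations agreeing with `ζ` on `F`. -/
def cylinder (F : Finset (Site d)) (ζ : Config d S) : Set (Config d S) :=
  {σ | ∀ k ∈ F, σ k = ζ k}

section updating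

variable (r : Site d → Config d S → ↥S → ℝ)

/-- `(p_k)_k` is a family of probability kernels. -/
def IsUpdating : Prop :=
  (∀ k η s, 0 ≤ r k η s) ∧ ∀ k η, ∑ s : ↥S, r k η s = 1

/-- Non degenerate updating family. -/
def NonDegenerate : Prop := ∀ k η s, 0 < r k η s

/-- Local updating family. -/
def IsLocalUpdating : Prop :=
  ∀ k : Site d, ∃ V : Finset (Site d),
    ∀ η η' : Config d S, (∀ j ∈ V, η j = η' j) → ∀ s, r k η s = r k η' s

/-- Translation invariant updating family : `p_k(s|η) = p_0(s|θ_{-k} η)`. -/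
def TranslationInvariant : Prop :=
  ∀ (k : Site d) (η : Config d S) (s : ↥S), r k η s = r 0 (fun j => η (j + k)) s

/-- Attractive dynamics: for each `k`, `s`, the map `η ↦ G_k(s,η) = Σ_{s' ≥ s} p_k(s'|η)`
is nondecreasing. -/
def Attractive : Prop :=
  ∀ (k : Site d) (s : ↥S),
    Monotone fun η : Config d S => ∑ s' ∈ Finset.univ.filter (fun s' : ↥S => s ≤ s'), r k η s'

/-- The transition kernel of the PCA dynamics `P(dσ|η) = ⊗_k p_k(dσ_k|η)`,
characterized through its (defining) values on cylinder sets. -/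
def IsPCAOf (P : Kernel (Config d S) (Config d S)) : Prop :=
  ∀ (η : Config d S) (F : Finset (Site d)) (ζ : Config d S),
    P η (cylinder F ζ) = ∏ k ∈ F, ENNReal.ofReal (r k η (ζ k))

/-- Transition probabilities of the finite volume dynamics `P_Λ^τ` on `S^Λ`. -/
def fvKer (Λ : Finset (Site d)) (τ : Config d S) (η σ : ↥Λ → ↥S) : ℝ :=
  ∏ k : ↥Λ, r (k : Site d) (patch Λ η τ) (σ k)

/-- Stationary probability measure for the finite volume dynamics `P_Λ^τ`. -/
def IsStationaryFV (Λ : Finset (Site d)) (τ : Config d S) (ν : (↥Λ → ↥S) → ℝ) : Prop :=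
  (∀ σ, 0 ≤ ν σ) ∧ (∑ σ, ν σ = 1) ∧ ∀ σ, ∑ η, ν η * fvKer r Λ τ η σ = ν σ

end updating

/-- `f` is a local function: it depends on finitely many coordinates. -/
def IsLocalFn (f : Config d S → ℝ) : Prop :=
  ∃ Λf : Finset (Site d), ∀ σ η : Config d S, (∀ k ∈ Λf, σ k = η k) → f σ = f η

/-- `Var_k(f)`. -/
noncomputable def varAt (k : Site d) (f : Config d S → ℝ) : ℝ :=
  sSup {x : ℝ | ∃ σ η : Config d S, (∀ j, j ≠ k → σ j = η j) ∧ x = |f σ - f η|}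

/-- The seminorm `|||f||| = Σ_k Var_k(f)`. -/
noncomputable def norm3 (f : Config d S → ℝ) : ℝ := ∑ᶠ k : Site d, varAt k f

/-- `iter P n σ` is the law `δ_σ P^{(n)}` at time `n` of the Markov chain with
transition kernel `P` started from `σ`. -/
noncomputable def iter (P : Kernel (Config d S) (Config d S)) :
    ℕ → Config d S → Measure (Config d S)
  | 0, σ => Measure.dirac σ
  | n + 1, σ => (iter P n σ).bind fun η => P η

/-- Mean value of the spin at the origin under a finite volume measure. -/
def atZero {Λ : Finset (Site d)} (h : (0 : Site d) ∈ Λ) (ν : (↥Λ → ↥S) → ℝ) : ℝ :=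
  ∑ σ, ν σ * ((σ ⟨0, h⟩ : ℝ))

end Stmt3

namespace Stmt3

variable {d : ℕ} {S : Finset ℝ}

lemma mem_ball_iff (L : ℕ) (k : Site d) : k ∈ ball d L ↔ ∑ i, |k i| ≤ (L : ℤ) := by
  simp only [ball, Finset.mem_filter, Finset.mem_Icc, Pi.le_def, and_iff_right_iff_imp]
  intro h
  have h1 : ∀ i, |k i| ≤ (L : ℤ) := fun i =>
    (Finset.single_le_sum (f := fun i => |k i|) (fun j _ => abs_nonneg (k j))
      (Finset.mem_univ i)).trans h
  exact ⟨fun i => (abs_le.1 (h1 i)).1, fun i => (abs_le.1 (h1 i)).2⟩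

/-- `f` depends only on the coordinates in `F`. -/
def DepOn (F : Finset (Site d)) (f : Config d S → ℝ) : Prop :=
  ∀ σ η : Config d S, (∀ k ∈ F, σ k = η k) → f σ = f η

lemma DepOn.mono {F G : Finset (Site d)} (h : F ⊆ G) {f : Config d S → ℝ} (hf : DepOn F f) :
    DepOn G f := fun σ η hση => hf σ η fun k hk => hση k (h hk)

lemma patch_mem (Λ : Finset (Site d)) (η : ↥Λ → ↥S) (τ : Config d S) (k : ↥Λ) :
    patch Λ η τ k = η k := by
  simp [patch]

lemma DepOn.eq_comp {F : Finset (Site d)} {f : Config d S → ℝ} (hf : DepOn F f)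
    (τ : Config d S) :
    f = (fun σ : ↥F → ↥S => f (patch F σ τ)) ∘ (fun x : Config d S => fun k : ↥F => x k) := by
  funext x
  apply hf
  intro k hk
  exact (patch_mem F (fun k : ↥F => x k) τ ⟨k, hk⟩).symm

lemma measurable_restr (F : Finset (Site d)) :
    Measurable (fun x : Config d S => fun k : ↥F => x k) :=
  measurable_pi_lambda _ fun k => measurable_pi_apply _

lemma DepOn.integrable {F : Finset (Site d)} {f : Config d S → ℝ} (hf : DepOn F f)
    (τ : Config d S) (μ : Measure (Config d S)) [IsFiniteMeasure μ] : Integrable f μ := by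
  rw [hf.eq_comp τ]
  exact (Integrable.of_finite (μ := μ.map (fun x : Config d S => fun k : ↥F => x k))).comp_measurable
    (measurable_restr F)

lemma integral_formula {r : Site d → Config d S → ↥S → ℝ} (hupd : IsUpdating r)
    {P : Kernel (Config d S) (Config d S)} [IsMarkovKernel P] (hP : IsPCAOf r P)
    {F : Finset (Site d)} {f : Config d S → ℝ} (hf : DepOn F f) (τ η : Config d S) :
    ∫ x, f x ∂(P η) = ∑ σ : ↥F → ↥S, (∏ k : ↥F, r k η (σ k)) * f (patch F σ τ) := by
  have h1 : ∫ x, f x ∂(P η) = ∫ σ, f (patch F σ τ)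
      ∂((P η).map (fun x : Config d S => fun k : ↥F => x k)) := by
    rw [integral_map (measurable_restr F).aemeasurable
      (Integrable.of_finite).aestronglyMeasurable]
    exact integral_congr_ae (Filter.Eventually.of_forall fun x => congrFun (hf.eq_comp τ) x)
  rw [h1, integral_fintype Integrable.of_finite]
  refine Finset.sum_congr rfl fun σ _ => ?_
  rw [smul_eq_mul]
  congr 1
  rw [Measure.real, Measure.map_apply (measurable_restr F) (measurableSet_singleton σ)]
  have h2 : (fun x : Config d S => fun k : ↥F => x k) ⁻¹' {σ} = cylinder F (patch F σ τ) := by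
    ext x
    simp only [Set.mem_preimage, Set.mem_singleton_iff, cylinder, Set.mem_setOf_eq]
    constructor
    · intro h k hk
      rw [patch_mem F σ τ ⟨k, hk⟩, ← h]
    · intro h
      funext k
      rw [h k k.2, patch_mem]
  rw [h2, hP, ENNReal.toReal_prod, ← Finset.prod_coe_sort]
  refine Finset.prod_congr rfl fun k _ => ?_
  rw [ENNReal.toReal_ofReal (hupd.1 _ _ _), patch_mem]

/-- Finite range of the family. -/
def HasRange (r : Site d → Config d S → ↥S → ℝ) (R : ℕ) : Prop :=
  ∀ m : ℕ, ∀ k ∈ ball d m, ∀ η η' : Config d S, (∀ j ∈ ball d (m + R), η j = η' j) →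
    ∀ s, r k η s = r k η' s

lemma exists_range {r : Site d → Config d S → ↥S → ℝ} (hloc : IsLocalUpdating r)
    (hti : TranslationInvariant r) : ∃ R : ℕ, 1 ≤ R ∧ HasRange r R := by
  obtain ⟨V, hV⟩ := hloc 0
  refine ⟨1 + V.sup fun j => (∑ i, |j i|).toNat, by omega, ?_⟩
  intro m k hk η η' h s
  rw [hti k η, hti k η']
  apply hV
  intro j hj
  apply h
  rw [mem_ball_iff] at hk ⊢
  have h1 := Finset.le_sup (f := fun j : Site d => (∑ i, |j i|).toNat) hj
  have h2 : ∑ i, |(j + k) i| ≤ ∑ i, |j i| + ∑ i, |k i| := by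
    rw [← Finset.sum_add_distrib]
    exact Finset.sum_le_sum fun i _ => abs_add_le _ _
  have h3 := Int.self_le_toNat (∑ i, |j i|)
  push_cast
  omega

lemma ball_mono {m n : ℕ} (h : m ≤ n) : ball d m ⊆ ball d n := by
  intro k hk
  rw [mem_ball_iff] at hk ⊢
  omega

lemma depOn_step {r : Site d → Config d S → ↥S → ℝ} (hupd : IsUpdating r)
    {P : Kernel (Config d S) (Config d S)} [IsMarkovKernel P] (hP : IsPCAOf r P)
    {R : ℕ} (hR : HasRange r R) {m : ℕ} {f : Config d S → ℝ} (hf : DepOn (ball d m) f) :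
    DepOn (ball d (m + R)) fun η => ∫ x, f x ∂(P η) := by
  intro σ η h
  simp only [integral_formula hupd hP hf σ]
  refine Finset.sum_congr rfl fun ξ _ => ?_
  congr 1
  exact Finset.prod_congr rfl fun k _ => hR m k k.2 σ η h _

lemma iter_prob (P : Kernel (Config d S) (Config d S)) [IsMarkovKernel P] (n : ℕ)
    (σ : Config d S) : IsProbabilityMeasure (iter P n σ) := by
  induction n with
  | zero => exact Measure.dirac.isProbabilityMeasure
  | succ n ih =>
    exact isProbabilityMeasure_bind P.measurable.aemeasurable
      (Filter.Eventually.of_forall fun η => inferInstance)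

lemma integral_iter_succ (P : Kernel (Config d S) (Config d S)) [IsMarkovKernel P] (n : ℕ)
    {F : Finset (Site d)} {f : Config d S → ℝ} (hf : DepOn F f) (σ : Config d S) :
    ∫ x, f x ∂(iter P (n + 1) σ) = ∫ η, (∫ x, f x ∂(P η)) ∂(iter P n σ) := by
  have := iter_prob P (n + 1) σ
  have h : Integrable f ((iter P n σ).bind P) := hf.integrable σ (iter P (n + 1) σ)
  exact Kernel.integral_comp (κ := Kernel.const Unit (iter P n σ)) (a := ()) (by rwa [Kernel.comp_apply, Kernel.const_apply])

lemma stationary_iter {r : Site d → Config d S → ↥S → ℝ} (hupd : IsUpdating r)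
    {P : Kernel (Config d S) (Config d S)} [IsMarkovKernel P] (hP : IsPCAOf r P)
    {R : ℕ} (hR : HasRange r R) {L : ℕ} (τ : Config d S) {μ : (↥(ball d L) → ↥S) → ℝ}
    (hμ : IsStationaryFV r (ball d L) τ μ) (n : ℕ) :
    ∀ (m : ℕ) (f : Config d S → ℝ), DepOn (ball d m) f → m + n * R ≤ L →
      ∑ η, μ η * ∫ x, f x ∂(iter P n (patch (ball d L) η τ))
        = ∑ σ, μ σ * f (patch (ball d L) σ τ) := by
  induction n with
  | zero =>
    intro m f hf _
    refine Finset.sum_congr rfl fun η _ => ?_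
    have hm : StronglyMeasurable f := by
      rw [hf.eq_comp τ]
      exact ((measurable_of_finite _).comp (measurable_restr _)).stronglyMeasurable
    simp only [iter]
    rw [integral_dirac' _ _ hm]
  | succ n ih =>
    intro m f hf hm
    have hm' : m + R + n * R ≤ L := by rw [Nat.succ_mul] at hm; omega
    have hmL : m ≤ L := by omega
    simp only [integral_iter_succ P n hf]
    rw [ih (m + R) _ (depOn_step hupd hP hR hf) hm']
    simp only [integral_formula hupd hP (hf.mono (ball_mono hmL)) τ, Finset.mul_sum]
    rw [Finset.sum_comm]
    refine Finset.sum_congr rfl fun σ _ => ?_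
    rw [← hμ.2.2 σ, Finset.sum_mul]
    refine Finset.sum_congr rfl fun η _ => ?_
    rw [fvKer, mul_assoc]

lemma close_to_nu {r : Site d → Config d S → ↥S → ℝ} (hupd : IsUpdating r)
    {P : Kernel (Config d S) (Config d S)} [IsMarkovKernel P] (hP : IsPCAOf r P)
    {R : ℕ} (hR : HasRange r R) {L : ℕ} (τ : Config d S) {μ : (↥(ball d L) → ↥S) → ℝ}
    (hμ : IsStationaryFV r (ball d L) τ μ) (n : ℕ) (hn : n * R ≤ L) (a ε : ℝ)
    (h : ∀ σ : Config d S, |∫ x, ((x 0 : ↥S) : ℝ) ∂(iter P n σ) - a| ≤ ε) :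
    |atZero (zero_mem_ball d L) μ - a| ≤ ε := by
  have hf : DepOn (ball d 0) (fun x : Config d S => ((x 0 : ↥S) : ℝ)) := by
    intro σ η hση
    simp only [hση 0 (zero_mem_ball d 0)]
  have h1 := stationary_iter hupd hP hR τ hμ n 0 _ hf (by omega)
  have h2 : atZero (zero_mem_ball d L) μ
      = ∑ σ, μ σ * ((patch (ball d L) σ τ 0 : ↥S) : ℝ) := by
    refine Finset.sum_congr rfl fun σ _ => ?_
    rw [← patch_mem (ball d L) σ τ ⟨0, zero_mem_ball d L⟩]
  have h3 : atZero (zero_mem_ball d L) μ - a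
      = ∑ η, μ η * (∫ x, ((x 0 : ↥S) : ℝ) ∂(iter P n (patch (ball d L) η τ)) - a) := by
    simp only [mul_sub, Finset.sum_sub_distrib, ← Finset.sum_mul, hμ.2.1, one_mul]
    rw [h2, h1]
  rw [h3]
  calc _ ≤ ∑ η, |μ η * (∫ x, ((x 0 : ↥S) : ℝ) ∂(iter P n (patch (ball d L) η τ)) - a)| :=
        Finset.abs_sum_le_sum_abs _ _
    _ ≤ ∑ η, μ η * ε := by
        refine Finset.sum_le_sum fun η _ => ?_
        rw [abs_mul, abs_of_nonneg (hμ.1 η)]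
        exact mul_le_mul_of_nonneg_left (h _) (hμ.1 η)
    _ = ε := by rw [← Finset.sum_mul, hμ.2.1, one_mul]

end Stmt3

open Stmt3 in
/-- Theorem 1: exponential ergodicity implies spatial mixing. -/
theorem stmt_3
    (d : ℕ) (hd : 1 ≤ d) (S : Finset ℝ) (hS : S.Nonempty)
    (smax smin : ↥S) (hsmax : ∀ s : ↥S, s ≤ smax) (hsmin : ∀ s : ↥S, smin ≤ s)
    (r : Site d → Config d S → ↥S → ℝ)
    (hupd : IsUpdating r) (hnd : NonDegenerate r) (hloc : IsLocalUpdating r)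
    (hti : TranslationInvariant r) (hatt : Attractive r)
    (P : Kernel (Config d S) (Config d S)) (hMarkov : IsMarkovKernel P)
    (hP : IsPCAOf r P)
    (ν : Measure (Config d S)) (hν : IsProbabilityMeasure ν)
    (lam : ℝ) (hlam : 0 < lam) (n₁ : ℕ) (hn₁ : 1 ≤ n₁)
    (herg : ∀ n : ℕ, n₁ ≤ n → ∀ f : Config d S → ℝ, IsLocalFn f →
      ∀ σ : Config d S,
        |∫ x, f x ∂(iter P n σ) - ∫ x, f x ∂ν| ≤ 2 * norm3 f * Real.exp (-lam * n)) :
    ∃ C > (0 : ℝ), ∃ M > (0 : ℝ), ∃ L₁ : ℕ, 1 ≤ L₁ ∧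
      ∀ L : ℕ, L₁ ≤ L →
        ∀ νp νm : (↥(ball d L) → ↥S) → ℝ,
          IsStationaryFV r (ball d L) (fun _ => smax) νp →
          IsStationaryFV r (ball d L) (fun _ => smin) νm →
          atZero (zero_mem_ball d L) νp - atZero (zero_mem_ball d L) νm
            ≤ C * Real.exp (-M * L) := by
  obtain ⟨R, hR1, hR⟩ := exists_range hloc hti
  set K : ℝ := norm3 (fun x : Config d S => ((x 0 : ↥S) : ℝ)) with hK
  have hRpos : (0 : ℝ) < R := by exact_mod_cast hR1
  refine ⟨4 * (|K| + 1) * Real.exp lam, by positivity, lam / R, by positivity, n₁ * R,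
    Nat.one_le_iff_ne_zero.2 (by positivity), ?_⟩
  intro L hL νp νm hp hm
  have hn : n₁ ≤ L / R := (Nat.le_div_iff_mul_le hR1).2 hL
  have hnR : L / R * R ≤ L := Nat.div_mul_le_self L R
  have hfl : IsLocalFn (fun x : Config d S => ((x 0 : ↥S) : ℝ)) :=
    ⟨{0}, fun σ η h => by simp only [h 0 (Finset.mem_singleton_self 0)]⟩
  have he := herg (L / R) hn _ hfl
  have h1 := abs_le.1 (close_to_nu hupd hP hR _ hp (L / R) hnR _ _ he)
  have h2 := abs_le.1 (close_to_nu hupd hP hR _ hm (L / R) hnR _ _ he)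
  rw [← hK] at h1 h2
  have h3 : Real.exp (-lam * ((L / R : ℕ) : ℝ)) ≤ Real.exp lam * Real.exp (-(lam / R) * L) := by
    rw [← Real.exp_add]
    apply Real.exp_le_exp.2
    have h4 : (L : ℝ) / R < ((L / R : ℕ) : ℝ) + 1 := by
      rw [div_lt_iff₀ hRpos]
      exact_mod_cast Nat.lt_mul_of_div_lt (Nat.lt_succ_self (L / R)) hR1
    have h5 : -(lam / R) * (L : ℝ) = - (lam * ((L : ℝ) / R)) := by ring
    rw [h5]
    nlinarith
  have h6 : K ≤ |K| + 1 := by linarith [le_abs_self K]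
  calc _ ≤ 4 * K * Real.exp (-lam * ((L / R : ℕ) : ℝ)) := by linarith [h1.2, h2.1]
    _ ≤ 4 * (|K| + 1) * Real.exp (-lam * ((L / R : ℕ) : ℝ)) := by gcongr
    _ ≤ 4 * (|K| + 1) * (Real.exp lam * Real.exp (-(lam / R) * L)) := by gcongr
    _ = _ := by ring
end

section
/- (Theorem 1, spatial mixing implies exponentially fast ergodicity.) Let the updating family (p_k)_{k∈ℤ^d} be non-degenerate, local, translation invariant and attractive, and let P be the associated PCA dynamics on S^{ℤ^d}. Assume condition (A): there exist C > 0, M > 0 and L₁ ∈ ℕ* such that for every integer L ≥ L₁ and every pair of probability measures ν_{B_L}^{+̂}, ν_{B_L}^{−̂} on S^{B_L} stationary for P_{B_L}^{+̂} and P_{B_L}^{−̂} respectively: ∫ σ₀ dν_{B_L}^{+̂} − ∫ σ₀ dν_{B_L}^{−̂} ≤ C e^{−M L}. Then P admits a unique stationary probability measure ν on S^{ℤ^d}, and there exist λ > 0 and n₁ ∈ ℕ* such that for every n ≥ n₁ and every local function f: sup_{σ ∈ S^{ℤ^d}} | ∫ f d(δ_σ P^{(n)}) − ∫ f dν | ≤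 2 |||f||| e^{−λ n}. -/
open MeasureTheory ProbabilityTheory

namespace Stmt4

/-- Sites of the lattice `ℤ^d`. -/
abbrev Site (d : ℕ) := Fin d → ℤ

/-- Configuration space `S^{ℤ^d}`, the spin space being a finite subset `S ⊂ ℝ`. -/
abbrev Config (d : ℕ) (S : Finset ℝ) := Site d → ↥S

variable {d : ℕ} {S : Finset ℝ}

/-- The ball `B_L = {k : Σᵢ |kᵢ| ≤ L}` for the ℓ¹ norm on `ℤ^d`. -/
noncomputable def ball (d L : ℕ) : Finset (Site d) :=
  (Finset.Icc (fun _ => -(L : ℤ)) (fun _ => (L : ℤ))).filter fun k => ∑ i, |k i| ≤ (L : ℤ)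

lemma zero_mem_ball (d L : ℕ) : (0 : Site d) ∈ ball d L := by
  simp [ball, Finset.mem_filter, Finset.mem_Icc, Pi.le_def]

/-- `patch Λ η τ` is the configuration `η_Λ τ_{Λᶜ}`. -/
def patch (Λ : Finset (Site d)) (η : ↥Λ → ↥S) (τ : Config d S) : Config d S :=
  fun j => if h : j ∈ Λ then η ⟨j, h⟩ else τ j

/-- The cylinder set of configurations agreeing with `ζ` on `F`. -/
def cylinder (F : Finset (Site d)) (ζ : Config d S) : Set (Config d S) :=
  {σ | ∀ k ∈ F, σ k = ζ k}

section updating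

variable (r : Site d → Config d S → ↥S → ℝ)

/-- `(p_k)_k` is a family of probability kernels. -/
def IsUpdating : Prop :=
  (∀ k η s, 0 ≤ r k η s) ∧ ∀ k η, ∑ s : ↥S, r k η s = 1

/-- Non degenerate updating family. -/
def NonDegenerate : Prop := ∀ k η s, 0 < r k η s

/-- Local updating family. -/
def IsLocalUpdating : Prop :=
  ∀ k : Site d, ∃ V : Finset (Site d),
    ∀ η η' : Config d S, (∀ j ∈ V, η j = η' j) → ∀ s, r k η s = r k η' s

/-- Translation invariant updating family : `p_k(s|η) = p_0(s|θ_{-k} η)`. -/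
def TranslationInvariant : Prop :=
  ∀ (k : Site d) (η : Config d S) (s : ↥S), r k η s = r 0 (fun j => η (j + k)) s

/-- Attractive dynamics: for each `k`, `s`, the map `η ↦ G_k(s,η) = Σ_{s' ≥ s} p_k(s'|η)`
is nondecreasing. -/
def Attractive : Prop :=
  ∀ (k : Site d) (s : ↥S),
    Monotone fun η : Config d S => ∑ s' ∈ Finset.univ.filter (fun s' : ↥S => s ≤ s'), r k η s'

/-- The transition kernel of the PCA dynamics `P(dσ|η) = ⊗_k p_k(dσ_k|η)`,
characterized through its (defining) values on cylinder sets. -/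
def IsPCAOf (P : Kernel (Config d S) (Config d S)) : Prop :=
  ∀ (η : Config d S) (F : Finset (Site d)) (ζ : Config d S),
    P η (cylinder F ζ) = ∏ k ∈ F, ENNReal.ofReal (r k η (ζ k))

/-- Transition probabilities of the finite volume dynamics `P_Λ^τ` on `S^Λ`. -/
def fvKer (Λ : Finset (Site d)) (τ : Config d S) (η σ : ↥Λ → ↥S) : ℝ :=
  ∏ k : ↥Λ, r (k : Site d) (patch Λ η τ) (σ k)

/-- Stationary probability measure for the finite volume dynamics `P_Λ^τ`. -/
def IsStationaryFV (Λ : Finset (Site d)) (τ : Config d S) (ν : (↥Λ → ↥S) → ℝ) : Prop :=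
  (∀ σ, 0 ≤ ν σ) ∧ (∑ σ, ν σ = 1) ∧ ∀ σ, ∑ η, ν η * fvKer r Λ τ η σ = ν σ

end updating

/-- `f` is a local function: it depends on finitely many coordinates. -/
def IsLocalFn (f : Config d S → ℝ) : Prop :=
  ∃ Λf : Finset (Site d), ∀ σ η : Config d S, (∀ k ∈ Λf, σ k = η k) → f σ = f η

/-- `Var_k(f)`. -/
noncomputable def varAt (k : Site d) (f : Config d S → ℝ) : ℝ :=
  sSup {x : ℝ | ∃ σ η : Config d S, (∀ j, j ≠ k → σ j = η j) ∧ x = |f σ - f η|}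

/-- The seminorm `|||f||| = Σ_k Var_k(f)`. -/
noncomputable def norm3 (f : Config d S → ℝ) : ℝ := ∑ᶠ k : Site d, varAt k f

/-- `iter P n σ` is the law `δ_σ P^{(n)}` at time `n` of the Markov chain with
transition kernel `P` started from `σ`. -/
noncomputable def iter (P : Kernel (Config d S) (Config d S)) :
    ℕ → Config d S → Measure (Config d S)
  | 0, σ => Measure.dirac σ
  | n + 1, σ => (iter P n σ).bind fun η => P η

/-- Mean value of the spin at the origin under a finite volume measure. -/
def atZero {Λ : Finset (Site d)} (h : (0 : Site d) ∈ Λ) (ν : (↥Λ → ↥S) → ℝ) : ℝ :=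
  ∑ σ, ν σ * ((σ ⟨0, h⟩ : ℝ))

end Stmt4

namespace Stmt4

open Filter Topology

variable {d : ℕ} {S : Finset ℝ}

/-- Upper tail of a weight function on the spin space. -/
noncomputable def tailG (q : ↥S → ℝ) (s : ↥S) : ℝ :=
  ∑ s' ∈ Finset.univ.filter (fun s' : ↥S => s ≤ s'), q s'

/-- Quantile function. -/
noncomputable def quant (smin : ↥S) (q : ↥S → ℝ) (u : ℝ) : ↥S :=
  (Finset.univ.filter (fun s : ↥S => u ≤ tailG q s ∨ s = smin)).max' ⟨smin, by simp⟩

lemma quant_mono (smin : ↥S) {q q' : ↥S → ℝ} (h : ∀ s, tailG q s ≤ tailG q' s) (u : ℝ) :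
    quant smin q u ≤ quant smin q' u := by
  apply Finset.max'_subset
  intro s hs
  simp only [Finset.mem_filter, Finset.mem_univ, true_and] at hs ⊢
  rcases hs with hs | hs
  · exact Or.inl (hs.trans (h s))
  · exact Or.inr hs

lemma tailG_anti {q : ↥S → ℝ} (hq : ∀ s, 0 ≤ q s) {s t : ↥S} (h : s ≤ t) :
    tailG q t ≤ tailG q s := by
  apply Finset.sum_le_sum_of_subset_of_nonneg
  · intro x hx
    simp only [Finset.mem_filter, Finset.mem_univ, true_and] at hx ⊢
    exact h.trans hx
  · intros; exact hq _

lemma le_quant_iff {smin : ↥S} (hsmin : ∀ s : ↥S, smin ≤ s) {q : ↥S → ℝ} (hq : ∀ s, 0 ≤ q s)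
    (u : ℝ) (s : ↥S) : s ≤ quant smin q u ↔ u ≤ tailG q s ∨ s = smin := by
  constructor
  · intro h
    have hm := Finset.max'_mem (Finset.univ.filter (fun s : ↥S => u ≤ tailG q s ∨ s = smin))
      ⟨smin, by simp⟩
    simp only [Finset.mem_filter, Finset.mem_univ, true_and] at hm
    rcases hm with hm | hm
    · exact Or.inl (hm.trans (tailG_anti hq h))
    · right
      refine le_antisymm ?_ (hsmin s)
      have h' := h
      unfold quant at h'
      rwa [hm] at h'
  · intro h
    apply Finset.le_max'
    simpa using h

lemma tailG_min {smin : ↥S} (hsmin : ∀ s : ↥S, smin ≤ s) {q : ↥S → ℝ}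
    (hq1 : ∑ s, q s = 1) : tailG q smin = 1 := by
  rw [tailG, ← hq1]
  congr 1
  ext s
  simp [hsmin s]

lemma tailG_le_one {q : ↥S → ℝ} (hq : ∀ s, 0 ≤ q s)
    (hq1 : ∑ s, q s = 1) (s : ↥S) : tailG q s ≤ 1 := by
  rw [← hq1]
  exact Finset.sum_le_sum_of_subset_of_nonneg (Finset.filter_subset _ _) (fun _ _ _ => hq _)

lemma measurable_quant {smin : ↥S} (hsmin : ∀ s : ↥S, smin ≤ s) {q : ↥S → ℝ}
    (hq : ∀ s, 0 ≤ q s) : Measurable (quant smin q) := by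
  have h1 : ∀ s : ↥S, MeasurableSet {u : ℝ | s ≤ quant smin q u} := by
    intro s
    have : {u : ℝ | s ≤ quant smin q u} = Set.Iic (tailG q s) ∪ {u | s = smin} := by
      ext u
      simp [le_quant_iff hsmin hq]
    rw [this]
    exact measurableSet_Iic.union (MeasurableSet.const _)
  apply measurable_to_countable'
  intro s
  have : quant smin q ⁻¹' {s} =
      {u : ℝ | s ≤ quant smin q u} ∩ ⋂ t ∈ {t : ↥S | s < t}, {u : ℝ | t ≤ quant smin q u}ᶜ := by
    ext u
    simp only [Set.mem_preimage, Set.mem_singleton_iff, Set.mem_inter_iff, Set.mem_ofPred_eq,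
      Set.mem_iInter, Set.mem_compl_iff, not_le]
    constructor
    · rintro rfl
      exact ⟨le_rfl, fun t ht => ht⟩
    · rintro ⟨h, h'⟩
      by_contra hne
      exact lt_irrefl _ (h' _ (lt_of_le_of_ne h (Ne.symm hne)))
  rw [this]
  exact (h1 s).inter (MeasurableSet.biInter (Set.to_countable _) fun t _ => (h1 t).compl)

/-- The uniform measure on `(0,1]`. -/
noncomputable def unif : Measure ℝ := volume.restrict (Set.Ioc 0 1)

instance : IsProbabilityMeasure unif := ⟨by simp [unif]⟩

lemma unif_quant {smin : ↥S} (hsmin : ∀ s : ↥S, smin ≤ s) {q : ↥S → ℝ}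
    (hq : ∀ s, 0 ≤ q s) (hq1 : ∑ s, q s = 1) (s : ↥S) :
    unif (quant smin q ⁻¹' {s}) = ENNReal.ofReal (q s) := by
  have hm := measurable_quant hsmin hq (measurableSet_singleton s)
  rw [unif, Measure.restrict_apply hm]
  set H : ℝ := ∑ t ∈ Finset.univ.filter (fun t : ↥S => s < t), q t with hH
  have hG : tailG q s = q s + H := by
    have : Finset.univ.filter (fun t : ↥S => s ≤ t) =
        insert s (Finset.univ.filter (fun t : ↥S => s < t)) := by
      ext t
      simp only [Finset.mem_filter, Finset.mem_univ, true_and, Finset.mem_insert]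
      rw [le_iff_eq_or_lt, eq_comm]
    rw [tailG, this, Finset.sum_insert (by simp)]
  have hH0 : 0 ≤ H := Finset.sum_nonneg fun _ _ => hq _
  have key : quant smin q ⁻¹' {s} ∩ Set.Ioc 0 1 = Set.Ioc H (tailG q s) := by
    ext u
    simp only [Set.mem_inter_iff, Set.mem_preimage, Set.mem_singleton_iff, Set.mem_Ioc]
    have htt : ∀ t, s < t → (t ≤ quant smin q u ↔ u ≤ tailG q t) := by
      intro t ht
      rw [le_quant_iff hsmin hq]
      have : t ≠ smin := fun h => absurd ht (not_lt.2 (h ▸ hsmin s))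
      simp [this]
    have htail : ∀ t, s < t → tailG q t ≤ H := by
      intro t ht
      apply Finset.sum_le_sum_of_subset_of_nonneg
      · intro x hx
        simp only [Finset.mem_filter, Finset.mem_univ, true_and] at hx ⊢
        exact lt_of_lt_of_le ht hx
      · intros; exact hq _
    constructor
    · rintro ⟨h, hu0, hu1⟩
      constructor
      · by_contra hle
        push Not at hle
        by_cases hne : (Finset.univ.filter (fun t : ↥S => s < t)).Nonempty
        · set t := (Finset.univ.filter (fun t : ↥S => s < t)).min' hne with ht
          have hst : s < t := by
            have := Finset.min'_mem _ hne
            exact (Finset.mem_filter.1 this).2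
          have hHt : tailG q t = H := by
            rw [hH, tailG]
            congr 1
            ext x
            simp only [Finset.mem_filter, Finset.mem_univ, true_and]
            constructor
            · intro hx; exact lt_of_lt_of_le hst hx
            · intro hx; exact Finset.min'_le _ _ (by simpa using hx)
          have := (htt t hst).2 (hHt ▸ hle)
          rw [h] at this
          exact absurd hst (not_lt.2 this)
        · rw [Finset.not_nonempty_iff_eq_empty] at hne
          rw [hne, Finset.sum_empty] at hH
          linarith
      · rcases (le_quant_iff hsmin hq u s).1 h.ge with h1 | h1
        · exact h1
        · rw [h1, tailG_min hsmin hq1]; exact hu1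
    · rintro ⟨h1, h2⟩
      refine ⟨?_, lt_of_le_of_lt hH0 h1, h2.trans (tailG_le_one hq hq1 s)⟩
      refine le_antisymm ?_ ((le_quant_iff hsmin hq u s).2 (Or.inl h2))
      by_contra hlt
      push Not at hlt
      have := (htt _ hlt).1 le_rfl
      linarith [htail _ hlt]
  rw [key, Real.volume_Ioc, hG]
  congr 1
  ring

/-- The product of uniform measures. -/
noncomputable def unifPi (d : ℕ) : Measure (Site d → ℝ) := Measure.infinitePi (fun _ => unif)

instance : IsProbabilityMeasure (unifPi d) := by unfold unifPi; infer_instance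

/-- One step of the dynamics as a random map. -/
noncomputable def step (smin : ↥S) (r : Site d → Config d S → ↥S → ℝ) (η : Config d S)
    (u : Site d → ℝ) : Config d S := fun k => quant smin (r k η) (u k)

/-- Transition operator. -/
noncomputable def T (smin : ↥S) (r : Site d → Config d S → ↥S → ℝ) (f : Config d S → ℝ)
    (η : Config d S) : ℝ := ∫ u, f (step smin r η u) ∂(unifPi d)

lemma measurable_step {smin : ↥S} (hsmin : ∀ s : ↥S, smin ≤ s)
    {r : Site d → Config d S → ↥S → ℝ} (hr : IsUpdating r) (η : Config d S) :
    Measurable (step smin r η) := by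
  rw [measurable_pi_iff]
  intro k
  exact (measurable_quant hsmin (hr.1 k η)).comp (measurable_pi_apply k)

lemma unifPi_cylinder {smin : ↥S} (hsmin : ∀ s : ↥S, smin ≤ s)
    {r : Site d → Config d S → ↥S → ℝ} (hr : IsUpdating r) (η : Config d S)
    (F : Finset (Site d)) (ζ : Config d S) :
    (unifPi d).map (step smin r η) (cylinder F ζ) = ∏ k ∈ F, ENNReal.ofReal (r k η (ζ k)) := by
  have hmc : MeasurableSet (cylinder F ζ) := by
    have : cylinder F ζ = ⋂ k ∈ F, (fun σ : Config d S => σ k) ⁻¹' {ζ k} := by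
      ext σ; simp [cylinder]
    rw [this]
    exact Finset.measurableSet_biInter _ fun k _ => measurable_pi_apply k (measurableSet_singleton _)
  rw [Measure.map_apply (measurable_step hsmin hr η) hmc]
  have : step smin r η ⁻¹' cylinder F ζ =
      Set.pi (F : Set (Site d)) (fun k => quant smin (r k η) ⁻¹' {ζ k}) := by
    ext u
    simp [cylinder, step, Set.mem_pi]
  rw [this, unifPi, Measure.infinitePi_pi]
  · exact Finset.prod_congr rfl fun k _ => unif_quant hsmin (hr.1 k η) (hr.2 k η) _
  · intro k _
    exact measurable_quant hsmin (hr.1 k η) (measurableSet_singleton _)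

/-- `f` depends only on the coordinates in `F`. -/
def Dep (F : Finset (Site d)) (f : Config d S → ℝ) : Prop :=
  ∀ σ η : Config d S, (∀ k ∈ F, σ k = η k) → f σ = f η

lemma Dep.mono {F F' : Finset (Site d)} {f : Config d S → ℝ} (h : Dep F f) (hF : F ⊆ F') :
    Dep F' f := fun σ η hk => h σ η fun k hk' => hk k (hF hk')

lemma Dep.loc {F : Finset (Site d)} {f : Config d S → ℝ} (h : Dep F f) : IsLocalFn f := ⟨F, h⟩

lemma Dep.eq_patch {F : Finset (Site d)} {f : Config d S → ℝ} (h : Dep F f) (τ σ : Config d S) :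
    f σ = f (patch F (fun k => σ k) τ) := by
  apply h
  intro k hk
  simp [patch, hk]

lemma IsLocalFn.meas {f : Config d S → ℝ} (h : IsLocalFn f) : Measurable f := by
  obtain ⟨F, hF⟩ := h
  by_cases hne : Nonempty (Config d S)
  · obtain ⟨τ⟩ := hne
    have : f = (fun ζ : ↥F → ↥S => f (patch F ζ τ)) ∘ (fun (σ : Config d S) (k : ↥F) => σ k) := by
      ext σ
      exact Dep.eq_patch hF τ σ
    rw [this]
    apply (measurable_of_finite _).comp
    rw [measurable_pi_iff]
    intro k
    exact measurable_pi_apply _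
  · rw [not_nonempty_iff] at hne
    exact measurable_of_empty f

lemma IsLocalFn.bdd {f : Config d S → ℝ} (h : IsLocalFn f) : ∃ B, ∀ σ, |f σ| ≤ B := by
  obtain ⟨F, hF⟩ := h
  by_cases hne : Nonempty (Config d S)
  · obtain ⟨τ⟩ := hne
    refine ⟨∑ ζ : ↥F → ↥S, |f (patch F ζ τ)|, fun σ => ?_⟩
    rw [Dep.eq_patch hF τ σ]
    exact Finset.single_le_sum (f := fun ζ : ↥F → ↥S => |f (patch F ζ τ)|)
      (fun _ _ => abs_nonneg _) (Finset.mem_univ _)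
  · exact ⟨0, fun σ => absurd ⟨σ⟩ hne⟩

lemma IsLocalFn.integrable {f : Config d S → ℝ} (h : IsLocalFn f) (μ : Measure (Config d S))
    [IsFiniteMeasure μ] : Integrable f μ := by
  obtain ⟨B, hB⟩ := h.bdd
  exact Integrable.of_bound h.meas.aestronglyMeasurable B (ae_of_all _ hB)

lemma IsLocalFn.integrable_step {smin : ↥S} (hsmin : ∀ s : ↥S, smin ≤ s)
    {r : Site d → Config d S → ↥S → ℝ} (hr : IsUpdating r) (η : Config d S)
    {f : Config d S → ℝ} (h : IsLocalFn f) :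
    Integrable (fun u => f (step smin r η u)) (unifPi d) := by
  obtain ⟨B, hB⟩ := h.bdd
  exact Integrable.of_bound (h.meas.comp (measurable_step hsmin hr η)).aestronglyMeasurable B
    (ae_of_all _ fun _ => hB _)

/-- Integral of a local function through cylinder probabilities. -/
lemma integral_local {F : Finset (Site d)} {f : Config d S → ℝ} (hf : Dep F f)
    (μ : Measure (Config d S)) [IsProbabilityMeasure μ] (q : Site d → ↥S → ℝ)
    (hq : ∀ k s, 0 ≤ q k s)
    (hμ : ∀ ζ : Config d S, μ (cylinder F ζ) = ∏ k ∈ F, ENNReal.ofReal (q k (ζ k)))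
    (τ : Config d S) :
    ∫ σ, f σ ∂μ = ∑ ζ : ↥F → ↥S, (∏ k : ↥F, q k (ζ k)) * f (patch F ζ τ) := by
  have hmc : ∀ ζ, MeasurableSet (cylinder F ζ : Set (Config d S)) := by
    intro ζ
    have : cylinder F ζ = ⋂ k ∈ F, (fun σ : Config d S => σ k) ⁻¹' {ζ k} := by
      ext σ; simp [cylinder]
    rw [this]
    exact Finset.measurableSet_biInter _ fun k _ => measurable_pi_apply k (measurableSet_singleton _)
  have h1 : ∀ σ, f σ = ∑ ζ : ↥F → ↥S,
      (cylinder F (patch F ζ τ)).indicator (fun _ => f (patch F ζ τ)) σ := by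
    intro σ
    rw [Finset.sum_eq_single (fun k : ↥F => σ k)]
    · rw [Set.indicator_of_mem]
      · exact hf.eq_patch τ σ
      · intro k hk
        simp [patch, hk]
    · intro ζ _ hne
      apply Set.indicator_of_notMem
      intro hmem
      apply hne
      ext k
      have := hmem k k.2
      simp [patch] at this
      rw [this]
    · simp
  rw [integral_congr_ae (ae_of_all μ h1), integral_finsetSum]
  · refine Finset.sum_congr rfl fun ζ _ => ?_
    rw [integral_indicator_const _ (hmc _), smul_eq_mul]
    congr 1
    rw [Measure.real, hμ, ENNReal.toReal_prod, ← Finset.prod_coe_sort]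
    refine Finset.prod_congr rfl fun k _ => ?_
    rw [ENNReal.toReal_ofReal (hq _ _)]
    simp [patch]
  · intro ζ _
    exact (integrable_const _).indicator (hmc _)

lemma T_eq_sum {smin : ↥S} (hsmin : ∀ s : ↥S, smin ≤ s)
    {r : Site d → Config d S → ↥S → ℝ} (hr : IsUpdating r) (η : Config d S)
    {F : Finset (Site d)} {f : Config d S → ℝ} (hf : Dep F f) (τ : Config d S) :
    T smin r f η = ∑ ζ : ↥F → ↥S, (∏ k : ↥F, r k η (ζ k)) * f (patch F ζ τ) := by
  have hm := measurable_step hsmin hr η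
  have : IsProbabilityMeasure ((unifPi d).map (step smin r η)) :=
    Measure.isProbabilityMeasure_map hm.aemeasurable
  rw [← integral_local hf ((unifPi d).map (step smin r η)) (fun k => r k η) (fun k => hr.1 k η)
    (unifPi_cylinder hsmin hr η F) τ, integral_map hm.aemeasurable
      hf.loc.meas.aestronglyMeasurable]
  rfl

lemma T_eq_integral {smin : ↥S} (hsmin : ∀ s : ↥S, smin ≤ s)
    {r : Site d → Config d S → ↥S → ℝ} (hr : IsUpdating r)
    {P : Kernel (Config d S) (Config d S)} [IsMarkovKernel P] (hP : IsPCAOf r P) (η : Config d S)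
    {f : Config d S → ℝ} (hf : IsLocalFn f) :
    ∫ σ, f σ ∂(P η) = T smin r f η := by
  obtain ⟨F, hF⟩ := hf
  have hF : Dep F f := hF
  rw [T_eq_sum hsmin hr η hF η,
    integral_local hF (P η) (fun k => r k η) (fun k => hr.1 k η) (hP η F) η]

end Stmt4

namespace Stmt4

open Filter Topology

variable {d : ℕ} {S : Finset ℝ}

lemma T_dep {smin : ↥S} {r : Site d → Config d S → ↥S → ℝ} {F F' : Finset (Site d)}
    {f : Config d S → ℝ} (hf : Dep F f)
    (h : ∀ k ∈ F, ∀ η η' : Config d S, (∀ j ∈ F', η j = η' j) → ∀ s, r k η s = r k η' s) :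
    Dep F' (T smin r f) := by
  intro η η' h'
  unfold T
  congr 1
  funext u
  apply hf
  intro k hk
  have : r k η = r k η' := funext fun s => h k hk η η' h' s
  simp [step, this]

lemma T_local {smin : ↥S} {r : Site d → Config d S → ↥S → ℝ} (hl : IsLocalUpdating r)
    {f : Config d S → ℝ} (hf : IsLocalFn f) : IsLocalFn (T smin r f) := by
  obtain ⟨F, hF⟩ := hf
  choose V hV using hl
  refine ⟨F.biUnion V, T_dep (F := F) hF ?_⟩
  intro k hk η η' h s
  exact hV k η η' (fun j hj => h j (Finset.mem_biUnion.2 ⟨k, hk, hj⟩)) s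

lemma iterT_local {smin : ↥S} {r : Site d → Config d S → ↥S → ℝ} (hl : IsLocalUpdating r)
    {f : Config d S → ℝ} (hf : IsLocalFn f) (n : ℕ) : IsLocalFn ((T smin r)^[n] f) := by
  induction n with
  | zero => exact hf
  | succ n ih => rw [Function.iterate_succ_apply']; exact T_local hl ih

/-- Order relation between observables. -/
def Rel (f f' : Config d S → ℝ) : Prop := ∀ η η' : Config d S, η ≤ η' → f η ≤ f' η'

/-- Stochastic domination between updating families. -/
def Dom (r r' : Site d → Config d S → ↥S → ℝ) : Prop :=
  ∀ η η' : Config d S, η ≤ η' → ∀ k s, tailG (r k η) s ≤ tailG (r' k η') s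

/-- Domination of increments. -/
def Rel2 (f g : Config d S → ℝ) : Prop :=
  ∀ η η' : Config d S, η ≤ η' → |f η' - f η| ≤ g η' - g η

/-- Bundled assumptions. -/
structure Good (r : Site d → Config d S → ↥S → ℝ) : Prop where
  upd : IsUpdating r
  loc : IsLocalUpdating r

lemma Attractive.dom {r : Site d → Config d S → ↥S → ℝ} (h : Attractive r) : Dom r r :=
  fun _ _ hle k s => h k s hle

lemma Dom.step_le {smin : ↥S} {r r' : Site d → Config d S → ↥S → ℝ} (h : Dom r r')
    {η η' : Config d S} (hle : η ≤ η') (u : Site d → ℝ) :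
    step smin r η u ≤ step smin r' η' u :=
  fun k => quant_mono smin (h η η' hle k) (u k)

lemma T_rel {smin : ↥S} (hsmin : ∀ s : ↥S, smin ≤ s) {r r' : Site d → Config d S → ↥S → ℝ}
    (hr : Good r) (hr' : Good r') (h : Dom r r') {f f' : Config d S → ℝ} (hf : IsLocalFn f)
    (hf' : IsLocalFn f') (hff : Rel f f') : Rel (T smin r f) (T smin r' f') := by
  intro η η' hle
  exact integral_mono (hf.integrable_step hsmin hr.upd η) (hf'.integrable_step hsmin hr'.upd η')
    fun u => hff _ _ (h.step_le hle u)

lemma iterT_rel {smin : ↥S} (hsmin : ∀ s : ↥S, smin ≤ s) {r r' : Site d → Config d S → ↥S → ℝ}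
    (hr : Good r) (hr' : Good r') (h : Dom r r') {f f' : Config d S → ℝ} (hf : IsLocalFn f)
    (hf' : IsLocalFn f') (hff : Rel f f') (n : ℕ) :
    Rel ((T smin r)^[n] f) ((T smin r')^[n] f') := by
  induction n with
  | zero => exact hff
  | succ n ih =>
    rw [Function.iterate_succ_apply', Function.iterate_succ_apply']
    exact T_rel hsmin hr hr' h (iterT_local hr.loc hf n) (iterT_local hr'.loc hf' n) ih

lemma T_rel2 {smin : ↥S} (hsmin : ∀ s : ↥S, smin ≤ s) {r : Site d → Config d S → ↥S → ℝ}
    (hr : Good r) (h : Dom r r) {f g : Config d S → ℝ} (hf : IsLocalFn f)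
    (hg : IsLocalFn g) (hfg : Rel2 f g) : Rel2 (T smin r f) (T smin r g) := by
  intro η η' hle
  have i1 := hf.integrable_step hsmin hr.upd η
  have i2 := hf.integrable_step hsmin hr.upd η'
  have i3 := hg.integrable_step hsmin hr.upd η
  have i4 := hg.integrable_step hsmin hr.upd η'
  unfold T
  rw [← integral_sub i2 i1, ← integral_sub i4 i3]
  refine (abs_integral_le_integral_abs).trans ?_
  exact integral_mono (i2.sub i1).abs (i4.sub i3) fun u => hfg _ _ (h.step_le hle u)

lemma iterT_rel2 {smin : ↥S} (hsmin : ∀ s : ↥S, smin ≤ s) {r : Site d → Config d S → ↥S → ℝ}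
    (hr : Good r) (h : Dom r r) {f g : Config d S → ℝ} (hf : IsLocalFn f)
    (hg : IsLocalFn g) (hfg : Rel2 f g) (n : ℕ) :
    Rel2 ((T smin r)^[n] f) ((T smin r)^[n] g) := by
  induction n with
  | zero => exact hfg
  | succ n ih =>
    rw [Function.iterate_succ_apply', Function.iterate_succ_apply']
    exact T_rel2 hsmin hr h (iterT_local hr.loc hf n) (iterT_local hr.loc hg n) ih

lemma local_sum {ι : Type*} (A : Finset ι) (c : ι → ℝ) {g : ι → Config d S → ℝ}
    (hg : ∀ i, IsLocalFn (g i)) : IsLocalFn (fun σ => ∑ i ∈ A, c i * g i σ) := by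
  classical
  choose F hF using hg
  refine ⟨A.biUnion F, fun σ η h => Finset.sum_congr rfl fun i hi => ?_⟩
  rw [hF i σ η fun k hk => h k (Finset.mem_biUnion.2 ⟨i, hi, hk⟩)]

lemma iterT_sum {smin : ↥S} (hsmin : ∀ s : ↥S, smin ≤ s) {r : Site d → Config d S → ↥S → ℝ}
    (hr : Good r) {ι : Type*} (A : Finset ι) (c : ι → ℝ) {g : ι → Config d S → ℝ}
    (hg : ∀ i, IsLocalFn (g i)) (n : ℕ) (η : Config d S) :
    (T smin r)^[n] (fun σ => ∑ i ∈ A, c i * g i σ) η =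
      ∑ i ∈ A, c i * (T smin r)^[n] (g i) η := by
  induction n generalizing η with
  | zero => rfl
  | succ n ih =>
    rw [Function.iterate_succ_apply', funext ih]
    simp_rw [Function.iterate_succ_apply']
    unfold T
    rw [integral_finsetSum]
    · refine Finset.sum_congr rfl fun i _ => ?_
      rw [integral_const_mul]
    · intro i _
      exact ((iterT_local hr.loc (hg i) n).integrable_step hsmin hr.upd η).const_mul _

/-- Shift of functions on the lattice. -/
def shift {α : Type*} (k : Site d) (σ : Site d → α) : Site d → α := fun j => σ (j + k)

lemma unifPi_shift (k : Site d) : (unifPi d).map (shift k) = unifPi d := by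
  have hm : Measurable (shift k : (Site d → ℝ) → (Site d → ℝ)) := by
    rw [measurable_pi_iff]
    intro j
    exact measurable_pi_apply (j + k)
  apply Measure.eq_infinitePi
  intro s t ht
  rw [Measure.map_apply hm (MeasurableSet.pi (Finset.countable_toSet _) fun i _ => ht i)]
  have : shift k ⁻¹' (Set.pi (s : Set (Site d)) t) =
      Set.pi ((s.map (Equiv.addRight k).toEmbedding : Finset (Site d)) : Set (Site d))
        (fun j => t (j - k)) := by
    ext u
    simp only [Set.mem_preimage, Set.mem_pi, Finset.mem_coe, Finset.mem_map,
      Equiv.coe_toEmbedding, Equiv.coe_addRight, shift]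
    constructor
    · rintro h _ ⟨j, hj, rfl⟩
      rw [add_sub_cancel_right]
      exact h j hj
    · intro h j hj
      have := h (j + k) ⟨j, hj, rfl⟩
      rwa [add_sub_cancel_right] at this
  rw [this, unifPi, Measure.infinitePi_pi _ (fun i _ => ht _), Finset.prod_map]
  refine Finset.prod_congr rfl fun j _ => ?_
  simp only [Equiv.coe_toEmbedding, Equiv.coe_addRight]
  rw [add_sub_cancel_right]

lemma local_shift (k : Site d) {f : Config d S → ℝ} (hf : IsLocalFn f) :
    IsLocalFn (fun σ => f (shift k σ)) := by
  obtain ⟨F, hF⟩ := hf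
  refine ⟨F.image (· + k), fun σ η h => hF _ _ fun j hj => h _ (Finset.mem_image_of_mem _ hj)⟩

lemma T_shift {smin : ↥S} (hsmin : ∀ s : ↥S, smin ≤ s) {r : Site d → Config d S → ↥S → ℝ}
    (hr : Good r) (hti : TranslationInvariant r) (k : Site d) {f : Config d S → ℝ}
    (hf : IsLocalFn f) (η : Config d S) :
    T smin r (fun σ => f (shift k σ)) η = T smin r f (shift k η) := by
  have hm : Measurable (shift k : (Site d → ℝ) → (Site d → ℝ)) := by
    rw [measurable_pi_iff]
    intro j
    exact measurable_pi_apply (j + k)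
  unfold T
  conv_rhs => rw [← unifPi_shift k]
  rw [integral_map hm.aemeasurable
    (f := fun u => f (step smin r (shift k η) u))
    (hf.meas.comp (measurable_step hsmin hr.upd _)).aestronglyMeasurable]
  congr 1
  funext u
  show f _ = f _
  congr 1
  funext j
  have : r (j + k) η = r j (shift k η) := by
    funext s
    rw [hti (j + k), hti j]
    congr 1
    funext i
    simp only [shift]
    congr 1
    abel
  simp [shift, step, this]

lemma iterT_shift {smin : ↥S} (hsmin : ∀ s : ↥S, smin ≤ s) {r : Site d → Config d S → ↥S → ℝ}
    (hr : Good r) (hti : TranslationInvariant r) (k : Site d) {f : Config d S → ℝ}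
    (hf : IsLocalFn f) (n : ℕ) (η : Config d S) :
    (T smin r)^[n] (fun σ => f (shift k σ)) η = (T smin r)^[n] f (shift k η) := by
  induction n generalizing η with
  | zero => rfl
  | succ n ih =>
    rw [Function.iterate_succ_apply', funext ih, T_shift hsmin hr hti k (iterT_local hr.loc hf n),
      Function.iterate_succ_apply']

/-- Spin at site `k`. -/
def X (k : Site d) (σ : Config d S) : ℝ := (σ k : ℝ)

lemma X_dep (k : Site d) : Dep {k} (X k : Config d S → ℝ) := by
  intro σ η h
  simp [X, h k (by simp)]

lemma X_local (k : Site d) : IsLocalFn (X k : Config d S → ℝ) := (X_dep k).loc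

lemma X_mono (k : Site d) : Rel (X k : Config d S → ℝ) (X k) := fun _ _ h => h k

lemma iterT_X {smin : ↥S} (hsmin : ∀ s : ↥S, smin ≤ s) {r : Site d → Config d S → ↥S → ℝ}
    (hr : Good r) (hti : TranslationInvariant r) (k : Site d) (n : ℕ) (s : ↥S) :
    (T smin r)^[n] (X k) (fun _ => s) = (T smin r)^[n] (X 0) (fun _ => s) := by
  have : (X k : Config d S → ℝ) = fun σ => X 0 (shift k σ) := by
    funext σ; simp [X, shift]
  rw [this, iterT_shift hsmin hr hti k (X_local 0)]
  rfl

/-- Minimal gap of the spin space. -/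
lemma exists_gap (S : Finset ℝ) : ∃ δ > (0 : ℝ), ∀ s t : ↥S, s < t → δ ≤ (t : ℝ) - s := by
  by_cases h : (Finset.univ.filter (fun p : ↥S × ↥S => p.1 < p.2)).Nonempty
  · obtain ⟨p, hp, hmin⟩ := Finset.exists_min_image _
      (fun p : ↥S × ↥S => (p.2 : ℝ) - (p.1 : ℝ)) h
    refine ⟨(p.2 : ℝ) - p.1, sub_pos.2 (Finset.mem_filter.1 hp).2, fun s t hst => ?_⟩
    exact hmin (s, t) (by simpa using hst)
  · refine ⟨1, one_pos, fun s t hst => absurd ⟨(s, t), ?_⟩ h⟩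
    simpa using hst

lemma rel2_lin {F : Finset (Site d)} {f : Config d S → ℝ} (hf : Dep F f) {δ : ℝ} (hδ : 0 < δ)
    (hgap : ∀ s t : ↥S, s < t → δ ≤ (t : ℝ) - s) {v : Site d → ℝ} (hv0 : ∀ k, 0 ≤ v k)
    (hv : ∀ k ∈ F, ∀ σ η : Config d S, (∀ j, j ≠ k → σ j = η j) → |f σ - f η| ≤ v k) :
    Rel2 f (fun σ => ∑ k ∈ F, (v k / δ) * X k σ) := by
  classical
  intro σ η hle
  have key : ∀ A : Finset (Site d), A ⊆ F → |f (A.piecewise η σ) - f σ| ≤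
      ∑ k ∈ A, (v k / δ) * (X k η - X k σ) := by
    intro A
    induction A using Finset.induction_on with
    | empty => intro _; simp
    | insert k A hk ih =>
      intro hA
      have ih' := ih fun x hx => hA (Finset.mem_insert_of_mem hx)
      rw [Finset.sum_insert hk]
      have h1 : |f ((insert k A).piecewise η σ) - f (A.piecewise η σ)| ≤
          (v k / δ) * (X k η - X k σ) := by
        rcases (hle k).eq_or_lt with heq | hlt
        · have : (insert k A).piecewise η σ = A.piecewise η σ := by
            funext j
            by_cases hj : j = k
            · subst hj; simp [Finset.piecewise, hk, heq]
            · simp [Finset.piecewise, hj]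
          rw [this]
          simp [X, heq]
        · have h2 := hv k (hA (Finset.mem_insert_self _ _)) ((insert k A).piecewise η σ)
            (A.piecewise η σ) (fun j hj => by simp [Finset.piecewise, hj])
          refine h2.trans ?_
          have h3 := hgap _ _ hlt
          rw [div_mul_eq_mul_div, le_div_iff₀ hδ]
          exact mul_le_mul_of_nonneg_left h3 (hv0 k)
      calc _ = |(f ((insert k A).piecewise η σ) - f (A.piecewise η σ)) +
              (f (A.piecewise η σ) - f σ)| := by ring_nf
        _ ≤ _ := (abs_add_le _ _).trans (add_le_add h1 ih')
  have h := key F (Finset.Subset.refl _)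
  rw [hf (F.piecewise η σ) η (fun k hk => by simp [hk])] at h
  refine h.trans_eq ?_
  simp only
  rw [← Finset.sum_sub_distrib]
  exact Finset.sum_congr rfl fun k _ => by ring

/-- The basic quantity: difference of magnetisations at the origin at time `n`. -/
noncomputable def aa (smax smin : ↥S) (r : Site d → Config d S → ↥S → ℝ) (n : ℕ) : ℝ :=
  (T smin r)^[n] (X 0) (fun _ => smax) - (T smin r)^[n] (X 0) (fun _ => smin)

lemma osc_bound {smax smin : ↥S} (hsmin : ∀ s : ↥S, smin ≤ s) (hsmax : ∀ s : ↥S, s ≤ smax)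
    {r : Site d → Config d S → ↥S → ℝ}
    (hr : Good r) (hti : TranslationInvariant r) (hatt : Dom r r)
    {F : Finset (Site d)} {f : Config d S → ℝ} (hf : Dep F f) {δ : ℝ} (hδ : 0 < δ)
    (hgap : ∀ s t : ↥S, s < t → δ ≤ (t : ℝ) - s) {v : Site d → ℝ} (hv0 : ∀ k, 0 ≤ v k)
    (hv : ∀ k ∈ F, ∀ σ η : Config d S, (∀ j, j ≠ k → σ j = η j) → |f σ - f η| ≤ v k)
    (n : ℕ) (σ : Config d S) :
    |(T smin r)^[n] f σ - (T smin r)^[n] f (fun _ => smin)| ≤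
      (∑ k ∈ F, v k) / δ * aa smax smin r n := by
  have hloc := local_sum F (fun k => v k / δ) (fun k => X_local (S := S) k)
  have h := iterT_rel2 hsmin hr hatt hf.loc hloc (rel2_lin hf hδ hgap hv0 hv) n
  refine (h _ σ (fun k => hsmin _)).trans ?_
  have h2 := h σ (fun _ => smax) (fun k => hsmax _)
  have h3 := (abs_nonneg _).trans h2
  have h4 : (T smin r)^[n] (fun σ => ∑ k ∈ F, (v k / δ) * X k σ) (fun _ => smax) -
      (T smin r)^[n] (fun σ => ∑ k ∈ F, (v k / δ) * X k σ) (fun _ => smin) =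
      (∑ k ∈ F, v k) / δ * aa smax smin r n := by
    rw [iterT_sum hsmin hr F _ (fun k => X_local k), iterT_sum hsmin hr F _ (fun k => X_local k),
      ← Finset.sum_sub_distrib, Finset.sum_div, Finset.sum_mul]
    refine Finset.sum_congr rfl fun k _ => ?_
    rw [iterT_X hsmin hr hti k n smax, iterT_X hsmin hr hti k n smin, aa]
    ring
  linarith

end Stmt4

namespace Stmt4

open Filter Topology

variable {d : ℕ} {S : Finset ℝ}

open Classical in
/-- The finite volume dynamics as an updating family on the whole lattice. -/
noncomputable def fam (Λ : Finset (Site d)) (τ : Config d S) (r : Site d → Config d S → ↥S → ℝ) :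
    Site d → Config d S → ↥S → ℝ :=
  fun k η s => if k ∈ Λ then r k (fun j => if j ∈ Λ then η j else τ j) s
    else if s = τ k then 1 else 0

lemma fam_of_mem {Λ : Finset (Site d)} {τ : Config d S} {r : Site d → Config d S → ↥S → ℝ}
    {k : Site d} (hk : k ∈ Λ) (η : Config d S) :
    fam Λ τ r k η = r k (patch Λ (fun j => η j) τ) := by
  classical
  funext s
  simp only [fam, hk, if_true]
  congr 1

lemma fam_of_notMem {Λ : Finset (Site d)} {τ : Config d S} {r : Site d → Config d S → ↥S → ℝ}
    {k : Site d} (hk : k ∉ Λ) (η η' : Config d S) :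
    fam Λ τ r k η = fam Λ τ r k η' := by
  funext s
  simp [fam, hk]

lemma fam_good {Λ : Finset (Site d)} {τ : Config d S} {r : Site d → Config d S → ↥S → ℝ}
    (hr : Good r) : Good (fam Λ τ r) := by
  classical
  refine ⟨⟨fun k η s => ?_, fun k η => ?_⟩, fun k => ⟨Λ, fun η η' h s => ?_⟩⟩
  · unfold fam
    split_ifs
    · exact hr.upd.1 _ _ _
    · exact zero_le_one
    · exact le_rfl
  · by_cases hk : k ∈ Λ
    · rw [fam_of_mem hk]; exact hr.upd.2 _ _
    · simp [fam, hk]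
  · by_cases hk : k ∈ Λ
    · rw [fam_of_mem hk, fam_of_mem hk]
      congr 1
      funext j
      by_cases hj : j ∈ Λ
      · simp [patch, hj, h j hj]
      · simp [patch, hj]
    · rw [fam_of_notMem hk η η']

lemma fam_T_dep {Λ : Finset (Site d)} {τ : Config d S} {r : Site d → Config d S → ↥S → ℝ}
    {smin : ↥S} (f : Config d S → ℝ) : Dep Λ (T smin (fam Λ τ r) f) := by
  intro η η' h
  have : ∀ k, fam Λ τ r k η = fam Λ τ r k η' := by
    intro k
    by_cases hk : k ∈ Λ
    · rw [fam_of_mem hk, fam_of_mem hk]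
      congr 1
      funext j
      by_cases hj : j ∈ Λ
      · simp [patch, hj, h j hj]
      · simp [patch, hj]
    · rw [fam_of_notMem hk η η']
  unfold T step
  simp_rw [this]

lemma fam_iterT_dep {Λ : Finset (Site d)} {τ : Config d S} {r : Site d → Config d S → ↥S → ℝ}
    {smin : ↥S} {f : Config d S → ℝ} (hf : Dep Λ f) (n : ℕ) :
    Dep Λ ((T smin (fam Λ τ r))^[n] f) := by
  cases n with
  | zero => exact hf
  | succ n => rw [Function.iterate_succ_apply']; exact fam_T_dep _

lemma patch_le_patch {Λ Λ' : Finset (Site d)} {η η' τ τ' : Config d S} 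
    (h : ∀ j, (if j ∈ Λ then η j else τ j) ≤ (if j ∈ Λ' then η' j else τ' j)) :
    patch Λ (fun j => η j) τ ≤ patch Λ' (fun j => η' j) τ' := by
  intro j
  have := h j
  by_cases h1 : j ∈ Λ <;> by_cases h2 : j ∈ Λ' <;> simpa [patch, h1, h2] using this

lemma tailG_dirac_max {smax : ↥S} (hsmax : ∀ s : ↥S, s ≤ smax) {Λ : Finset (Site d)}
    {r : Site d → Config d S → ↥S → ℝ} {k : Site d} (hk : k ∉ Λ) (η : Config d S) (s : ↥S) :
    tailG (fam Λ (fun _ => smax) r k η) s = 1 := by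
  classical
  simp [tailG, fam, hk, hsmax, Finset.sum_ite_eq']

lemma tailG_dirac_min {smin : ↥S} (hsmin : ∀ s : ↥S, smin ≤ s) {Λ : Finset (Site d)}
    {r : Site d → Config d S → ↥S → ℝ} {k : Site d} (hk : k ∉ Λ) (η : Config d S)
    {q : ↥S → ℝ} (hq : ∀ s, 0 ≤ q s) (hq1 : ∑ s, q s = 1) (s : ↥S) :
    tailG (fam Λ (fun _ => smin) r k η) s ≤ tailG q s := by
  classical
  by_cases hs : s = smin
  · subst hs
    rw [tailG_min hsmin hq1, tailG_min hsmin]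
    simp [fam, hk]
  · have : tailG (fam Λ (fun _ => smin) r k η) s = 0 := by
      have h : ¬ s ≤ smin := fun h => hs (le_antisymm h (hsmin s))
      simp [tailG, fam, hk, Finset.sum_ite_eq', h]
    rw [this]
    exact Finset.sum_nonneg fun _ _ => hq _

/-- Larger boxes with maximal boundary condition are dominated. -/
lemma dom_max {smax : ↥S} (hsmax : ∀ s : ↥S, s ≤ smax)
    {r : Site d → Config d S → ↥S → ℝ} (hr : Good r) (hatt : Dom r r)
    {Λ Λ' : Finset (Site d)} (hΛ : Λ ⊆ Λ') :
    Dom (fam Λ' (fun _ => smax) r) (fam Λ (fun _ => smax) r) := by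
  intro η η' hle k s
  by_cases hk : k ∈ Λ
  · rw [fam_of_mem hk, fam_of_mem (hΛ hk)]
    apply hatt
    apply patch_le_patch
    intro j
    by_cases hj : j ∈ Λ
    · simpa [hj, hΛ hj] using hle j
    · simp [hj, hsmax]
  · rw [tailG_dirac_max hsmax hk]
    exact tailG_le_one ((fam_good hr).upd.1 _ _) ((fam_good hr).upd.2 _ _) _

lemma dom_max' {smax : ↥S} (hsmax : ∀ s : ↥S, s ≤ smax)
    {r : Site d → Config d S → ↥S → ℝ} (hr : Good r) (hatt : Dom r r)
    (Λ : Finset (Site d)) : Dom r (fam Λ (fun _ => smax) r) := by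
  intro η η' hle k s
  by_cases hk : k ∈ Λ
  · rw [fam_of_mem hk]
    apply hatt
    intro j
    by_cases hj : j ∈ Λ
    · simpa [patch, hj] using hle j
    · simp [patch, hj, hsmax]
  · rw [tailG_dirac_max hsmax hk]
    exact tailG_le_one (hr.upd.1 _ _) (hr.upd.2 _ _) _

lemma dom_min {smin : ↥S} (hsmin : ∀ s : ↥S, smin ≤ s)
    {r : Site d → Config d S → ↥S → ℝ} (hr : Good r) (hatt : Dom r r)
    {Λ Λ' : Finset (Site d)} (hΛ : Λ ⊆ Λ') :
    Dom (fam Λ (fun _ => smin) r) (fam Λ' (fun _ => smin) r) := by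
  intro η η' hle k s
  by_cases hk : k ∈ Λ
  · rw [fam_of_mem hk, fam_of_mem (hΛ hk)]
    apply hatt
    apply patch_le_patch
    intro j
    by_cases hj : j ∈ Λ
    · simpa [hj, hΛ hj] using hle j
    · simp [hj, hsmin]
  · exact tailG_dirac_min hsmin hk _ ((fam_good hr).upd.1 _ _) ((fam_good hr).upd.2 _ _) _

lemma dom_min' {smin : ↥S} (hsmin : ∀ s : ↥S, smin ≤ s)
    {r : Site d → Config d S → ↥S → ℝ} (hr : Good r) (hatt : Dom r r)
    (Λ : Finset (Site d)) : Dom (fam Λ (fun _ => smin) r) r := by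
  intro η η' hle k s
  by_cases hk : k ∈ Λ
  · rw [fam_of_mem hk]
    apply hatt
    intro j
    by_cases hj : j ∈ Λ
    · simpa [patch, hj] using hle j
    · simp [patch, hj, hsmin]
  · exact tailG_dirac_min hsmin hk _ (hr.upd.1 _ _) (hr.upd.2 _ _) _

lemma Dom.trans {r r' r'' : Site d → Config d S → ↥S → ℝ} (h : Dom r r') (h' : Dom r' r'') :
    Dom r r'' := fun η η' hle k s => (h η η (le_refl η) k s).trans (h' η η' hle k s)

lemma fam_T_eq {smin : ↥S} (hsmin : ∀ s : ↥S, smin ≤ s) {r : Site d → Config d S → ↥S → ℝ}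
    (hr : Good r) {Λ : Finset (Site d)} (τ : Config d S) {f : Config d S → ℝ} (hf : Dep Λ f)
    (η : Config d S) :
    T smin (fam Λ τ r) f η =
      ∑ ζ : ↥Λ → ↥S, fvKer r Λ τ (fun j => η j) ζ * f (patch Λ ζ τ) := by
  rw [T_eq_sum hsmin (fam_good hr).upd η hf τ]
  refine Finset.sum_congr rfl fun ζ _ => ?_
  congr 1
  refine Finset.prod_congr rfl fun k _ => ?_
  rw [fam_of_mem k.2]

lemma stat_T {smin : ↥S} (hsmin : ∀ s : ↥S, smin ≤ s) {r : Site d → Config d S → ↥S → ℝ}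
    (hr : Good r) {Λ : Finset (Site d)} {τ : Config d S} {f : Config d S → ℝ} (hf : Dep Λ f)
    {ν : (↥Λ → ↥S) → ℝ} (hν : IsStationaryFV r Λ τ ν) (n : ℕ) :
    ∑ η, ν η * (T smin (fam Λ τ r))^[n] f (patch Λ η τ) = ∑ η, ν η * f (patch Λ η τ) := by
  induction n with
  | zero => rfl
  | succ n ih =>
    rw [← ih]
    simp_rw [Function.iterate_succ_apply', fam_T_eq hsmin hr τ (fam_iterT_dep hf n)]
    have hp : ∀ η : ↥Λ → ↥S, (fun j : ↥Λ => patch Λ η τ j) = η := by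
      intro η; funext j; simp [patch]
    simp_rw [hp, Finset.mul_sum]
    rw [Finset.sum_comm]
    refine Finset.sum_congr rfl fun ζ _ => ?_
    simp_rw [← mul_assoc]
    rw [← Finset.sum_mul, hν.2.2 ζ]

lemma exists_stat {ι : Type*} [Fintype ι] [Nonempty ι] (K : ι → ι → ℝ)
    (h0 : ∀ i j, 0 ≤ K i j) (h1 : ∀ i, ∑ j, K i j = 1) :
    ∃ ν : ι → ℝ, (∀ i, 0 ≤ ν i) ∧ ∑ i, ν i = 1 ∧ ∀ j, ∑ i, ν i * K i j = ν j := by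
  classical
  have hdet : (Matrix.of K - 1).det = 0 := by
    rw [← Matrix.exists_mulVec_eq_zero_iff]
    refine ⟨fun _ => 1, fun h => one_ne_zero (congrFun h (Classical.arbitrary ι)), ?_⟩
    rw [Matrix.sub_mulVec, Matrix.one_mulVec]
    funext i
    simp [Matrix.mulVec, dotProduct, h1]
  obtain ⟨v, hv, hvK⟩ := Matrix.exists_vecMul_eq_zero_iff.2 hdet
  have hvK' : ∀ j, ∑ i, v i * K i j = v j := by
    intro j
    have := congrFun hvK j
    rw [Matrix.vecMul_sub, Matrix.vecMul_one] at this
    simp [Matrix.vecMul, dotProduct, sub_eq_zero] at this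
    exact this
  have hle : ∀ j, |v j| ≤ ∑ i, |v i| * K i j := by
    intro j
    rw [← hvK' j]
    refine (Finset.abs_sum_le_sum_abs _ _).trans (le_of_eq ?_)
    exact Finset.sum_congr rfl fun i _ => by rw [abs_mul, abs_of_nonneg (h0 i j)]
  have hsum : ∑ j, |v j| = ∑ j, ∑ i, |v i| * K i j := by
    rw [Finset.sum_comm]
    refine Finset.sum_congr rfl fun i _ => ?_
    rw [← Finset.mul_sum, h1, mul_one]
  have heq := (Finset.sum_eq_sum_iff_of_le fun j _ => hle j).1 hsum
  have hpos : 0 < ∑ j, |v j| := by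
    obtain ⟨i, hi⟩ := Function.ne_iff.1 hv
    exact Finset.sum_pos' (fun _ _ => abs_nonneg _) ⟨i, Finset.mem_univ _, abs_pos.2 hi⟩
  refine ⟨fun i => |v i| / ∑ j, |v j|, fun i => by positivity, ?_, fun j => ?_⟩
  · rw [← Finset.sum_div, div_self hpos.ne']
  · show ∑ i, |v i| / (∑ j, |v j|) * K i j = |v j| / ∑ j, |v j|
    conv_rhs => rw [heq j (Finset.mem_univ _)]
    rw [Finset.sum_div]
    exact Finset.sum_congr rfl fun i _ => by ring

lemma fvKer_nonneg {r : Site d → Config d S → ↥S → ℝ} (hr : Good r) (Λ : Finset (Site d))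
    (τ : Config d S) (η σ : ↥Λ → ↥S) : 0 ≤ fvKer r Λ τ η σ :=
  Finset.prod_nonneg fun _ _ => hr.upd.1 _ _ _

lemma fvKer_sum {r : Site d → Config d S → ↥S → ℝ} (hr : Good r) (Λ : Finset (Site d))
    (τ : Config d S) (η : ↥Λ → ↥S) : ∑ σ, fvKer r Λ τ η σ = 1 := by
  unfold fvKer
  rw [← Fintype.prod_sum (fun (k : ↥Λ) s => r k (patch Λ η τ) s)]
  exact Finset.prod_eq_one fun k _ => hr.upd.2 _ _

lemma exists_statFV {r : Site d → Config d S → ↥S → ℝ} (hr : Good r) (Λ : Finset (Site d))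
    (τ : Config d S) : ∃ ν, IsStationaryFV r Λ τ ν := by
  have : Nonempty (↥Λ → ↥S) := ⟨fun k => τ k⟩
  exact exists_stat (fvKer r Λ τ) (fvKer_nonneg hr Λ τ) (fvKer_sum hr Λ τ)

/-- Uniform ellipticity. -/
lemma exists_eps {r : Site d → Config d S → ↥S → ℝ} (hne : Nonempty ↥S) (hr : Good r)
    (hnd : NonDegenerate r)
    (hti : TranslationInvariant r) : ∃ ε > (0 : ℝ), ε ≤ 1 ∧ ∀ k η s, ε ≤ r k η s := by
  obtain ⟨V, hV⟩ := hr.loc 0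
  obtain ⟨s0⟩ := hne
  have : Nonempty ((↥V → ↥S) × ↥S) := ⟨fun _ => s0, s0⟩
  obtain ⟨p, hp⟩ := Finite.exists_min
    (fun p : (↥V → ↥S) × ↥S => r 0 (patch V p.1 (fun _ => s0)) p.2)
  refine ⟨_, hnd 0 (patch V p.1 (fun _ => s0)) p.2, ?_, fun k η s => ?_⟩
  · rw [← hr.upd.2 0 (patch V p.1 (fun _ => s0))]
    exact Finset.single_le_sum (f := fun s => r 0 (patch V p.1 (fun _ => s0)) s)
      (fun _ _ => hr.upd.1 _ _ _) (Finset.mem_univ _)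
  · rw [hti k η s, hV _ (patch V (fun j => η (j + k)) (fun _ => s0)) (fun j hj => by
      simp [patch, hj]) s]
    exact hp (_, s)

end Stmt4

namespace Stmt4

open Filter Topology

variable {d : ℕ} {S : Finset ℝ}

lemma mem_ball {L : ℕ} {k : Site d} : k ∈ ball d L ↔ ∑ i, |k i| ≤ (L : ℤ) := by
  unfold ball
  rw [Finset.mem_filter, Finset.mem_Icc]
  refine ⟨fun h => h.2, fun h => ⟨?_, h⟩⟩
  have : ∀ i, |k i| ≤ (L : ℤ) := fun i =>
    (Finset.single_le_sum (f := fun i => |k i|) (fun _ _ => abs_nonneg _)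
      (Finset.mem_univ i)).trans h
  exact ⟨fun i => (abs_le.1 (this i)).1, fun i => (abs_le.1 (this i)).2⟩

lemma ball_mono {L L' : ℕ} (h : L ≤ L') : ball d L ⊆ ball d L' := by
  intro k hk
  rw [mem_ball] at hk ⊢
  exact hk.trans (by exact_mod_cast h)

lemma card_ball_le (L : ℕ) : (ball d L).card ≤ (2 * L + 1) ^ d := by
  refine (Finset.card_filter_le _ _).trans ?_
  rw [Pi.card_Icc]
  simp only [Int.card_Icc, Finset.prod_const, Finset.card_univ, Fintype.card_fin]
  apply le_of_eq
  congr 1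
  omega

lemma exists_ball (V : Finset (Site d)) : ∃ R : ℕ, V ⊆ ball d R := by
  refine ⟨V.sup (fun k => (∑ i, |k i|).toNat), fun k hk => ?_⟩
  rw [mem_ball]
  have := Finset.le_sup (f := fun k : Site d => (∑ i, |k i|).toNat) hk
  have h2 := Int.self_le_toNat (∑ i, |k i|)
  omega

lemma X_dep_ball (L : ℕ) : Dep (ball d L) (X 0 : Config d S → ℝ) :=
  (X_dep 0).mono (by simpa using zero_mem_ball d L)

lemma exists_range {r : Site d → Config d S → ↥S → ℝ} (hr : Good r)
    (hti : TranslationInvariant r) : ∃ R : ℕ, ∀ (smin : ↥S) (m : ℕ),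
      Dep (ball d (R * m)) ((T smin r)^[m] (X 0)) := by
  obtain ⟨V, hV⟩ := hr.loc 0
  obtain ⟨R, hR⟩ := exists_ball V
  refine ⟨R, fun smin m => ?_⟩
  induction m with
  | zero => exact X_dep_ball 0
  | succ m ih =>
    rw [Function.iterate_succ_apply']
    refine T_dep ih fun k hk η η' h s => ?_
    rw [hti k η s, hti k η' s]
    apply hV
    intro j hj
    apply h
    have h1 := mem_ball.1 (hR hj)
    have h2 := mem_ball.1 hk
    rw [mem_ball]
    calc ∑ i, |(j + k) i| ≤ ∑ i, (|j i| + |k i|) :=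
          Finset.sum_le_sum fun i _ => abs_add_le _ _
      _ = ∑ i, |j i| + ∑ i, |k i| := Finset.sum_add_distrib
      _ ≤ R + (R * m : ℕ) := add_le_add h1 h2
      _ = ((R * (m + 1) : ℕ) : ℤ) := by push_cast; ring

/-- All the standing assumptions. -/
structure Ctx (smax smin : ↥S) (r : Site d → Config d S → ↥S → ℝ) : Prop where
  hmax : ∀ s : ↥S, s ≤ smax
  hmin : ∀ s : ↥S, smin ≤ s
  good : Good r
  ti : TranslationInvariant r
  dom : Dom r r

variable {smax smin : ↥S} {r : Site d → Config d S → ↥S → ℝ}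

lemma Ctx.mono (c : Ctx smax smin r) (n : ℕ) :
    Rel ((T smin r)^[n] (X 0)) ((T smin r)^[n] (X 0)) :=
  iterT_rel c.hmin c.good c.good c.dom (X_local 0) (X_local 0) (X_mono 0) n

lemma Ctx.aa_nonneg (c : Ctx smax smin r) (n : ℕ) : 0 ≤ aa smax smin r n :=
  sub_nonneg.2 (c.mono n _ _ fun _ => c.hmin _)

lemma Ctx.aa_zero : aa smax smin r 0 = (smax : ℝ) - smin := rfl

lemma T_le_const (c : Ctx smax smin r) {r' : Site d → Config d S → ↥S → ℝ} (hr : Good r')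
    {f : Config d S → ℝ} (hf : IsLocalFn f)
    {b : ℝ} (h : ∀ σ, f σ ≤ b) (η : Config d S) : T smin r' f η ≤ b := by
  have := integral_mono (hf.integrable_step c.hmin hr.upd η) (integrable_const b)
    (fun u => h (step smin r' η u))
  simpa [T] using this

lemma const_le_T (c : Ctx smax smin r) {r' : Site d → Config d S → ↥S → ℝ} (hr : Good r')
    {f : Config d S → ℝ} (hf : IsLocalFn f)
    {b : ℝ} (h : ∀ σ, b ≤ f σ) (η : Config d S) : b ≤ T smin r' f η := by
  have := integral_mono (integrable_const b) (hf.integrable_step c.hmin hr.upd η)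
    (fun u => h (step smin r' η u))
  simpa [T] using this

lemma Ctx.aa_anti (c : Ctx smax smin r) : Antitone (aa smax smin r) := by
  apply antitone_nat_of_succ_le
  intro n
  unfold aa
  simp only [Function.iterate_succ_apply']
  have hl := iterT_local (smin := smin) c.good.loc (X_local (d := d) (S := S) 0) n
  have h1 := T_le_const c c.good hl (fun σ => c.mono n σ (fun _ => smax) fun _ => c.hmax _)
    (fun _ => smax)
  have h2 := const_le_T c c.good hl (fun σ => c.mono n (fun _ => smin) σ fun _ => c.hmin _)
    (fun _ => smin)
  linarith

/-- Oscillation estimate for an increasing local observable. -/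
lemma Ctx.osc_mono (c : Ctx smax smin r) {F : Finset (Site d)} {f : Config d S → ℝ}
    (hf : Dep F f) {δ : ℝ} (hδ : 0 < δ)
    (hgap : ∀ s t : ↥S, s < t → δ ≤ (t : ℝ) - s) (hm : Rel f f) {b : ℝ}
    (hb : f (fun _ => smax) - f (fun _ => smin) ≤ b) (n : ℕ) :
    (T smin r)^[n] f (fun _ => smax) - (T smin r)^[n] f (fun _ => smin) ≤
      F.card * b / δ * aa smax smin r n := by
  have h1 : ∀ σ, f σ ≤ f (fun _ => smax) := fun σ => hm _ _ fun _ => c.hmax _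
  have h2 : ∀ σ, f (fun _ => smin) ≤ f σ := fun σ => hm _ _ fun _ => c.hmin _
  have hb0 : 0 ≤ b := by linarith [h1 (fun _ => smin)]
  have := osc_bound (smax := smax) c.hmin c.hmax c.good c.ti c.dom hf hδ hgap
    (v := fun _ => b) (fun _ => hb0)
    (fun k _ σ η _ => by
      rw [abs_le]
      constructor <;> linarith [h1 σ, h1 η, h2 σ, h2 η]) n (fun _ => smax)
  refine (le_abs_self _).trans (this.trans_eq ?_)
  simp

lemma Ctx.submult (c : Ctx smax smin r) {δ : ℝ} (hδ : 0 < δ)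
    (hgap : ∀ s t : ↥S, s < t → δ ≤ (t : ℝ) - s) {F : Finset (Site d)} {m : ℕ}
    (hF : Dep F ((T smin r)^[m] (X 0))) (n : ℕ) :
    aa smax smin r (n + m) ≤ F.card * aa smax smin r m / δ * aa smax smin r n := by
  conv_lhs => unfold aa
  rw [Function.iterate_add_apply]
  exact c.osc_mono hF hδ hgap (c.mono m) le_rfl n

/-- Finite volume analogue of `aa`. -/
noncomputable def aL (smax smin : ↥S) (r : Site d → Config d S → ↥S → ℝ) (L n : ℕ) : ℝ :=
  (T smin (fam (ball d L) (fun _ => smax) r))^[n] (X 0) (fun _ => smax) -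
    (T smin (fam (ball d L) (fun _ => smin) r))^[n] (X 0) (fun _ => smin)

lemma Ctx.aL_anti (c : Ctx smax smin r) {l L : ℕ} (h : l ≤ L) (n : ℕ) :
    aL smax smin r L n ≤ aL smax smin r l n := by
  have h1 := iterT_rel c.hmin (fam_good c.good) (fam_good c.good)
    (dom_max c.hmax c.good c.dom (ball_mono (d := d) h)) (X_local 0) (X_local 0) (X_mono 0) n
    (fun _ => smax) (fun _ => smax) le_rfl
  have h2 := iterT_rel c.hmin (fam_good c.good) (fam_good c.good)
    (dom_min c.hmin c.good c.dom (ball_mono (d := d) h)) (X_local 0) (X_local 0) (X_mono 0) n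
    (fun _ => smin) (fun _ => smin) le_rfl
  unfold aL
  linarith

lemma Ctx.aL_nonneg (c : Ctx smax smin r) (L n : ℕ) : 0 ≤ aL smax smin r L n :=
  sub_nonneg.2 (iterT_rel c.hmin (fam_good c.good) (fam_good c.good)
    ((dom_min' c.hmin c.good c.dom _).trans (dom_max' c.hmax c.good c.dom _))
    (X_local 0) (X_local 0) (X_mono 0) n _ _ fun _ => c.hmin _)

lemma atZero_eq {Λ : Finset (Site d)} (h : (0 : Site d) ∈ Λ) (ν : (↥Λ → ↥S) → ℝ)
    (τ : Config d S) : atZero h ν = ∑ σ, ν σ * X 0 (patch Λ σ τ) := by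
  unfold atZero
  refine Finset.sum_congr rfl fun σ _ => ?_
  simp [X, patch, h]

lemma le_avg {ι : Type*} [Fintype ι] {ν f : ι → ℝ} (h0 : ∀ i, 0 ≤ ν i) (h1 : ∑ i, ν i = 1)
    {b : ℝ} (h : ∀ i, b ≤ f i) : b ≤ ∑ i, ν i * f i := by
  calc b = ∑ i, ν i * b := by rw [← Finset.sum_mul, h1, one_mul]
    _ ≤ _ := Finset.sum_le_sum fun i _ => mul_le_mul_of_nonneg_left (h i) (h0 i)

lemma avg_le {ι : Type*} [Fintype ι] {ν f : ι → ℝ} (h0 : ∀ i, 0 ≤ ν i) (h1 : ∑ i, ν i = 1)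
    {b : ℝ} (h : ∀ i, f i ≤ b) : ∑ i, ν i * f i ≤ b := by
  calc _ ≤ ∑ i, ν i * b := Finset.sum_le_sum fun i _ => mul_le_mul_of_nonneg_left (h i) (h0 i)
    _ = b := by rw [← Finset.sum_mul, h1, one_mul]

/-- The main recursive inequality. -/
lemma Ctx.main_rec (c : Ctx smax smin r) {δ : ℝ} (hδ : 0 < δ)
    (hgap : ∀ s t : ↥S, s < t → δ ≤ (t : ℝ) - s) {L : ℕ} {E : ℝ}
    (hA : ∀ νp νm : (↥(ball d L) → ↥S) → ℝ,
          IsStationaryFV r (ball d L) (fun _ => smax) νp →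
          IsStationaryFV r (ball d L) (fun _ => smin) νm →
          atZero (zero_mem_ball d L) νp - atZero (zero_mem_ball d L) νm ≤ E) (n m : ℕ) :
    aa smax smin r (n + m) ≤
      E + 2 * ((ball d L).card * aL smax smin r L m / δ * aa smax smin r n) := by
  obtain ⟨νp, hνp⟩ := exists_statFV c.good (ball d L) (fun _ => smax)
  obtain ⟨νm, hνm⟩ := exists_statFV c.good (ball d L) (fun _ => smin)
  have hE := hA νp νm hνp hνm
  rw [atZero_eq _ νp (fun _ => smax), atZero_eq _ νm (fun _ => smin)] at hE
  rw [← stat_T c.hmin c.good (X_dep_ball L) hνp (n + m),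
    ← stat_T c.hmin c.good (X_dep_ball L) hνm (n + m)] at hE
  set rp := fam (ball d L) (fun _ => smax) r with hrp
  set rm := fam (ball d L) (fun _ => smin) r with hrm
  have gp : Good rp := fam_good c.good
  have gm : Good rm := fam_good c.good
  have dp : Dom r rp := dom_max' c.hmax c.good c.dom _
  have dm : Dom rm r := dom_min' c.hmin c.good c.dom _
  have dpp : Dom rp rp := dom_max c.hmax c.good c.dom (Finset.Subset.refl _)
  have dmm : Dom rm rm := dom_min c.hmin c.good c.dom (Finset.Subset.refl _)
  have lX : IsLocalFn (X 0 : Config d S → ℝ) := X_local 0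
  have mX : Rel (X 0 : Config d S → ℝ) (X 0) := X_mono 0
  set hp := (T smin rp)^[m] (X 0) with hhp
  set hm := (T smin rm)^[m] (X 0) with hhm
  have lp : IsLocalFn hp := iterT_local gp.loc lX m
  have lm : IsLocalFn hm := iterT_local gm.loc lX m
  have mp : Rel hp hp := iterT_rel c.hmin gp gp dpp lX lX mX m
  have mm : Rel hm hm := iterT_rel c.hmin gm gm dmm lX lX mX m
  have mmp : Rel hm hp := iterT_rel c.hmin gm gp (dm.trans dp) lX lX mX m
  have hap : hp (fun _ => smax) - hp (fun _ => smin) ≤ aL smax smin r L m := by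
    have := mmp (fun _ => smin) (fun _ => smin) le_rfl
    unfold aL
    linarith
  have ham : hm (fun _ => smax) - hm (fun _ => smin) ≤ aL smax smin r L m := by
    have := mmp (fun _ => smax) (fun _ => smax) le_rfl
    unfold aL
    linarith
  have o1 := c.osc_mono (fam_iterT_dep (X_dep_ball L) m) hδ hgap mp hap n
  have o2 := c.osc_mono (fam_iterT_dep (X_dep_ball L) m) hδ hgap mm ham n
  have l0 := iterT_local (smin := smin) c.good.loc lX m
  have u1 : (T smin r)^[n + m] (X 0) (fun _ => smax) ≤ (T smin r)^[n] hp (fun _ => smax) := by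
    rw [Function.iterate_add_apply]
    exact iterT_rel c.hmin c.good c.good c.dom l0 lp
      (iterT_rel c.hmin c.good gp dp lX lX mX m) n _ _ le_rfl
  have u2 : (T smin r)^[n] hm (fun _ => smin) ≤ (T smin r)^[n + m] (X 0) (fun _ => smin) := by
    rw [Function.iterate_add_apply]
    exact iterT_rel c.hmin c.good c.good c.dom lm l0
      (iterT_rel c.hmin gm c.good dm lX lX mX m) n _ _ le_rfl
  have w1 : (T smin r)^[n] hp (fun _ => smin) ≤
      ∑ η, νp η * (T smin rp)^[n + m] (X 0) (patch (ball d L) η fun _ => smax) := by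
    apply le_avg hνp.1 hνp.2.1
    intro η
    rw [Function.iterate_add_apply]
    exact iterT_rel c.hmin c.good gp dp lp lp mp n _ _ fun _ => c.hmin _
  have w2 : ∑ η, νm η * (T smin rm)^[n + m] (X 0) (patch (ball d L) η fun _ => smin) ≤
      (T smin r)^[n] hm (fun _ => smax) := by
    apply avg_le hνm.1 hνm.2.1
    intro η
    rw [Function.iterate_add_apply]
    exact iterT_rel c.hmin gm c.good dm lm lm mm n _ _ fun _ => c.hmax _
  conv_lhs => unfold aa
  linarith

lemma Ctx.contract (c : Ctx smax smin r) {ε : ℝ} (hε : 0 < ε) (hε' : ∀ k η s, ε ≤ r k η s)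
    {Λ : Finset (Site d)} (τ : Config d S) {f : Config d S → ℝ} (hf : Dep Λ f) (hm : Rel f f) :
    T smin (fam Λ τ r) f (fun _ => smax) - T smin (fam Λ τ r) f (fun _ => smin) ≤
      (1 - ε ^ Λ.card) * (f (fun _ => smax) - f (fun _ => smin)) := by
  have h1 : ∀ σ, f σ ≤ f (fun _ => smax) := fun σ => hm _ _ fun _ => c.hmax _
  have h2 : ∀ σ, f (fun _ => smin) ≤ f σ := fun σ => hm _ _ fun _ => c.hmin _
  have h3 := const_le_T c (fam_good (Λ := Λ) (τ := τ) c.good) hf.loc h2 (fun _ => smin)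
  set K := fvKer r Λ τ (fun _ => smax) with hK
  have hK0 := fvKer_nonneg c.good Λ τ (fun _ => smax)
  have hK1 := fvKer_sum c.good Λ τ (fun _ => smax)
  have hKε : ε ^ Λ.card ≤ K (fun _ => smin) := by
    have : ε ^ Λ.card = ∏ _k : ↥Λ, ε := by simp
    rw [this]
    exact Finset.prod_le_prod (fun _ _ => hε.le) fun k _ => hε' _ _ _
  have hp : f (patch Λ (fun _ => smin) τ) = f (fun _ => smin) := by
    apply hf
    intro k hk
    simp [patch, hk]
  have h4 : T smin (fam Λ τ r) f (fun _ => smax) =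
      f (fun _ => smax) - ∑ ζ, K ζ * (f (fun _ => smax) - f (patch Λ ζ τ)) := by
    rw [fam_T_eq c.hmin c.good τ hf]
    simp_rw [mul_sub]
    rw [Finset.sum_sub_distrib, ← Finset.sum_mul, hK1]
    ring
  have h5 : K (fun _ => smin) * (f (fun _ => smax) - f (patch Λ (fun _ => smin) τ)) ≤
      ∑ ζ, K ζ * (f (fun _ => smax) - f (patch Λ ζ τ)) :=
    Finset.single_le_sum (f := fun ζ => K ζ * (f (fun _ => smax) - f (patch Λ ζ τ)))
      (fun ζ _ => mul_nonneg (hK0 ζ) (sub_nonneg.2 (h1 _))) (Finset.mem_univ _)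
  rw [hp] at h5
  have h6 := mul_le_mul_of_nonneg_right hKε (sub_nonneg.2 (h2 (fun _ => smax)))
  linarith

lemma Ctx.contract_iter (c : Ctx smax smin r) {ε : ℝ} (hε : 0 < ε) (hε1 : ε ≤ 1)
    (hε' : ∀ k η s, ε ≤ r k η s)
    {Λ : Finset (Site d)} (τ : Config d S) (hd : Dom (fam Λ τ r) (fam Λ τ r))
    {f : Config d S → ℝ} (hf : Dep Λ f) (hm : Rel f f) (n : ℕ) :
    (T smin (fam Λ τ r))^[n] f (fun _ => smax) - (T smin (fam Λ τ r))^[n] f (fun _ => smin) ≤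
      (1 - ε ^ Λ.card) ^ n * (f (fun _ => smax) - f (fun _ => smin)) := by
  have hκ : 0 ≤ 1 - ε ^ Λ.card := sub_nonneg.2 (pow_le_one₀ hε.le hε1)
  induction n with
  | zero => simp
  | succ n ih =>
    rw [Function.iterate_succ_apply']
    have g := fam_good (Λ := Λ) (τ := τ) c.good
    refine (c.contract hε hε' τ (fam_iterT_dep hf n)
      (iterT_rel c.hmin g g hd hf.loc hf.loc hm n)).trans ?_
    rw [pow_succ', mul_assoc]
    exact mul_le_mul_of_nonneg_left ih hκ

lemma Ctx.fv_mix (c : Ctx smax smin r) {ε : ℝ} (hε : 0 < ε) (hε1 : ε ≤ 1)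
    (hε' : ∀ k η s, ε ≤ r k η s) {L : ℕ} {E : ℝ}
    (hA : ∀ νp νm : (↥(ball d L) → ↥S) → ℝ,
          IsStationaryFV r (ball d L) (fun _ => smax) νp →
          IsStationaryFV r (ball d L) (fun _ => smin) νm →
          atZero (zero_mem_ball d L) νp - atZero (zero_mem_ball d L) νm ≤ E) (m : ℕ) :
    aL smax smin r L m ≤
      E + 2 * ((1 - ε ^ (ball d L).card) ^ m * ((smax : ℝ) - smin)) := by
  obtain ⟨νp, hνp⟩ := exists_statFV c.good (ball d L) (fun _ => smax)
  obtain ⟨νm, hνm⟩ := exists_statFV c.good (ball d L) (fun _ => smin)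
  have hE := hA νp νm hνp hνm
  rw [atZero_eq _ νp (fun _ => smax), atZero_eq _ νm (fun _ => smin)] at hE
  rw [← stat_T c.hmin c.good (X_dep_ball L) hνp m,
    ← stat_T c.hmin c.good (X_dep_ball L) hνm m] at hE
  have dpp : Dom (fam (ball d L) (fun _ => smax) r) (fam (ball d L) (fun _ => smax) r) :=
    dom_max c.hmax c.good c.dom (Finset.Subset.refl _)
  have dmm : Dom (fam (ball d L) (fun _ => smin) r) (fam (ball d L) (fun _ => smin) r) :=
    dom_min c.hmin c.good c.dom (Finset.Subset.refl _)
  have k1 := c.contract_iter hε hε1 hε' _ dpp (X_dep_ball L) (X_mono 0) m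
  have k2 := c.contract_iter hε hε1 hε' _ dmm (X_dep_ball L) (X_mono 0) m
  have gp := fam_good (Λ := ball d L) (τ := fun _ => smax) c.good
  have gm := fam_good (Λ := ball d L) (τ := fun _ => smin) c.good
  have w1 := le_avg hνp.1 hνp.2.1 (fun η : ↥(ball d L) → ↥S =>
    iterT_rel c.hmin gp gp dpp (X_local 0) (X_local 0) (X_mono 0) m (fun _ => smin)
      (patch (ball d L) η fun _ => smax) fun _ => c.hmin _)
  have w2 := avg_le hνm.1 hνm.2.1 (fun η : ↥(ball d L) → ↥S =>
    iterT_rel c.hmin gm gm dmm (X_local 0) (X_local 0) (X_mono 0) m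
      (patch (ball d L) η fun _ => smin) (fun _ => smax) fun _ => c.hmax _)
  simp only [X] at k1 k2
  unfold aL
  linarith

end Stmt4

namespace Stmt4

open Filter Topology

lemma ev_small {M : ℝ} (hM : 0 < M) (K : ℝ) (p : ℕ) :
    ∀ᶠ l : ℕ in atTop, K * (l : ℝ) ^ p * Real.exp (-M * l) ≤ 1 / 2 := by
  have h := (tendsto_pow_const_mul_const_pow_of_abs_lt_one p (r := Real.exp (-M))
    (by rw [abs_of_pos (Real.exp_pos _)]; exact Real.exp_lt_one_iff.2 (by linarith))).const_mul K
  rw [mul_zero] at h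
  filter_upwards [h.eventually (ge_mem_nhds (show (0 : ℝ) < 1 / 2 by norm_num))] with l hl
  have : Real.exp (-M * l) = Real.exp (-M) ^ l := by
    rw [← Real.exp_nat_mul]; ring_nf
  rw [this, mul_assoc]
  exact hl

lemma geom_rec {a : ℕ → ℝ} {m : ℕ} {E D : ℝ} (h0 : a 0 ≤ D) (hE : 0 ≤ E)
    (h : ∀ n, a (n + m) ≤ E + a n / 2) (j : ℕ) : a (j * m) ≤ 2 * E + D * (1 / 2) ^ j := by
  induction j with
  | zero => simp; linarith
  | succ j ih =>
    have := h (j * m)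
    rw [Nat.succ_mul, pow_succ]
    linarith

lemma exp_decay {a : ℕ → ℝ} (ha : Antitone a) (hpos : ∀ n, 0 ≤ a n) {n0 : ℕ} (hn0 : 1 ≤ n0)
    (h : ∀ n, a (n + n0) ≤ a n / 2) :
    ∃ lam > (0 : ℝ), ∀ n : ℕ, a n ≤ 2 * a 0 * Real.exp (-lam * n) := by
  have hn0' : (0 : ℝ) < n0 := by exact_mod_cast hn0
  refine ⟨Real.log 2 / n0, div_pos (Real.log_pos (by norm_num)) hn0', fun n => ?_⟩
  have h1 := geom_rec (a := a) (m := n0) (E := 0) le_rfl le_rfl (fun n => by linarith [h n])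
    (n / n0)
  have h2 : a n ≤ a (n / n0 * n0) := ha (Nat.div_mul_le_self n n0)
  have h3 : ((1 : ℝ) / 2) ^ (n / n0) ≤ 2 * Real.exp (-(Real.log 2 / n0) * n) := by
    have e1 : ((1 : ℝ) / 2) ^ (n / n0) = Real.exp (-Real.log 2 * (n / n0 : ℕ)) := by
      rw [mul_comm, Real.exp_nat_mul, Real.exp_neg, Real.exp_log (by norm_num)]
      norm_num
    have e2 : (2 : ℝ) * Real.exp (-(Real.log 2 / n0) * n) =
        Real.exp (Real.log 2 + -(Real.log 2 / n0) * n) := by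
      rw [Real.exp_add, Real.exp_log (by norm_num)]
    rw [e1, e2, Real.exp_le_exp]
    have hl : 0 < Real.log 2 := Real.log_pos (by norm_num)
    have h4 : (n : ℝ) / n0 ≤ (n / n0 : ℕ) + 1 := by
      rw [div_le_iff₀ hn0']
      have := (Nat.lt_div_mul_add (a := n) hn0).le
      have h5 : (n : ℝ) ≤ (n / n0 : ℕ) * n0 + n0 := by exact_mod_cast this
      linarith
    have h5 : Real.log 2 / n0 * n = Real.log 2 * (n / n0) := by ring
    have h6 := mul_le_mul_of_nonneg_left h4 hl.le
    linarith
  have h4 := mul_le_mul_of_nonneg_left h3 (hpos 0)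
  linarith

lemma abstract_decay {d : ℕ} (hd : 1 ≤ d) {a : ℕ → ℝ} (ha : Antitone a) (hpos : ∀ n, 0 ≤ a n)
    {δ C M ε : ℝ} (hδ : 0 < δ) (hC : 0 < C) (hM : 0 < M) (hε : 0 < ε) (hε1 : ε ≤ 1)
    {R L₁ : ℕ}
    (hsub : ∀ n m, a (n + m) ≤ (2 * (R * m : ℕ) + 1 : ℝ) ^ d * a m / δ * a n)
    (hrec : ∀ l L : ℕ, L₁ ≤ l → l ≤ L → ∀ n m, a (n + m) ≤ C * Real.exp (-M * L) +
      2 * ((2 * L + 1 : ℝ) ^ d * (C * Real.exp (-M * l) +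
        2 * ((1 - ε ^ ((2 * l + 1) ^ d)) ^ m * a 0)) / δ * a n)) :
    ∃ lam > (0 : ℝ), ∀ n : ℕ, a n ≤ 2 * a 0 * Real.exp (-lam * n) := by
  set D := a 0 with hD
  have hD0 : 0 ≤ D := hpos 0
  set b : ℝ := -Real.log ε with hb
  have hb0 : 0 ≤ b := by
    have := Real.log_nonpos hε.le hε1
    linarith
  obtain ⟨J, hJ⟩ : ∃ J : ℕ, ((1 : ℝ) / 2) ^ J < Real.exp (-M) :=
    exists_pow_lt_of_lt_one (Real.exp_pos _) (by norm_num)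
  have hJ1 : 1 ≤ J := by
    by_contra h
    have : J = 0 := by omega
    subst this
    have := Real.exp_lt_one_iff (x := -M) |>.2 (by linarith)
    simp at hJ
    linarith
  set Q : ℝ := 2 * R * J * (M + 1) + 1 with hQ
  have hQ0 : 0 ≤ Q := by positivity
  obtain ⟨l, ⟨⟨⟨hl1, hl2⟩, hl3⟩, hl4⟩, hl5⟩ := ((((eventually_ge_atTop L₁).and
    (eventually_ge_atTop 1)).and (ev_small hM (2 * (3 ^ d * (C + 2 * D) / δ)) ((d + 1) * d))).and
    (ev_small hM (Q ^ d * (2 * C + D) / δ) ((d + 2) * d))).and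
    (eventually_ge_atTop ⌈(d * (b * 3 ^ d) + M) / M⌉₊) |>.exists
  have hlr : (1 : ℝ) ≤ l := by exact_mod_cast hl2
  have hl5' : d * (b * 3 ^ d) + M ≤ M * l := by
    have : (d * (b * 3 ^ d) + M) / M ≤ l := (Nat.le_ceil _).trans (by exact_mod_cast hl5)
    rw [div_le_iff₀ hM] at this
    linarith
  set N : ℕ := (2 * l + 1) ^ d with hN
  set κ : ℝ := ε ^ N with hκ
  have hκ0 : 0 < κ := pow_pos hε _
  have hκ1 : κ ≤ 1 := pow_le_one₀ hε.le hε1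
  set m : ℕ := ⌈M * l / κ⌉₊ with hm
  have hm0 : M * l / κ ≤ m := Nat.le_ceil _
  have hm1 : 1 ≤ m := Nat.one_le_ceil_iff.2 (by positivity)
  set L : ℕ := l ^ (d + 1) with hL
  have hlL : l ≤ L := Nat.le_self_pow (by omega) l
  have hL1 : 1 ≤ L := hl2.trans hlL
  -- mixing in the small box
  have hmix : (1 - κ) ^ m ≤ Real.exp (-M * l) := by
    have h1 : 1 - κ ≤ Real.exp (-κ) := by
      have := Real.add_one_le_exp (-κ); linarith
    refine (pow_le_pow_left₀ (by linarith) h1 m).trans ?_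
    rw [← Real.exp_nat_mul, Real.exp_le_exp]
    rw [div_le_iff₀ hκ0] at hm0
    linarith
  have hstep : ∀ n, a (n + m) ≤ C * Real.exp (-M * L) + a n / 2 := by
    intro n
    refine (hrec l L hl1 hlL n m).trans ?_
    have h1 : (2 * L + 1 : ℝ) ^ d ≤ 3 ^ d * (l : ℝ) ^ ((d + 1) * d) := by
      rw [pow_mul, ← mul_pow]
      apply pow_le_pow_left₀ (by positivity)
      have hLr : (L : ℝ) = (l : ℝ) ^ (d + 1) := by rw [hL]; push_cast; rfl
      have : (1 : ℝ) ≤ L := by exact_mod_cast hL1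
      rw [← hLr]
      linarith
    have h2 : C * Real.exp (-M * l) + 2 * ((1 - κ) ^ m * D) ≤ (C + 2 * D) * Real.exp (-M * l) := by
      have := mul_le_mul_of_nonneg_right hmix hD0
      linarith
    have hbr0 : 0 ≤ C * Real.exp (-M * l) + 2 * ((1 - κ) ^ m * D) := by
      have : 0 ≤ 1 - κ := by linarith
      positivity
    have h3 : 2 * ((2 * L + 1 : ℝ) ^ d * (C * Real.exp (-M * l) + 2 * ((1 - κ) ^ m * D)) / δ)
        ≤ 1 / 2 := by
      refine le_trans ?_ hl3
      have := mul_le_mul h1 h2 hbr0 (by positivity)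
      have h4 := div_le_div_of_nonneg_right this hδ.le
      calc _ ≤ 2 * (3 ^ d * (l : ℝ) ^ ((d + 1) * d) * ((C + 2 * D) * Real.exp (-M * l)) / δ) := by
            linarith
        _ = _ := by ring
    have h4 := mul_le_mul_of_nonneg_right h3 (hpos n)
    linarith
  have hn0 := geom_rec (a := a) (D := D) le_rfl (by positivity) hstep (J * L)
  have hJL : ((1 : ℝ) / 2) ^ (J * L) ≤ Real.exp (-M * L) := by
    rw [pow_mul]
    refine (pow_le_pow_left₀ (by positivity) hJ.le L).trans_eq ?_
    rw [← Real.exp_nat_mul]; ring_nf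
  have hn0' : a (J * L * m) ≤ (2 * C + D) * Real.exp (-M * L) := by
    have := mul_le_mul_of_nonneg_left hJL hD0
    linarith
  apply exp_decay ha hpos (n0 := J * L * m) (Nat.mul_pos (Nat.mul_pos hJ1 hL1) hm1)
  intro n
  refine (hsub n (J * L * m)).trans ?_
  -- bound on the number of sites
  have hNl : (N : ℝ) ≤ 3 ^ d * (l : ℝ) ^ d := by
    rw [← mul_pow, hN]
    push_cast
    apply pow_le_pow_left₀ (by positivity)
    linarith
  have hκinv : 1 / κ = Real.exp (b * N) := by
    rw [hκ, hb, mul_comm, Real.exp_nat_mul, Real.exp_neg, Real.exp_log hε]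
    simp
  have hexp1 : 1 ≤ Real.exp (b * N) := Real.one_le_exp (by positivity)
  have hmle : (m : ℝ) ≤ (M + 1) * l * Real.exp (b * N) := by
    have h1 : (m : ℝ) < M * l / κ + 1 := Nat.ceil_lt_add_one (by positivity)
    have h2 : M * l / κ = M * l * Real.exp (b * N) := by rw [← hκinv]; ring
    rw [h2] at h1
    have h3 : 1 * 1 ≤ (l : ℝ) * Real.exp (b * N) := mul_le_mul hlr hexp1 zero_le_one (by positivity)
    linarith
  have hsize : (2 * (R * (J * L * m) : ℕ) + 1 : ℝ) ≤
      Q * (l : ℝ) ^ (d + 2) * Real.exp (b * (3 ^ d * (l : ℝ) ^ d)) := by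
    have hexp2 : Real.exp (b * N) ≤ Real.exp (b * (3 ^ d * (l : ℝ) ^ d)) :=
      Real.exp_le_exp.2 (mul_le_mul_of_nonneg_left hNl hb0)
    have hA : (2 * (R * (J * L * m) : ℕ) : ℝ) ≤
        2 * R * J * (l : ℝ) ^ (d + 1) * ((M + 1) * l * Real.exp (b * N)) := by
      have : (2 * (R * (J * L * m) : ℕ) : ℝ) = 2 * R * J * (l : ℝ) ^ (d + 1) * m := by
        rw [hL]; push_cast; ring
      rw [this]
      exact mul_le_mul_of_nonneg_left hmle (by positivity)
    have hB : 1 * 1 ≤ (l : ℝ) ^ (d + 2) * Real.exp (b * N) :=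
      mul_le_mul (one_le_pow₀ hlr) hexp1 zero_le_one (by positivity)
    calc _ ≤ Q * (l : ℝ) ^ (d + 2) * Real.exp (b * N) := by
          rw [hQ]
          have e : 2 * R * J * (l : ℝ) ^ (d + 1) * ((M + 1) * l * Real.exp (b * N)) =
            2 * R * J * (M + 1) * ((l : ℝ) ^ (d + 2) * Real.exp (b * N)) := by ring
          rw [e] at hA
          linarith
      _ ≤ _ := mul_le_mul_of_nonneg_left hexp2 (by positivity)
  have hsize2 : (2 * (R * (J * L * m) : ℕ) + 1 : ℝ) ^ d * Real.exp (-M * L) ≤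
      Q ^ d * (l : ℝ) ^ ((d + 2) * d) * Real.exp (-M * l) := by
    have h1 := pow_le_pow_left₀ (by positivity) hsize d
    have h2 := mul_le_mul_of_nonneg_right h1 (Real.exp_pos (-M * L)).le
    refine h2.trans ?_
    rw [mul_pow, mul_pow, ← pow_mul, ← Real.exp_nat_mul, mul_assoc _ (Real.exp _), ← Real.exp_add]
    apply mul_le_mul_of_nonneg_left _ (by positivity)
    rw [Real.exp_le_exp]
    have hLr : (L : ℝ) = (l : ℝ) ^ d * l := by rw [hL]; push_cast; ring
    rw [hLr]
    have h3 : (l : ℝ) ≤ (l : ℝ) ^ d := le_self_pow₀ hlr (by omega)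
    have h4 := mul_le_mul_of_nonneg_left hl5' (show (0 : ℝ) ≤ (l : ℝ) ^ d by positivity)
    have h5 := mul_le_mul_of_nonneg_left h3 hM.le
    linarith
  have hfin : (2 * (R * (J * L * m) : ℕ) + 1 : ℝ) ^ d * a (J * L * m) / δ ≤ 1 / 2 := by
    refine le_trans ?_ hl4
    have h1 := mul_le_mul_of_nonneg_left hn0'
      (show (0 : ℝ) ≤ (2 * (R * (J * L * m) : ℕ) + 1 : ℝ) ^ d by positivity)
    have h2 := mul_le_mul_of_nonneg_left hsize2 (show (0 : ℝ) ≤ 2 * C + D by positivity)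
    calc _ ≤ ((2 * C + D) * (Q ^ d * (l : ℝ) ^ ((d + 2) * d) * Real.exp (-M * l))) / δ := by
          apply div_le_div_of_nonneg_right _ hδ.le
          linarith
      _ = _ := by ring
  have := mul_le_mul_of_nonneg_right hfin (hpos n)
  linarith

end Stmt4

namespace Stmt4

open Filter Topology

variable {d : ℕ} {S : Finset ℝ}

/-! ### Exponential decay of the plus-minus discrepancy -/

lemma aa_decay {smax smin : ↥S} {r : Site d → Config d S → ↥S → ℝ} (hd : 1 ≤ d)
    (c : Ctx smax smin r) (hnd : NonDegenerate r) {δ : ℝ} (hδ : 0 < δ)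
    (hgap : ∀ s t : ↥S, s < t → δ ≤ (t : ℝ) - s) {C M : ℝ} (hC : 0 < C) (hM : 0 < M) {L₁ : ℕ}
    (hA : ∀ L : ℕ, L₁ ≤ L →
        ∀ νp νm : (↥(ball d L) → ↥S) → ℝ,
          IsStationaryFV r (ball d L) (fun _ => smax) νp →
          IsStationaryFV r (ball d L) (fun _ => smin) νm →
          atZero (zero_mem_ball d L) νp - atZero (zero_mem_ball d L) νm
            ≤ C * Real.exp (-M * L)) :
    ∃ lam > (0 : ℝ), ∀ n : ℕ, aa smax smin r n ≤
      2 * aa smax smin r 0 * Real.exp (-lam * n) := by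
  obtain ⟨R, hR⟩ := exists_range c.good c.ti
  obtain ⟨ε, hε, hε1, hε'⟩ := exists_eps ⟨smin⟩ c.good hnd c.ti
  have hcard : ∀ L : ℕ, ((ball d L).card : ℝ) ≤ (2 * L + 1 : ℝ) ^ d := fun L => by
    exact_mod_cast card_ball_le (d := d) L
  refine abstract_decay (R := R) (L₁ := L₁) hd c.aa_anti c.aa_nonneg hδ hC hM hε hε1 ?_ ?_
  · intro n m
    refine (c.submult hδ hgap (hR smin m) n).trans ?_
    have h1 := c.aa_nonneg m
    have h2 := c.aa_nonneg n
    have h3 := hcard (R * m)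
    gcongr
  · intro l L hl hlL n m
    refine (c.main_rec hδ hgap (hA L (hl.trans hlL)) n m).trans ?_
    have h2 := c.aa_nonneg n
    have h0 : 0 ≤ aa smax smin r 0 := c.aa_nonneg 0
    have hp : (1 - ε ^ (ball d l).card) ^ m ≤ (1 - ε ^ ((2 * l + 1) ^ d)) ^ m := by
      apply pow_le_pow_left₀
      · have := pow_le_one₀ (n := (ball d l).card) hε.le hε1
        linarith
      · have := pow_le_pow_of_le_one hε.le hε1 (card_ball_le (d := d) l)
        linarith
    have hL : aL smax smin r L m ≤ C * Real.exp (-M * l) +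
        2 * ((1 - ε ^ ((2 * l + 1) ^ d)) ^ m * aa smax smin r 0) := by
      refine (c.aL_anti hlL m).trans ((c.fv_mix hε hε1 hε' (hA l hl) m).trans ?_)
      rw [← Ctx.aa_zero (r := r)]
      gcongr
    have h3 := hcard L
    have h4 := c.aL_nonneg L m
    gcongr

/-! ### The seminorm -/

lemma varAt_bddAbove (k : Site d) {f : Config d S → ℝ} (hf : IsLocalFn f) :
    BddAbove {x : ℝ | ∃ σ η : Config d S, (∀ j, j ≠ k → σ j = η j) ∧ x = |f σ - f η|} := by
  obtain ⟨B, hB⟩ := hf.bdd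
  refine ⟨B + B, ?_⟩
  rintro x ⟨σ, η, -, rfl⟩
  exact (abs_sub _ _).trans (add_le_add (hB _) (hB _))

lemma le_varAt {k : Site d} {f : Config d S → ℝ} (hf : IsLocalFn f) {σ η : Config d S}
    (h : ∀ j, j ≠ k → σ j = η j) : |f σ - f η| ≤ varAt k f :=
  le_csSup (varAt_bddAbove k hf) ⟨σ, η, h, rfl⟩

lemma varAt_nonneg (k : Site d) (f : Config d S → ℝ) : 0 ≤ varAt k f := by
  apply Real.sSup_nonneg
  rintro x ⟨σ, η, -, rfl⟩
  exact abs_nonneg _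

lemma varAt_eq_zero {F : Finset (Site d)} {f : Config d S → ℝ} (hf : Dep F f) {k : Site d}
    (hk : k ∉ F) : varAt k f = 0 := by
  apply le_antisymm _ (varAt_nonneg k f)
  apply Real.sSup_nonpos
  rintro x ⟨σ, η, h, rfl⟩
  rw [hf σ η fun j hj => h j fun e => hk (e ▸ hj)]
  simp

lemma norm3_eq {F : Finset (Site d)} {f : Config d S → ℝ} (hf : Dep F f) :
    norm3 f = ∑ k ∈ F, varAt k f := by
  apply finsum_eq_sum_of_support_subset
  intro k hk
  by_contra h
  exact hk (varAt_eq_zero hf h)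

lemma norm3_nonneg (f : Config d S → ℝ) : 0 ≤ norm3 f := finsum_nonneg fun k => varAt_nonneg k f

lemma osc_norm3 {smax smin : ↥S} {r : Site d → Config d S → ↥S → ℝ}
    (c : Ctx smax smin r) {δ : ℝ} (hδ : 0 < δ)
    (hgap : ∀ s t : ↥S, s < t → δ ≤ (t : ℝ) - s) {f : Config d S → ℝ} (hf : IsLocalFn f)
    (n : ℕ) (σ η : Config d S) :
    |(T smin r)^[n] f σ - (T smin r)^[n] f η| ≤ 2 * (norm3 f / δ * aa smax smin r n) := by
  obtain ⟨F, hF⟩ := id hf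
  have hF : Dep F f := hF
  have h := osc_bound (smax := smax) c.hmin c.hmax c.good c.ti c.dom hF hδ hgap
    (v := fun k => varAt k f) (fun k => varAt_nonneg k f)
    (fun k _ σ η h => le_varAt hf h) n
  rw [← norm3_eq hF] at h
  have h1 := abs_le.1 (h σ)
  have h2 := abs_le.1 (h η)
  rw [abs_le]
  constructor <;> linarith

/-! ### The semigroup acting on local functions -/

lemma integral_bind_local {smin : ↥S} (hsmin : ∀ s : ↥S, smin ≤ s)
    {r : Site d → Config d S → ↥S → ℝ} (hr : IsUpdating r)
    {P : Kernel (Config d S) (Config d S)} [IsMarkovKernel P] (hP : IsPCAOf r P)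
    (μ : Measure (Config d S)) [IsProbabilityMeasure μ] {f : Config d S → ℝ} (hf : IsLocalFn f) :
    ∫ σ, f σ ∂(μ.bind fun η => P η) = ∫ η, T smin r f η ∂μ := by
  have h := Kernel.integral_comp (κ := Kernel.const Unit μ) (η := P) (a := ()) (f := f)
    (hf.integrable _)
  rw [Kernel.comp_apply, Kernel.const_apply] at h
  rw [h]
  exact integral_congr_ae (ae_of_all _ fun η => T_eq_integral hsmin hr hP η hf)

lemma bind_prob {P : Kernel (Config d S) (Config d S)} [IsMarkovKernel P]
    (μ : Measure (Config d S)) [IsProbabilityMeasure μ] :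
    IsProbabilityMeasure (μ.bind fun η => P η) :=
  isProbabilityMeasure_bind P.measurable.aemeasurable (ae_of_all _ fun η => inferInstance)

lemma iter_prob {P : Kernel (Config d S) (Config d S)} [IsMarkovKernel P] (n : ℕ)
    (σ : Config d S) : IsProbabilityMeasure (iter P n σ) := by
  induction n with
  | zero => unfold iter; infer_instance
  | succ n ih => unfold iter; exact bind_prob _

lemma integral_iter {smin : ↥S} (hsmin : ∀ s : ↥S, smin ≤ s)
    {r : Site d → Config d S → ↥S → ℝ} (hr : Good r)
    {P : Kernel (Config d S) (Config d S)} [IsMarkovKernel P] (hP : IsPCAOf r P) (n : ℕ)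
    (σ : Config d S) {f : Config d S → ℝ} (hf : IsLocalFn f) :
    ∫ x, f x ∂(iter P n σ) = (T smin r)^[n] f σ := by
  induction n generalizing f with
  | zero =>
    unfold iter
    rw [integral_dirac' _ _ hf.meas.stronglyMeasurable]
    rfl
  | succ n ih =>
    have := iter_prob (P := P) n σ
    unfold iter
    rw [integral_bind_local hsmin hr.upd hP _ hf, ih (T_local hr.loc hf),
      Function.iterate_succ_apply]

lemma integral_stat {smin : ↥S} (hsmin : ∀ s : ↥S, smin ≤ s)
    {r : Site d → Config d S → ↥S → ℝ} (hr : Good r)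
    {P : Kernel (Config d S) (Config d S)} [IsMarkovKernel P] (hP : IsPCAOf r P)
    {ν : Measure (Config d S)} [IsProbabilityMeasure ν] (hν : ν.bind (fun η => P η) = ν) (n : ℕ)
    {f : Config d S → ℝ} (hf : IsLocalFn f) :
    ∫ x, (T smin r)^[n] f x ∂ν = ∫ x, f x ∂ν := by
  induction n with
  | zero => rfl
  | succ n ih =>
    rw [Function.iterate_succ_apply',
      ← integral_bind_local hsmin hr.upd hP ν (iterT_local hr.loc hf n), hν, ih]

/-! ### Local functions determine measures -/

lemma ext_local {μ ν : Measure (Config d S)} [IsProbabilityMeasure μ] [IsProbabilityMeasure ν]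
    (h : ∀ f : Config d S → ℝ, IsLocalFn f → ∫ x, f x ∂μ = ∫ x, f x ∂ν) : μ = ν := by
  refine ext_of_generate_finite (measurableCylinders fun _ : Site d => ↥S)
    generateFrom_measurableCylinders.symm isPiSystem_measurableCylinders ?_ (by simp)
  intro s hs
  have hms := MeasurableSet.of_mem_measurableCylinders hs
  obtain ⟨F, A, -, rfl⟩ := (mem_measurableCylinders _).1 hs
  have hloc : IsLocalFn ((MeasureTheory.cylinder F A).indicator (1 : Config d S → ℝ)) := by
    refine ⟨F, fun σ η hk => ?_⟩
    have : σ ∈ MeasureTheory.cylinder F A ↔ η ∈ MeasureTheory.cylinder F A := by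
      rw [MeasureTheory.mem_cylinder, MeasureTheory.mem_cylinder]
      have : F.restrict σ = F.restrict η := by
        funext k
        exact hk k k.2
      rw [this]
    by_cases hσ : σ ∈ MeasureTheory.cylinder F A
    · rw [Set.indicator_of_mem hσ, Set.indicator_of_mem (this.1 hσ)]; rfl
    · rw [Set.indicator_of_notMem hσ, Set.indicator_of_notMem (mt this.2 hσ)]
  have := h _ hloc
  rw [integral_indicator_one hms, integral_indicator_one hms] at this
  exact (measureReal_eq_measureReal_iff).1 this

lemma IsLocalFn.cont {f : Config d S → ℝ} (h : IsLocalFn f) : Continuous f := by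
  obtain ⟨F, hF⟩ := h
  by_cases hne : Nonempty (Config d S)
  · obtain ⟨τ⟩ := hne
    have : f = (fun ζ : ↥F → ↥S => f (patch F ζ τ)) ∘
        (fun (σ : Config d S) (k : ↥F) => σ k) := by
      ext σ
      exact Dep.eq_patch hF τ σ
    rw [this]
    exact continuous_of_discreteTopology.comp (by fun_prop)
  · rw [not_nonempty_iff] at hne
    exact continuous_of_discreteTopology

lemma exists_limit (u : ℕ → Measure (Config d S)) (hu : ∀ n, IsProbabilityMeasure (u n)) :
    ∃ ν : Measure (Config d S), IsProbabilityMeasure ν ∧ ∃ l : Filter ℕ, l.NeBot ∧ l ≤ atTop ∧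
      ∀ f : Config d S → ℝ, IsLocalFn f → Tendsto (fun n => ∫ x, f x ∂(u n)) l
        (𝓝 (∫ x, f x ∂ν)) := by
  let v : ℕ → ProbabilityMeasure (Config d S) := fun n => ⟨u n, hu n⟩
  let U : Ultrafilter (ProbabilityMeasure (Config d S)) := (hyperfilter ℕ).map v
  have hU := U.le_nhds_lim
  refine ⟨(U.lim : ProbabilityMeasure (Config d S)), inferInstance, hyperfilter ℕ,
    inferInstance, Nat.hyperfilter_le_atTop, fun f hf => ?_⟩
  have ht : Tendsto v (hyperfilter ℕ) (𝓝 U.lim) := hU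
  exact ProbabilityMeasure.tendsto_iff_forall_integral_tendsto.1 ht
    (BoundedContinuousFunction.mkOfCompact ⟨f, hf.cont⟩)

lemma iter_sub_stat {smax smin : ↥S} {r : Site d → Config d S → ↥S → ℝ}
    (c : Ctx smax smin r) {δ : ℝ} (hδ : 0 < δ)
    (hgap : ∀ s t : ↥S, s < t → δ ≤ (t : ℝ) - s)
    {P : Kernel (Config d S) (Config d S)} [IsMarkovKernel P] (hP : IsPCAOf r P)
    {ν : Measure (Config d S)} [IsProbabilityMeasure ν] (hν : ν.bind (fun η => P η) = ν)
    {f : Config d S → ℝ} (hf : IsLocalFn f) (n : ℕ) (σ : Config d S) :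
    |(T smin r)^[n] f σ - ∫ x, f x ∂ν| ≤ 2 * (norm3 f / δ * aa smax smin r n) := by
  rw [← integral_stat c.hmin c.good hP hν n hf]
  have hi := (iterT_local (smin := smin) c.good.loc hf n).integrable ν
  have : (T smin r)^[n] f σ - ∫ x, (T smin r)^[n] f x ∂ν =
      ∫ x, ((T smin r)^[n] f σ - (T smin r)^[n] f x) ∂ν := by
    rw [integral_sub (integrable_const _) hi]
    simp
  rw [this]
  have h := norm_integral_le_of_norm_le_const (μ := ν)
    (f := fun x => (T smin r)^[n] f σ - (T smin r)^[n] f x)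
    (ae_of_all _ fun x => osc_norm3 c hδ hgap hf n σ x)
  simpa using h

end Stmt4

open Stmt4 in
/-- (Theorem 1: the spatial mixing condition (A) implies that the PCA
dynamics has a unique stationary measure and converges to it exponentially fast,
uniformly over the initial configuration, for every local function). -/
theorem stmt_4
    (d : ℕ) (hd : 1 ≤ d) (S : Finset ℝ) (hS : S.Nonempty)
    (smax smin : ↥S) (hsmax : ∀ s : ↥S, s ≤ smax) (hsmin : ∀ s : ↥S, smin ≤ s)
    (r : Site d → Config d S → ↥S → ℝ)
    (hupd : IsUpdating r) (hnd : NonDegenerate r) (hloc : IsLocalUpdating r)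
    (hti : TranslationInvariant r) (hatt : Attractive r)
    (P : Kernel (Config d S) (Config d S)) (hMarkov : IsMarkovKernel P)
    (hP : IsPCAOf r P)
    (hA : ∃ C > (0 : ℝ), ∃ M > (0 : ℝ), ∃ L₁ : ℕ, 1 ≤ L₁ ∧
      ∀ L : ℕ, L₁ ≤ L →
        ∀ νp νm : (↥(ball d L) → ↥S) → ℝ,
          IsStationaryFV r (ball d L) (fun _ => smax) νp →
          IsStationaryFV r (ball d L) (fun _ => smin) νm →
          atZero (zero_mem_ball d L) νp - atZero (zero_mem_ball d L) νm
            ≤ C * Real.exp (-M * L)) :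
    ∃ ν : Measure (Config d S), IsProbabilityMeasure ν ∧
      ν.bind (fun η => P η) = ν ∧
      (∀ ν' : Measure (Config d S), IsProbabilityMeasure ν' →
        ν'.bind (fun η => P η) = ν' → ν' = ν) ∧
      ∃ lam > (0 : ℝ), ∃ n₁ : ℕ, 1 ≤ n₁ ∧
        ∀ n : ℕ, n₁ ≤ n → ∀ f : Config d S → ℝ, IsLocalFn f →
          ∀ σ : Config d S,
            |∫ x, f x ∂(iter P n σ) - ∫ x, f x ∂ν| ≤ 2 * norm3 f * Real.exp (-lam * n) := by
  have hMarkov' : IsMarkovKernel P := hMarkov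
  obtain ⟨C, hC, M, hM, L₁, -, hA⟩ := hA
  have c : Ctx smax smin r := ⟨hsmax, hsmin, ⟨hupd, hloc⟩, hti, hatt.dom⟩
  obtain ⟨δ, hδ, hgap⟩ := exists_gap S
  obtain ⟨lam, hlam, hdec⟩ := aa_decay hd c hnd hδ hgap hC hM hA
  have ha0 := c.aa_nonneg 0
  -- convergence of the discrepancy to zero
  have hexp : Filter.Tendsto (fun n : ℕ => Real.exp (-(lam / 2) * n)) Filter.atTop (nhds 0) := by
    refine Real.tendsto_exp_atBot.comp ?_
    exact (tendsto_natCast_atTop_atTop (R := ℝ)).const_mul_atTop_of_neg (by linarith)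
  have haa : Filter.Tendsto (aa smax smin r) Filter.atTop (nhds 0) := by
    refine squeeze_zero c.aa_nonneg (fun n => (hdec n).trans ?_)
      (by simpa using hexp.const_mul (2 * aa smax smin r 0))
    have hn : (0 : ℝ) ≤ n := Nat.cast_nonneg n
    have hln := mul_nonneg hlam.le hn
    gcongr
    linarith
  have hbd : ∀ f : Config d S → ℝ, Filter.Tendsto
      (fun n => 2 * (norm3 f / δ * aa smax smin r n)) Filter.atTop (nhds 0) := fun f => by
    simpa using (haa.const_mul (norm3 f / δ)).const_mul 2
  -- existence
  obtain ⟨ν, hν, l, hl, hle, hlim⟩ := exists_limit (fun n => iter P n (fun _ => smin))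
    (fun n => iter_prob n _)
  have hstat : ν.bind (fun η => P η) = ν := by
    have := bind_prob (P := P) ν
    refine ext_local fun f hf => ?_
    rw [integral_bind_local hsmin hupd hP ν hf]
    have h1 := hlim f hf
    have h2 := hlim _ (T_local (smin := smin) hloc hf)
    simp only [integral_iter hsmin c.good hP _ _ hf] at h1
    simp only [integral_iter hsmin c.good hP _ _ (T_local (smin := smin) hloc hf)] at h2
    have h3 : Filter.Tendsto (fun n => (T smin r)^[n] (T smin r f) (fun _ => smin) -
        (T smin r)^[n] f (fun _ => smin)) l (nhds 0) := by
      refine squeeze_zero_norm (fun n => ?_) ((hbd f).mono_left hle)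
      have hloc' := iterT_local (smin := smin) hloc hf n
      rw [← Function.iterate_succ_apply, Function.iterate_succ_apply',
        ← T_eq_integral hsmin hupd hP _ hloc']
      have : ∫ σ, (T smin r)^[n] f σ ∂(P fun _ => smin) - (T smin r)^[n] f (fun _ => smin) =
          ∫ σ, ((T smin r)^[n] f σ - (T smin r)^[n] f (fun _ => smin)) ∂(P fun _ => smin) := by
        rw [integral_sub (hloc'.integrable _) (integrable_const _)]
        simp
      rw [this]
      have h := norm_integral_le_of_norm_le_const (μ := P fun _ => smin)
        (f := fun x => (T smin r)^[n] f x - (T smin r)^[n] f (fun _ => smin))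
        (ae_of_all _ fun x => osc_norm3 c hδ hgap hf n x (fun _ => smin))
      simpa using h
    have h4 := tendsto_nhds_unique h3 (h2.sub h1)
    linarith
  refine ⟨ν, hν, hstat, ?_, ?_⟩
  · intro ν' hν' hstat'
    refine ext_local fun f hf => ?_
    have key : ∀ (ν : Measure (Config d S)), IsProbabilityMeasure ν →
        ν.bind (fun η => P η) = ν →
        Filter.Tendsto (fun n => (T smin r)^[n] f (fun _ => smin)) Filter.atTop
          (nhds (∫ x, f x ∂ν)) := by
      intro ν hν hs
      rw [tendsto_iff_norm_sub_tendsto_zero]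
      exact squeeze_zero (fun n => norm_nonneg _)
        (fun n => iter_sub_stat c hδ hgap hP hs hf n _) (hbd f)
    exact tendsto_nhds_unique (key ν' hν' hstat') (key ν hν hstat)
  · have hev : ∀ᶠ n : ℕ in Filter.atTop,
        2 * aa smax smin r 0 / δ * Real.exp (-(lam / 2) * n) ≤ 1 := by
      have := hexp.const_mul (2 * aa smax smin r 0 / δ)
      rw [mul_zero] at this
      exact this.eventually (ge_mem_nhds one_pos)
    obtain ⟨n₁, hn₁⟩ := Filter.eventually_atTop.1 hev
    refine ⟨lam / 2, by linarith, max n₁ 1, le_max_right _ _, fun n hn f hf σ => ?_⟩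
    rw [integral_iter hsmin c.good hP n σ hf]
    refine (iter_sub_stat c hδ hgap hP hstat hf n σ).trans ?_
    have h1 := hn₁ n ((le_max_left _ _).trans hn)
    have hN := norm3_nonneg f
    have hE : Real.exp (-lam * n) = Real.exp (-(lam / 2) * n) * Real.exp (-(lam / 2) * n) := by
      rw [← Real.exp_add]; ring_nf
    have h2 := hdec n
    rw [hE] at h2
    have hx := Real.exp_pos (-(lam / 2) * n)
    set x := Real.exp (-(lam / 2) * n) with hxdef
    calc 2 * (norm3 f / δ * aa smax smin r n)
        ≤ 2 * (norm3 f / δ * (2 * aa smax smin r 0 * (x * x))) := by gcongr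
      _ = (2 * norm3 f * x) * (2 * aa smax smin r 0 / δ * x) := by ring
      _ ≤ (2 * norm3 f * x) * 1 := by gcongr
      _ = 2 * norm3 f * x := mul_one _
end

section
/- (Extremality of the finite-volume stationary measures in the boundary condition.) Let (p_k)_{k∈ℤ^d} be a non-degenerate, local, attractive updating family on S^{ℤ^d}, let Λ ⊂ ℤ^d be finite and let τ ∈ S^{ℤ^d} be any boundary condition. If ν_Λ^τ, ν_Λ^{+̂} and ν_Λ^{−̂} are probability measures on S^Λ stationary for P_Λ^τ, P_Λ^{+̂} and P_Λ^{−̂} respectively, then ν_Λ^{−̂} ≼ ν_Λ^τ ≼ ν_Λ^{+̂} in stochastic order. -/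
open MeasureTheory ProbabilityTheory

namespace Stmt6

/-- Sites of the lattice `ℤ^d`. -/
abbrev Site (d : ℕ) := Fin d → ℤ

/-- Configuration space `S^{ℤ^d}`, the spin space being a finite subset `S ⊂ ℝ`. -/
abbrev Config (d : ℕ) (S : Finset ℝ) := Site d → ↥S

variable {d : ℕ} {S : Finset ℝ}

/-- The ball `B_L = {k : Σᵢ |kᵢ| ≤ L}` for the ℓ¹ norm on `ℤ^d`. -/
noncomputable def ball (d L : ℕ) : Finset (Site d) :=
  (Finset.Icc (fun _ => -(L : ℤ)) (fun _ => (L : ℤ))).filter fun k => ∑ i, |k i| ≤ (L : ℤ)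

lemma zero_mem_ball (d L : ℕ) : (0 : Site d) ∈ ball d L := by
  simp [ball, Finset.mem_filter, Finset.mem_Icc, Pi.le_def]

/-- `patch Λ η τ` is the configuration `η_Λ τ_{Λᶜ}`. -/
def patch (Λ : Finset (Site d)) (η : ↥Λ → ↥S) (τ : Config d S) : Config d S :=
  fun j => if h : j ∈ Λ then η ⟨j, h⟩ else τ j

/-- The cylinder set of configurations agreeing with `ζ` on `F`. -/
def cylinder (F : Finset (Site d)) (ζ : Config d S) : Set (Config d S) :=
  {σ | ∀ k ∈ F, σ k = ζ k}

section updating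

variable (r : Site d → Config d S → ↥S → ℝ)

/-- `(p_k)_k` is a family of probability kernels. -/
def IsUpdating : Prop :=
  (∀ k η s, 0 ≤ r k η s) ∧ ∀ k η, ∑ s : ↥S, r k η s = 1

/-- Non degenerate updating family. -/
def NonDegenerate : Prop := ∀ k η s, 0 < r k η s

/-- Local updating family. -/
def IsLocalUpdating : Prop :=
  ∀ k : Site d, ∃ V : Finset (Site d),
    ∀ η η' : Config d S, (∀ j ∈ V, η j = η' j) → ∀ s, r k η s = r k η' s

/-- Translation invariant updating family : `p_k(s|η) = p_0(s|θ_{-k} η)`. -/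
def TranslationInvariant : Prop :=
  ∀ (k : Site d) (η : Config d S) (s : ↥S), r k η s = r 0 (fun j => η (j + k)) s

/-- Attractive dynamics: for each `k`, `s`, the map `η ↦ G_k(s,η) = Σ_{s' ≥ s} p_k(s'|η)`
is nondecreasing. -/
def Attractive : Prop :=
  ∀ (k : Site d) (s : ↥S),
    Monotone fun η : Config d S => ∑ s' ∈ Finset.univ.filter (fun s' : ↥S => s ≤ s'), r k η s'

/-- The transition kernel of the PCA dynamics `P(dσ|η) = ⊗_k p_k(dσ_k|η)`,
characterized through its (defining) values on cylinder sets. -/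
def IsPCAOf (P : Kernel (Config d S) (Config d S)) : Prop :=
  ∀ (η : Config d S) (F : Finset (Site d)) (ζ : Config d S),
    P η (cylinder F ζ) = ∏ k ∈ F, ENNReal.ofReal (r k η (ζ k))

/-- Transition probabilities of the finite volume dynamics `P_Λ^τ` on `S^Λ`. -/
def fvKer (Λ : Finset (Site d)) (τ : Config d S) (η σ : ↥Λ → ↥S) : ℝ :=
  ∏ k : ↥Λ, r (k : Site d) (patch Λ η τ) (σ k)

/-- Stationary probability measure for the finite volume dynamics `P_Λ^τ`. -/
def IsStationaryFV (Λ : Finset (Site d)) (τ : Config d S) (ν : (↥Λ → ↥S) → ℝ) : Prop :=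
  (∀ σ, 0 ≤ ν σ) ∧ (∑ σ, ν σ = 1) ∧ ∀ σ, ∑ η, ν η * fvKer r Λ τ η σ = ν σ

end updating

/-- `f` is a local function: it depends on finitely many coordinates. -/
def IsLocalFn (f : Config d S → ℝ) : Prop :=
  ∃ Λf : Finset (Site d), ∀ σ η : Config d S, (∀ k ∈ Λf, σ k = η k) → f σ = f η

/-- `Var_k(f)`. -/
noncomputable def varAt (k : Site d) (f : Config d S → ℝ) : ℝ :=
  sSup {x : ℝ | ∃ σ η : Config d S, (∀ j, j ≠ k → σ j = η j) ∧ x = |f σ - f η|}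

/-- The seminorm `|||f||| = Σ_k Var_k(f)`. -/
noncomputable def norm3 (f : Config d S → ℝ) : ℝ := ∑ᶠ k : Site d, varAt k f

/-- `iter P n σ` is the law `δ_σ P^{(n)}` at time `n` of the Markov chain with
transition kernel `P` started from `σ`. -/
noncomputable def iter (P : Kernel (Config d S) (Config d S)) :
    ℕ → Config d S → Measure (Config d S)
  | 0, σ => Measure.dirac σ
  | n + 1, σ => (iter P n σ).bind fun η => P η

/-- Mean value of the spin at the origin under a finite volume measure. -/
def atZero {Λ : Finset (Site d)} (h : (0 : Site d) ∈ Λ) (ν : (↥Λ → ↥S) → ℝ) : ℝ :=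
  ∑ σ, ν σ * ((σ ⟨0, h⟩ : ℝ))

end Stmt6

namespace Stmt6

/-- Abel summation, in an inductive form. -/
lemma abel_nonneg {α : Type*} [LinearOrder α] (h : α → ℝ) (T : Finset α) :
    (∀ t ∈ T, 0 ≤ ∑ s ∈ T.filter (fun s => t ≤ s), h s) →
    ∀ g : α → ℝ, Monotone g → (∀ s ∈ T, 0 ≤ g s) → 0 ≤ ∑ s ∈ T, h s * g s := by
  induction T using Finset.induction_on_min with
  | empty => intro _ g _ _; simp
  | insert a T ha ih =>
    intro ht g hg hg0
    have haT : a ∉ T := fun hmem => lt_irrefl _ (ha a hmem)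
    have htot : 0 ≤ ∑ s ∈ insert a T, h s := by
      have h1 := ht a (Finset.mem_insert_self a T)
      have h2 : (insert a T).filter (fun s => a ≤ s) = insert a T := by
        apply Finset.filter_true_of_mem
        intro s hs
        rcases Finset.mem_insert.1 hs with rfl | hs
        · exact le_rfl
        · exact (ha s hs).le
      rwa [h2] at h1
    have hrest : 0 ≤ ∑ s ∈ T, h s * (g s - g a) := by
      apply ih
      · intro t htT
        have h1 := ht t (Finset.mem_insert_of_mem htT)
        rwa [Finset.filter_insert, if_neg (not_le.2 (ha t htT))] at h1
      · intro x y hxy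
        exact sub_le_sub_right (hg hxy) _
      · intro s hs
        exact sub_nonneg.2 (hg (ha s hs).le)
    have hga := hg0 a (Finset.mem_insert_self a T)
    have key : ∑ s ∈ insert a T, h s * g s
        = g a * (∑ s ∈ insert a T, h s) + ∑ s ∈ T, h s * (g s - g a) := by
      rw [Finset.sum_insert haT, Finset.sum_insert haT]
      simp only [mul_sub, Finset.sum_sub_distrib, ← Finset.sum_mul]
      ring
    rw [key]
    positivity

/-- Stochastic order on a finite chain through tails. -/
lemma chain_le {α : Type*} [LinearOrder α] [Fintype α] (b : α) (hb : ∀ s, b ≤ s)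
    (p q : α → ℝ) (hpq : ∑ s, p s = ∑ s, q s)
    (ht : ∀ t, ∑ s ∈ Finset.univ.filter (fun s => t ≤ s), p s
      ≤ ∑ s ∈ Finset.univ.filter (fun s => t ≤ s), q s)
    (g : α → ℝ) (hg : Monotone g) : ∑ s, p s * g s ≤ ∑ s, q s * g s := by
  have h1 := abel_nonneg (fun s => q s - p s) Finset.univ
    (fun t _ => by rw [Finset.sum_sub_distrib]; exact sub_nonneg.2 (ht t))
    (fun s => g s - g b) (fun x y hxy => sub_le_sub_right (hg hxy) _)
    (fun s _ => sub_nonneg.2 (hg (hb s)))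
  simp only [mul_sub, sub_mul, Finset.sum_sub_distrib, ← Finset.sum_mul] at h1
  rw [hpq] at h1
  linarith

/-- Fubini at a single coordinate. -/
lemma sum_split {ι α : Type*} [Fintype ι] [DecidableEq ι] [Fintype α] (i : ι)
    (w : ι → α → ℝ) (f : (ι → α) → ℝ) :
    ∑ σ : ι → α, (∏ k, w k (σ k)) * f σ
      = ∑ ρ : {j // j ≠ i} → α, (∏ j, w j.1 (ρ j)) *
          ∑ s, w i s * f ((Equiv.funSplitAt i α).symm (s, ρ)) := by
  rw [← (Equiv.funSplitAt i α).symm.sum_comp, Fintype.sum_prod_type, Finset.sum_comm]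
  refine Finset.sum_congr rfl fun ρ _ => ?_
  rw [Finset.mul_sum]
  refine Finset.sum_congr rfl fun s _ => ?_
  rw [Fintype.prod_eq_mul_prod_subtype_ne _ i]
  have h1 : ∀ j : {j // j ≠ i}, (Equiv.funSplitAt i α).symm (s, ρ) j.1 = ρ j := by
    intro j; simp [Equiv.funSplitAt, Equiv.piSplitAt, j.2]
  have h2 : (Equiv.funSplitAt i α).symm (s, ρ) i = s := by
    simp [Equiv.funSplitAt, Equiv.piSplitAt]
  simp only [h1, h2]
  ring

/-- Products of stochastically ordered weights are ordered. -/
lemma prod_le {ι α : Type*} [Fintype ι] [DecidableEq ι] [LinearOrder α] [Fintype α]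
    (b : α) (hb : ∀ s, b ≤ s) (p q : ι → α → ℝ)
    (hp : ∀ k s, 0 ≤ p k s) (hq : ∀ k s, 0 ≤ q k s)
    (hpq : ∀ k, ∑ s, p k s = ∑ s, q k s)
    (ht : ∀ k t, ∑ s ∈ Finset.univ.filter (fun s => t ≤ s), p k s
      ≤ ∑ s ∈ Finset.univ.filter (fun s => t ≤ s), q k s)
    (f : (ι → α) → ℝ) (hf : Monotone f) :
    ∑ σ : ι → α, (∏ k, p k (σ k)) * f σ ≤ ∑ σ : ι → α, (∏ k, q k (σ k)) * f σ := by
  have main : ∀ A : Finset ι, ∑ σ : ι → α, (∏ k, p k (σ k)) * f σ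
      ≤ ∑ σ : ι → α, (∏ k, (if k ∈ A then q k else p k) (σ k)) * f σ := by
    intro A
    induction A using Finset.induction_on with
    | empty => simp
    | insert i A hi ih =>
      refine ih.trans ?_
      rw [sum_split i (fun k => if k ∈ A then q k else p k),
        sum_split i (fun k => if k ∈ insert i A then q k else p k)]
      apply Finset.sum_le_sum
      intro ρ _
      have e : ∀ j : {j // j ≠ i}, (if j.1 ∈ insert i A then q j.1 else p j.1)
          = (if j.1 ∈ A then q j.1 else p j.1) := by
        intro j; simp [Finset.mem_insert, j.2]
      simp only [e]
      apply mul_le_mul_of_nonneg_left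
      · rw [if_neg hi, if_pos (Finset.mem_insert_self i A)]
        refine chain_le b hb _ _ (hpq i) (ht i)
          (fun s => f ((Equiv.funSplitAt i α).symm (s, ρ))) ?_
        intro x y hxy
        apply hf
        intro j
        by_cases hj : j = i
        · subst hj; simpa [Equiv.funSplitAt, Equiv.piSplitAt] using hxy
        · simp [Equiv.funSplitAt, Equiv.piSplitAt, hj]
      · apply Finset.prod_nonneg
        intro j _
        split_ifs
        · exact hq _ _
        · exact hp _ _
  simpa using main Finset.univ

/-- Comparison of stationary measures of two ordered kernels on a finite poset. -/
lemma stat_le {Ω : Type*} [Fintype Ω] [PartialOrder Ω] (bot top : Ω)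
    (hbot : ∀ x, bot ≤ x) (htop : ∀ x, x ≤ top)
    (K₁ K₂ : Ω → Ω → ℝ) (hK : ∀ x y, 0 ≤ K₂ x y) (hK1 : ∀ x, ∑ y, K₂ x y = 1)
    (hpos : 0 < K₂ bot top)
    (h12 : ∀ f : Ω → ℝ, Monotone f → ∀ x, ∑ y, K₁ x y * f y ≤ ∑ y, K₂ x y * f y)
    (h22 : ∀ f : Ω → ℝ, Monotone f → Monotone fun x => ∑ y, K₂ x y * f y)
    (ν₁ ν₂ : Ω → ℝ) (h10 : ∀ x, 0 ≤ ν₁ x) (h20 : ∀ x, 0 ≤ ν₂ x)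
    (h11 : ∑ x, ν₁ x = 1) (h21 : ∑ x, ν₂ x = 1)
    (hs1 : ∀ y, ∑ x, ν₁ x * K₁ x y = ν₁ y) (hs2 : ∀ y, ∑ x, ν₂ x * K₂ x y = ν₂ y)
    (f : Ω → ℝ) (hf : Monotone f) : ∑ x, ν₁ x * f x ≤ ∑ x, ν₂ x * f x := by
  have swap : ∀ (ν : Ω → ℝ) (K : Ω → Ω → ℝ), (∀ y, ∑ x, ν x * K x y = ν y) →
      ∀ g : Ω → ℝ, ∑ x, ν x * g x = ∑ x, ν x * ∑ y, K x y * g y := by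
    intro ν K hs g
    calc ∑ y, ν y * g y = ∑ y, ∑ x, ν x * K x y * g y := by
          refine Finset.sum_congr rfl fun y _ => ?_
          rw [← Finset.sum_mul, hs]
      _ = _ := by
          rw [Finset.sum_comm]
          refine Finset.sum_congr rfl fun x _ => ?_
          rw [Finset.mul_sum]
          exact Finset.sum_congr rfl fun y _ => by ring
  have up : ∀ w : Ω → ℝ, (∀ x, 0 ≤ w x) → ∑ x, w x = 1 → ∀ g : Ω → ℝ, Monotone g →
      ∑ x, w x * g x ≤ g top := by
    intro w hw hw1 g hg
    calc ∑ x, w x * g x ≤ ∑ x, w x * g top :=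
          Finset.sum_le_sum fun x _ => mul_le_mul_of_nonneg_left (hg (htop x)) (hw x)
      _ = g top := by rw [← Finset.sum_mul, hw1, one_mul]
  have low : ∀ w : Ω → ℝ, (∀ x, 0 ≤ w x) → ∑ x, w x = 1 → ∀ g : Ω → ℝ, Monotone g →
      g bot + w top * (g top - g bot) ≤ ∑ x, w x * g x := by
    intro w hw hw1 g hg
    have h1 : w top * (g top - g bot) ≤ ∑ x, w x * (g x - g bot) :=
      Finset.single_le_sum (f := fun x => w x * (g x - g bot))
        (fun x _ => mul_nonneg (hw x) (sub_nonneg.2 (hg (hbot x)))) (Finset.mem_univ top)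
    simp only [mul_sub, Finset.sum_sub_distrib, ← Finset.sum_mul, hw1] at h1
    linarith
  set ε := K₂ bot top with hε
  have hε1 : ε ≤ 1 := by
    rw [← hK1 bot]
    exact Finset.single_le_sum (f := fun y => K₂ bot y) (fun y _ => hK bot y)
      (Finset.mem_univ top)
  have main : ∀ n : ℕ, ∀ g : Ω → ℝ, Monotone g →
      ∑ x, ν₁ x * g x - ∑ x, ν₂ x * g x ≤ (1 - ε) ^ n * (g top - g bot) := by
    intro n
    induction n with
    | zero =>
      intro g hg
      have a := up ν₁ h10 h11 g hg
      have b := low ν₂ h20 h21 g hg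
      have c := mul_nonneg (h20 top) (sub_nonneg.2 (hg (hbot top)))
      simp only [pow_zero, one_mul]
      linarith
    | succ n ih =>
      intro g hg
      have a := ih _ (h22 g hg)
      have b : ∑ x, ν₁ x * g x ≤ ∑ x, ν₁ x * ∑ y, K₂ x y * g y := by
        rw [swap ν₁ K₁ hs1 g]
        exact Finset.sum_le_sum fun x _ => mul_le_mul_of_nonneg_left (h12 g hg x) (h10 x)
      have c := swap ν₂ K₂ hs2 g
      have u := up (K₂ top) (hK top) (hK1 top) g hg
      have l := low (K₂ bot) (hK bot) (hK1 bot) g hg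
      have e : (1 - ε) ^ n * ((∑ y, K₂ top y * g y) - ∑ y, K₂ bot y * g y)
          ≤ (1 - ε) ^ n * ((1 - ε) * (g top - g bot)) := by
        apply mul_le_mul_of_nonneg_left _ (pow_nonneg (sub_nonneg.2 hε1) n)
        linarith
      rw [pow_succ, mul_assoc]
      linarith
  have lim : Filter.Tendsto (fun n : ℕ => (1 - ε) ^ n * (f top - f bot)) Filter.atTop
      (nhds (0 * (f top - f bot))) :=
    (tendsto_pow_atTop_nhds_zero_of_lt_one (sub_nonneg.2 hε1) (by linarith)).mul_const _
  have := ge_of_tendsto' lim (fun n => main n f hf)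
  linarith

lemma fv_le {d : ℕ} {S : Finset ℝ} (smin : ↥S) (hsmin : ∀ s : ↥S, smin ≤ s)
    (r : Site d → Config d S → ↥S → ℝ) (hupd : IsUpdating r) (hatt : Attractive r)
    (Λ : Finset (Site d)) (τ τ' : Config d S) (hτ : τ ≤ τ')
    (f : (↥Λ → ↥S) → ℝ) (hf : Monotone f) (η η' : ↥Λ → ↥S) (hη : η ≤ η') :
    ∑ σ, fvKer r Λ τ η σ * f σ ≤ ∑ σ, fvKer r Λ τ' η' σ * f σ := by
  have hpatch : patch Λ η τ ≤ patch Λ η' τ' := by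
    intro j
    unfold patch
    split_ifs with h
    · exact hη _
    · exact hτ _
  exact prod_le smin hsmin (fun k : ↥Λ => r k (patch Λ η τ)) (fun k : ↥Λ => r k (patch Λ η' τ'))
    (fun k s => hupd.1 _ _ _) (fun k s => hupd.1 _ _ _)
    (fun k => by rw [hupd.2, hupd.2]) (fun k t => hatt k t hpatch) f hf

lemma fv_stat_le {d : ℕ} {S : Finset ℝ} (smax smin : ↥S)
    (hsmax : ∀ s : ↥S, s ≤ smax) (hsmin : ∀ s : ↥S, smin ≤ s)
    (r : Site d → Config d S → ↥S → ℝ) (hupd : IsUpdating r) (hnd : NonDegenerate r)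
    (hatt : Attractive r)
    (Λ : Finset (Site d)) (τ τ' : Config d S) (hτ : τ ≤ τ')
    (ν ν' : (↥Λ → ↥S) → ℝ) (hν : IsStationaryFV r Λ τ ν) (hν' : IsStationaryFV r Λ τ' ν')
    (f : (↥Λ → ↥S) → ℝ) (hf : Monotone f) : ∑ σ, ν σ * f σ ≤ ∑ σ, ν' σ * f σ := by
  refine stat_le (fun _ => smin) (fun _ => smax) (fun x k => hsmin _) (fun x k => hsmax _)
    (fvKer r Λ τ) (fvKer r Λ τ') (fun x y => Finset.prod_nonneg fun k _ => hupd.1 _ _ _) ?_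
    (Finset.prod_pos fun k _ => hnd _ _ _)
    (fun g hg x => fv_le smin hsmin r hupd hatt Λ τ τ' hτ g hg x x le_rfl)
    (fun g hg x y hxy => fv_le smin hsmin r hupd hatt Λ τ' τ' le_rfl g hg x y hxy)
    ν ν' hν.1 hν'.1 hν.2.1 hν'.2.1 hν.2.2 hν'.2.2 f hf
  intro x
  unfold fvKer
  rw [← Fintype.prod_sum (fun (k : ↥Λ) s => r k (patch Λ x τ') s)]
  exact Finset.prod_eq_one fun k _ => hupd.2 _ _

end Stmt6

open Stmt6 in
/-- extremality of the finite-volume stationary measures in the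
boundary condition: for a non-degenerate, local, attractive updating family, any
stationary measure of `P_Λ^τ` is stochastically between the stationary measures of
`P_Λ^{−̂}` and `P_Λ^{+̂}`. -/
theorem stmt_6
    (d : ℕ) (hd : 1 ≤ d) (S : Finset ℝ) (hS : S.Nonempty)
    (smax smin : ↥S) (hsmax : ∀ s : ↥S, s ≤ smax) (hsmin : ∀ s : ↥S, smin ≤ s)
    (r : Site d → Config d S → ↥S → ℝ)
    (hupd : IsUpdating r) (hnd : NonDegenerate r) (hloc : IsLocalUpdating r)
    (hatt : Attractive r)
    (Λ : Finset (Site d)) (τ : Config d S)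
    (ντ νp νm : (↥Λ → ↥S) → ℝ)
    (hντ : IsStationaryFV r Λ τ ντ)
    (hνp : IsStationaryFV r Λ (fun _ => smax) νp)
    (hνm : IsStationaryFV r Λ (fun _ => smin) νm) :
    ∀ f : (↥Λ → ↥S) → ℝ, Monotone f →
      (∑ σ, νm σ * f σ) ≤ (∑ σ, ντ σ * f σ) ∧ (∑ σ, ντ σ * f σ) ≤ ∑ σ, νp σ * f σ := by
  intro f hf
  exact ⟨fv_stat_le smax smin hsmax hsmin r hupd hnd hatt Λ _ _ (fun _ => hsmin _) _ _ hνm hντ f hf,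
    fv_stat_le smax smin hsmax hsmin r hupd hnd hatt Λ _ _ (fun _ => hsmax _) _ _ hντ hνp f hf⟩
end

section
/- (Sandwiching of the infinite-volume evolution between finite-volume evolutions with extremal boundary conditions.) Let (p_k)_{k∈ℤ^d} be a non-degenerate, local, attractive updating family on S^{ℤ^d}, P the associated PCA dynamics, and for finite Λ ⊂ ℤ^d let P_Λ^τ denote the finite-volume dynamics with boundary condition τ, identified with the kernel on S^{ℤ^d} given by P_Λ^τ(dσ|η) = ⊗_{k∈Λ} p_k(dσ_k|η_Λ τ_{Λ^c}) ⊗ δ_{τ_{Λ^c}}(dσ_{Λ^c}). Then for every finite Λ ⊂ ℤ^d, every n ∈ ℕ and every ξ ∈ S^{ℤ^d}: δ_{ξ_Λ(−̂)_{Λ^c}} (P_Λ^{−̂})^{(n)} ≼ δ_ξ P^{(n)} ≼ δ_{ξ_Λ(+̂)_{Λ^c}} (P_Λ^{+̂})^{(n)} in stochastic order on S^{ℤ^d}. -/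
open MeasureTheory ProbabilityTheory

namespace Stmt7

/-- Sites of the lattice `ℤ^d`. -/
abbrev Site (d : ℕ) := Fin d → ℤ

/-- Configuration space `S^{ℤ^d}`, the spin space being a finite subset `S ⊂ ℝ`. -/
abbrev Config (d : ℕ) (S : Finset ℝ) := Site d → ↥S

variable {d : ℕ} {S : Finset ℝ}

/-- The ball `B_L = {k : Σᵢ |kᵢ| ≤ L}` for the ℓ¹ norm on `ℤ^d`. -/
noncomputable def ball (d L : ℕ) : Finset (Site d) :=
  (Finset.Icc (fun _ => -(L : ℤ)) (fun _ => (L : ℤ))).filter fun k => ∑ i, |k i| ≤ (L : ℤ)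

lemma zero_mem_ball (d L : ℕ) : (0 : Site d) ∈ ball d L := by
  simp [ball, Finset.mem_filter, Finset.mem_Icc, Pi.le_def]

/-- `patch Λ η τ` is the configuration `η_Λ τ_{Λᶜ}`. -/
def patch (Λ : Finset (Site d)) (η : ↥Λ → ↥S) (τ : Config d S) : Config d S :=
  fun j => if h : j ∈ Λ then η ⟨j, h⟩ else τ j

/-- The cylinder set of configurations agreeing with `ζ` on `F`. -/
def cylinder (F : Finset (Site d)) (ζ : Config d S) : Set (Config d S) :=
  {σ | ∀ k ∈ F, σ k = ζ k}

section updating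

variable (r : Site d → Config d S → ↥S → ℝ)

/-- `(p_k)_k` is a family of probability kernels. -/
def IsUpdating : Prop :=
  (∀ k η s, 0 ≤ r k η s) ∧ ∀ k η, ∑ s : ↥S, r k η s = 1

/-- Non degenerate updating family. -/
def NonDegenerate : Prop := ∀ k η s, 0 < r k η s

/-- Local updating family. -/
def IsLocalUpdating : Prop :=
  ∀ k : Site d, ∃ V : Finset (Site d),
    ∀ η η' : Config d S, (∀ j ∈ V, η j = η' j) → ∀ s, r k η s = r k η' s

/-- Translation invariant updating family : `p_k(s|η) = p_0(s|θ_{-k} η)`. -/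
def TranslationInvariant : Prop :=
  ∀ (k : Site d) (η : Config d S) (s : ↥S), r k η s = r 0 (fun j => η (j + k)) s

/-- Attractive dynamics: for each `k`, `s`, the map `η ↦ G_k(s,η) = Σ_{s' ≥ s} p_k(s'|η)`
is nondecreasing. -/
def Attractive : Prop :=
  ∀ (k : Site d) (s : ↥S),
    Monotone fun η : Config d S => ∑ s' ∈ Finset.univ.filter (fun s' : ↥S => s ≤ s'), r k η s'

/-- The transition kernel of the PCA dynamics `P(dσ|η) = ⊗_k p_k(dσ_k|η)`,
characterized through its (defining) values on cylinder sets. -/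
def IsPCAOf (P : Kernel (Config d S) (Config d S)) : Prop :=
  ∀ (η : Config d S) (F : Finset (Site d)) (ζ : Config d S),
    P η (cylinder F ζ) = ∏ k ∈ F, ENNReal.ofReal (r k η (ζ k))

/-- Transition probabilities of the finite volume dynamics `P_Λ^τ` on `S^Λ`. -/
def fvKer (Λ : Finset (Site d)) (τ : Config d S) (η σ : ↥Λ → ↥S) : ℝ :=
  ∏ k : ↥Λ, r (k : Site d) (patch Λ η τ) (σ k)

/-- Stationary probability measure for the finite volume dynamics `P_Λ^τ`. -/
def IsStationaryFV (Λ : Finset (Site d)) (τ : Config d S) (ν : (↥Λ → ↥S) → ℝ) : Prop :=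
  (∀ σ, 0 ≤ ν σ) ∧ (∑ σ, ν σ = 1) ∧ ∀ σ, ∑ η, ν η * fvKer r Λ τ η σ = ν σ

end updating

/-- `f` is a local function: it depends on finitely many coordinates. -/
def IsLocalFn (f : Config d S → ℝ) : Prop :=
  ∃ Λf : Finset (Site d), ∀ σ η : Config d S, (∀ k ∈ Λf, σ k = η k) → f σ = f η

/-- `Var_k(f)`. -/
noncomputable def varAt (k : Site d) (f : Config d S → ℝ) : ℝ :=
  sSup {x : ℝ | ∃ σ η : Config d S, (∀ j, j ≠ k → σ j = η j) ∧ x = |f σ - f η|}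

/-- The seminorm `|||f||| = Σ_k Var_k(f)`. -/
noncomputable def norm3 (f : Config d S → ℝ) : ℝ := ∑ᶠ k : Site d, varAt k f

/-- `iter P n σ` is the law `δ_σ P^{(n)}` at time `n` of the Markov chain with
transition kernel `P` started from `σ`. -/
noncomputable def iter (P : Kernel (Config d S) (Config d S)) :
    ℕ → Config d S → Measure (Config d S)
  | 0, σ => Measure.dirac σ
  | n + 1, σ => (iter P n σ).bind fun η => P η

/-- Mean value of the spin at the origin under a finite volume measure. -/
def atZero {Λ : Finset (Site d)} (h : (0 : Site d) ∈ Λ) (ν : (↥Λ → ↥S) → ℝ) : ℝ :=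
  ∑ σ, ν σ * ((σ ⟨0, h⟩ : ℝ))

/-- `patchC Λ ξ τ` is the configuration `ξ_Λ τ_{Λᶜ}` (both `ξ, τ` full configurations). -/
def patchC (Λ : Finset (Site d)) (ξ τ : Config d S) : Config d S :=
  fun j => if j ∈ Λ then ξ j else τ j

/-- The finite volume dynamics `P_Λ^τ`, identified with a kernel on the whole
configuration space: `P_Λ^τ(dσ|η) = ⊗_{k∈Λ} p_k(dσ_k|η_Λ τ_{Λᶜ}) ⊗ δ_{τ_{Λᶜ}}(dσ_{Λᶜ})`,
characterized through its (defining) values on cylinder sets. -/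
def IsFVPCAOf (r : Site d → Config d S → ↥S → ℝ) (Λ : Finset (Site d)) (τ : Config d S)
    (Q : Kernel (Config d S) (Config d S)) : Prop :=
  ∀ (η : Config d S) (F : Finset (Site d)) (ζ : Config d S),
    Q η (cylinder F ζ) =
      (∏ k ∈ F ∩ Λ, ENNReal.ofReal (r k (patchC Λ η τ) (ζ k))) *
        ∏ k ∈ F \ Λ, (if ζ k = τ k then 1 else 0)

end Stmt7

namespace Stmt7

variable {d : ℕ} {S : Finset ℝ}

/-- Upper tail of a weight. -/
noncomputable def tailG (q : ↥S → ℝ) (s : ↥S) : ℝ :=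
  ∑ s' ∈ Finset.univ.filter (fun s' : ↥S => s ≤ s'), q s'

/-- Quantile map. -/
noncomputable def quant (smin : ↥S) (q : ↥S → ℝ) (u : unitInterval) : ↥S :=
  (insert smin (Finset.univ.filter (fun s : ↥S => (u : ℝ) ≤ tailG q s))).max'
    (Finset.insert_nonempty _ _)

lemma quant_mono (smin : ↥S) {q q' : ↥S → ℝ} (h : ∀ s, tailG q s ≤ tailG q' s)
    (u : unitInterval) : quant smin q u ≤ quant smin q' u := by
  unfold quant
  apply Finset.max'_subset
  apply Finset.insert_subset_insert
  intro s hs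
  simp only [Finset.mem_filter, Finset.mem_univ, true_and] at hs ⊢
  exact hs.trans (h s)

lemma tailG_anti {q : ↥S → ℝ} (h0 : ∀ s, 0 ≤ q s) {s t : ↥S} (h : s ≤ t) :
    tailG q t ≤ tailG q s := by
  unfold tailG
  apply Finset.sum_le_sum_of_subset_of_nonneg
  · intro x hx
    simp only [Finset.mem_filter, Finset.mem_univ, true_and] at hx ⊢
    exact h.trans hx
  · intros; exact h0 _

lemma tailG_nonneg {q : ↥S → ℝ} (h0 : ∀ s, 0 ≤ q s) (s : ↥S) : 0 ≤ tailG q s :=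
  Finset.sum_nonneg fun _ _ => h0 _

lemma tailG_le_one {q : ↥S → ℝ} (h0 : ∀ s, 0 ≤ q s) (h1 : ∑ s, q s = 1) (s : ↥S) :
    tailG q s ≤ 1 := by
  rw [← h1]
  exact Finset.sum_le_sum_of_subset_of_nonneg (Finset.filter_subset _ _) (fun _ _ _ => h0 _)

lemma tailG_min {smin : ↥S} (hsmin : ∀ s, smin ≤ s) {q : ↥S → ℝ} (h1 : ∑ s, q s = 1) :
    tailG q smin = 1 := by
  rw [← h1]; unfold tailG
  congr 1
  ext x; simp [hsmin x]

lemma le_quant {smin : ↥S} (hsmin : ∀ s, smin ≤ s) {q : ↥S → ℝ} (h0 : ∀ s, 0 ≤ q s)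
    (h1 : ∑ s, q s = 1) (s : ↥S) (u : unitInterval) :
    s ≤ quant smin q u ↔ (u : ℝ) ≤ tailG q s := by
  unfold quant
  constructor
  · intro h
    have hm := Finset.max'_mem (insert smin (Finset.univ.filter
      (fun s : ↥S => (u : ℝ) ≤ tailG q s))) (Finset.insert_nonempty _ _)
    rw [Finset.mem_insert] at hm
    rcases hm with hm | hm
    · rw [hm] at h
      have : s = smin := le_antisymm h (hsmin s)
      rw [this, tailG_min hsmin h1]
      exact u.2.2
    · simp only [Finset.mem_filter, Finset.mem_univ, true_and] at hm
      exact hm.trans (tailG_anti h0 h)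
  · intro h
    apply Finset.le_max'
    simp [h]

lemma orderTop (S : Finset ℝ) : OrderTopology ↥S := by
  classical
  let : LocallyFiniteOrder ↥S := Fintype.toLocallyFiniteOrder
  let := LinearLocallyFiniteOrder.succOrder ↥S
  let := LinearLocallyFiniteOrder.predOrder ↥S
  infer_instance

lemma quant_measurable {smin : ↥S} (hsmin : ∀ s, smin ≤ s) {q : ↥S → ℝ} (h0 : ∀ s, 0 ≤ q s)
    (h1 : ∑ s, q s = 1) : Measurable (quant smin q) := by
  have := orderTop S
  apply measurable_of_Ici
  intro s
  have : quant smin q ⁻¹' Set.Ici s = {u : unitInterval | (u : ℝ) ≤ tailG q s} := by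
    ext u; exact le_quant hsmin h0 h1 s u
  rw [this]
  exact measurableSet_le measurable_subtype_coe measurable_const

/-- The measure with weights `q`. -/
noncomputable def wMeas (q : ↥S → ℝ) : Measure ↥S :=
  ∑ s : ↥S, ENNReal.ofReal (q s) • Measure.dirac s

lemma wMeas_singleton (q : ↥S → ℝ) (s : ↥S) : wMeas q {s} = ENNReal.ofReal (q s) := by
  classical
  simp [wMeas, Measure.finsetSum_apply, Set.indicator_apply]

lemma wMeas_Ici {q : ↥S → ℝ} (h0 : ∀ s, 0 ≤ q s) (s : ↥S) :
    wMeas q (Set.Ici s) = ENNReal.ofReal (tailG q s) := by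
  classical
  rw [tailG, ENNReal.ofReal_sum_of_nonneg (fun _ _ => h0 _)]
  simp [wMeas, Measure.finsetSum_apply, Set.indicator_apply, Finset.sum_filter]

lemma quant_map {smin : ↥S} (hsmin : ∀ s, smin ≤ s) {q : ↥S → ℝ} (h0 : ∀ s, 0 ≤ q s)
    (h1 : ∑ s, q s = 1) : (volume : Measure unitInterval).map (quant smin q) = wMeas q := by
  have hm := quant_measurable hsmin h0 h1
  have := Measure.isProbabilityMeasure_map (μ := (volume : Measure unitInterval)) hm.aemeasurable
  have := orderTop S
  apply Measure.ext_of_Ici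
  intro s
  rw [wMeas_Ici h0, Measure.map_apply hm measurableSet_Ici]
  have h2 : quant smin q ⁻¹' Set.Ici s
      = Set.Iic (⟨tailG q s, tailG_nonneg h0 s, tailG_le_one h0 h1 s⟩ : unitInterval) := by
    ext u; exact le_quant hsmin h0 h1 s u
  rw [h2]
  simp

lemma eq_map_quant {smin : ↥S} (hsmin : ∀ s, smin ≤ s) {q : Site d → ↥S → ℝ}
    (h0 : ∀ k s, 0 ≤ q k s) (h1 : ∀ k, ∑ s, q k s = 1)
    (μ : Measure (Config d S))
    (hμ : ∀ (F : Finset (Site d)) (ζ : Config d S),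
      μ (cylinder F ζ) = ∏ k ∈ F, ENNReal.ofReal (q k (ζ k))) :
    μ = (Measure.infinitePi (fun _ : Site d => (volume : Measure unitInterval))).map
      (fun u k => quant smin (q k) (u k)) := by
  classical
  rw [Measure.infinitePi_map_pi _ (fun k => quant_measurable hsmin (h0 k) (h1 k))]
  have hp : ∀ k, IsProbabilityMeasure ((volume : Measure unitInterval).map (quant smin (q k))) :=
    fun k => Measure.isProbabilityMeasure_map
      (quant_measurable hsmin (h0 k) (h1 k)).aemeasurable
  have hfin : IsFiniteMeasure μ := by
    constructor
    have := hμ ∅ (fun _ => smin)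
    simp [cylinder] at this
    simp [this]
  refine ((Measure.isProjectiveLimit_infinitePi _).unique ?_).symm
  intro F
  apply Measure.ext_of_singleton
  intro a
  rw [Measure.map_apply (by fun_prop) (measurableSet_singleton _), Measure.pi_singleton]
  have : (F.restrict : Config d S → (↥F → ↥S)) ⁻¹' ({a} : Set (↥F → ↥S)) = cylinder F (patch F a (fun _ => smin)) := by
    ext σ
    simp only [Set.mem_preimage, Set.mem_singleton_iff, cylinder, Set.mem_ofPred_eq, patch]
    constructor
    · intro h k hk
      simp [hk, ← h]
    · intro h
      ext ⟨k, hk⟩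
      simpa [hk] using congrArg Subtype.val (h k hk)
  refine (congrArg μ this).trans ?_
  rw [hμ, ← Finset.prod_attach]
  apply Finset.prod_congr rfl
  intro k _
  rw [quant_map hsmin (h0 k) (h1 k), wMeas_singleton]
  simp [patch]

lemma integrable_bdd {μ : Measure (Config d S)} [IsFiniteMeasure μ] {f : Config d S → ℝ}
    (hf : Measurable f) {B : ℝ} (hB : ∀ σ, |f σ| ≤ B) : Integrable f μ :=
  Integrable.of_bound hf.aestronglyMeasurable B (ae_of_all _ hB)

/-- Stochastic domination of product measures. -/
lemma prod_dom {smin : ↥S} (hsmin : ∀ s, smin ≤ s) {q q' : Site d → ↥S → ℝ}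
    (h0 : ∀ k s, 0 ≤ q k s) (h1 : ∀ k, ∑ s, q k s = 1)
    (h0' : ∀ k s, 0 ≤ q' k s) (h1' : ∀ k, ∑ s, q' k s = 1)
    (hG : ∀ k s, tailG (q k) s ≤ tailG (q' k) s)
    (μ μ' : Measure (Config d S))
    (hμ : ∀ (F : Finset (Site d)) (ζ : Config d S),
      μ (cylinder F ζ) = ∏ k ∈ F, ENNReal.ofReal (q k (ζ k)))
    (hμ' : ∀ (F : Finset (Site d)) (ζ : Config d S),
      μ' (cylinder F ζ) = ∏ k ∈ F, ENNReal.ofReal (q' k (ζ k)))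
    (f : Config d S → ℝ) (hf : Measurable f) (hfm : Monotone f)
    (hb : ∃ B : ℝ, ∀ σ, |f σ| ≤ B) :
    ∫ x, f x ∂μ ≤ ∫ x, f x ∂μ' := by
  obtain ⟨B, hB⟩ := hb
  have hm : Measurable (fun (u : Site d → unitInterval) k => quant smin (q k) (u k)) :=
    measurable_pi_lambda _ fun k =>
      (quant_measurable hsmin (h0 k) (h1 k)).comp (measurable_pi_apply k)
  have hm' : Measurable (fun (u : Site d → unitInterval) k => quant smin (q' k) (u k)) :=
    measurable_pi_lambda _ fun k =>
      (quant_measurable hsmin (h0' k) (h1' k)).comp (measurable_pi_apply k)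
  rw [eq_map_quant hsmin h0 h1 μ hμ, eq_map_quant hsmin h0' h1' μ' hμ',
    integral_map hm.aemeasurable hf.aestronglyMeasurable,
    integral_map hm'.aemeasurable hf.aestronglyMeasurable]
  apply integral_mono
  · exact Integrable.of_bound (hf.comp hm).aestronglyMeasurable B (ae_of_all _ fun u => hB _)
  · exact Integrable.of_bound (hf.comp hm').aestronglyMeasurable B (ae_of_all _ fun u => hB _)
  · intro u
    exact hfm fun k => quant_mono smin (hG k) (u k)

/-- One-step domination between kernels. -/
def KDom (K K' : Kernel (Config d S) (Config d S)) : Prop :=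
  ∀ η η' : Config d S, η ≤ η' → ∀ f : Config d S → ℝ, Measurable f → Monotone f →
    (∃ B : ℝ, ∀ σ, |f σ| ≤ B) → ∫ x, f x ∂(K η) ≤ ∫ x, f x ∂(K' η')

lemma iter_prob (K : Kernel (Config d S) (Config d S)) [IsMarkovKernel K] (n : ℕ)
    (x : Config d S) : IsProbabilityMeasure (iter K n x) := by
  induction n with
  | zero => unfold iter; infer_instance
  | succ n ih => unfold iter; infer_instance

lemma integral_bind_kernel {μ : Measure (Config d S)} {κ : Kernel (Config d S) (Config d S)}
    {f : Config d S → ℝ} (hf : Integrable f (μ.bind κ)) :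
    ∫ z, f z ∂(μ.bind κ) = ∫ w, ∫ z, f z ∂(κ w) ∂μ := by
  rw [Measure.comp_eq_comp_const_apply] at hf ⊢
  rw [Kernel.integral_comp hf, Kernel.const_apply]

lemma iter_dom (K K' : Kernel (Config d S) (Config d S)) [IsMarkovKernel K] [IsMarkovKernel K']
    (hmono : KDom K K) (hdom : KDom K K') (n : ℕ) (x y : Config d S) (hxy : x ≤ y) :
    ∀ f : Config d S → ℝ, Measurable f → Monotone f → (∃ B : ℝ, ∀ σ, |f σ| ≤ B) →
      ∫ z, f z ∂(iter K n x) ≤ ∫ z, f z ∂(iter K' n y) := by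
  induction n with
  | zero =>
    intro f hf hfm _
    simpa [iter, integral_dirac' _ _ hf.stronglyMeasurable] using hfm hxy
  | succ n ih =>
    intro f hf hfm ⟨B, hB⟩
    have := iter_prob K n x
    have := iter_prob K' n y
    have := iter_prob K (n + 1) x
    have := iter_prob K' (n + 1) y
    have e1 : ∫ z, f z ∂(iter K (n + 1) x) = ∫ w, ∫ z, f z ∂(K w) ∂(iter K n x) :=
      integral_bind_kernel (μ := iter K n x) (κ := K)
        (integrable_bdd (μ := iter K (n + 1) x) hf hB)
    have e2 : ∫ z, f z ∂(iter K' (n + 1) y) = ∫ w, ∫ z, f z ∂(K' w) ∂(iter K' n y) :=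
      integral_bind_kernel (μ := iter K' n y) (κ := K')
        (integrable_bdd (μ := iter K' (n + 1) y) hf hB)
    have bd : ∀ (L : Kernel (Config d S) (Config d S)) [IsMarkovKernel L] (w : Config d S),
        |∫ z, f z ∂(L w)| ≤ B := by
      intro L _ w
      have := norm_integral_le_of_norm_le_const (μ := L w) (f := f) (C := B) (ae_of_all _ hB)
      simpa using this
    have me : ∀ (L : Kernel (Config d S) (Config d S)),
        Measurable fun w => ∫ z, f z ∂(L w) := fun L =>
      (hf.stronglyMeasurable.integral_kernel (κ := L)).measurable
    rw [e1, e2]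
    refine (ih (fun w => ∫ z, f z ∂(K w)) (me K)
      (fun a b hab => hmono a b hab f hf hfm ⟨B, hB⟩) ⟨B, bd K⟩).trans ?_
    exact integral_mono (integrable_bdd (me K) (bd K)) (integrable_bdd (me K') (bd K'))
      (fun w => hdom w w le_rfl f hf hfm ⟨B, hB⟩)

open Classical in
/-- Single-site weights of the finite volume dynamics. -/
noncomputable def fvW (r : Site d → Config d S → ↥S → ℝ) (Λ : Finset (Site d)) (τ η : Config d S)
    (k : Site d) (s : ↥S) : ℝ :=
  if k ∈ Λ then r k (patchC Λ η τ) s else if s = τ k then 1 else 0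

lemma fvW_nonneg {r : Site d → Config d S → ↥S → ℝ} (hupd : IsUpdating r) (Λ : Finset (Site d))
    (τ η : Config d S) (k : Site d) (s : ↥S) : 0 ≤ fvW r Λ τ η k s := by
  unfold fvW
  split_ifs
  · exact hupd.1 _ _ _
  · exact zero_le_one
  · exact le_rfl

lemma fvW_sum {r : Site d → Config d S → ↥S → ℝ} (hupd : IsUpdating r) (Λ : Finset (Site d))
    (τ η : Config d S) (k : Site d) : ∑ s, fvW r Λ τ η k s = 1 := by
  unfold fvW
  split_ifs
  · exact hupd.2 _ _
  · simp

lemma fv_cyl {r : Site d → Config d S → ↥S → ℝ} {Λ : Finset (Site d)} {τ : Config d S}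
    {Q : Kernel (Config d S) (Config d S)} (hQ : IsFVPCAOf r Λ τ Q) (η : Config d S)
    (F : Finset (Site d)) (ζ : Config d S) :
    Q η (cylinder F ζ) = ∏ k ∈ F, ENNReal.ofReal (fvW r Λ τ η k (ζ k)) := by
  classical
  rw [hQ, ← Finset.prod_inter_mul_prod_sdiff F Λ]
  congr 1
  · apply Finset.prod_congr rfl
    intro k hk
    simp [fvW, (Finset.mem_inter.1 hk).2]
  · apply Finset.prod_congr rfl
    intro k hk
    rw [fvW, if_neg (Finset.mem_sdiff.1 hk).2]
    split_ifs <;> simp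

lemma tail_delta_max (smax : ↥S) (hsmax : ∀ s, s ≤ smax) {q : ↥S → ℝ} (h0 : ∀ s, 0 ≤ q s)
    (h1 : ∑ s, q s = 1) (r : Site d → Config d S → ↥S → ℝ) (Λ : Finset (Site d)) (η : Config d S)
    (k : Site d) (hk : k ∉ Λ) (s : ↥S) :
    tailG q s ≤ tailG (fvW r Λ (fun _ => smax) η k) s := by
  refine (tailG_le_one h0 h1 s).trans ?_
  simp [tailG, fvW, hk, hsmax s]

lemma tail_delta_min (smin : ↥S) (hsmin : ∀ s, smin ≤ s) {q : ↥S → ℝ} (h0 : ∀ s, 0 ≤ q s)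
    (h1 : ∑ s, q s = 1) (r : Site d → Config d S → ↥S → ℝ) (Λ : Finset (Site d)) (η : Config d S)
    (k : Site d) (hk : k ∉ Λ) (s : ↥S) :
    tailG (fvW r Λ (fun _ => smin) η k) s ≤ tailG q s := by
  by_cases h : s = smin
  · subst h
    rw [tailG_min hsmin h1]
    simp [tailG, fvW, hk]
  · have : ¬ s ≤ smin := fun h' => h (le_antisymm h' (hsmin s))
    refine le_trans (le_of_eq ?_) (tailG_nonneg h0 s)
    simp [tailG, fvW, hk, this]

end Stmt7

open Stmt7 in
/-- sandwiching of the infinite-volume evolution between the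
finite-volume evolutions with extremal boundary conditions, in stochastic order. -/
theorem stmt_7
    (d : ℕ) (hd : 1 ≤ d) (S : Finset ℝ) (hS : S.Nonempty)
    (smax smin : ↥S) (hsmax : ∀ s : ↥S, s ≤ smax) (hsmin : ∀ s : ↥S, smin ≤ s)
    (r : Site d → Config d S → ↥S → ℝ)
    (hupd : IsUpdating r) (hnd : NonDegenerate r) (hloc : IsLocalUpdating r)
    (hatt : Attractive r)
    (P : Kernel (Config d S) (Config d S)) (hMarkov : IsMarkovKernel P)
    (hP : IsPCAOf r P)
    (Λ : Finset (Site d))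
    (Qp Qm : Kernel (Config d S) (Config d S))
    (hQpMarkov : IsMarkovKernel Qp) (hQmMarkov : IsMarkovKernel Qm)
    (hQp : IsFVPCAOf r Λ (fun _ => smax) Qp)
    (hQm : IsFVPCAOf r Λ (fun _ => smin) Qm)
    (n : ℕ) (ξ : Config d S) :
    ∀ f : Config d S → ℝ, Measurable f → Monotone f → (∃ B : ℝ, ∀ σ, |f σ| ≤ B) →
      (∫ x, f x ∂(iter Qm n (patchC Λ ξ fun _ => smin)) ≤ ∫ x, f x ∂(iter P n ξ)) ∧
        ∫ x, f x ∂(iter P n ξ) ≤ ∫ x, f x ∂(iter Qp n (patchC Λ ξ fun _ => smax)) := by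
  classical
  intro f hf hfm hb
  have hPP : KDom P P := fun η η' h => prod_dom hsmin (q := fun k => r k η)
    (q' := fun k => r k η') (fun k => hupd.1 k η) (fun k => hupd.2 k η)
    (fun k => hupd.1 k η') (fun k => hupd.2 k η') (fun k s => hatt k s h) _ _ (hP η) (hP η')
  have hPQ : KDom P Qp := fun η η' h => prod_dom hsmin (q := fun k => r k η)
    (q' := fvW r Λ (fun _ => smax) η') (fun k => hupd.1 k η) (fun k => hupd.2 k η)
    (fvW_nonneg hupd _ _ _) (fvW_sum hupd _ _ _) (by
      intro k s
      by_cases hk : k ∈ Λ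
      · have e : fvW r Λ (fun _ => smax) η' k = r k (patchC Λ η' fun _ => smax) := by
          funext s; simp [fvW, hk]
        rw [e]
        refine hatt k s fun j => ?_
        unfold patchC
        split_ifs
        · exact h j
        · exact hsmax _
      · exact tail_delta_max smax hsmax (hupd.1 k η) (hupd.2 k η) r Λ η' k hk s)
    _ _ (hP η) (fv_cyl hQp η')
  have hQP : KDom Qm P := fun η η' h => prod_dom hsmin (q := fvW r Λ (fun _ => smin) η)
    (q' := fun k => r k η')
    (fvW_nonneg hupd _ _ _) (fvW_sum hupd _ _ _)
    (fun k => hupd.1 k η') (fun k => hupd.2 k η') (by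
      intro k s
      by_cases hk : k ∈ Λ
      · have e : fvW r Λ (fun _ => smin) η k = r k (patchC Λ η fun _ => smin) := by
          funext s; simp [fvW, hk]
        rw [e]
        refine hatt k s fun j => ?_
        unfold patchC
        split_ifs
        · exact h j
        · exact hsmin _
      · exact tail_delta_min smin hsmin (hupd.1 k η') (hupd.2 k η') r Λ η k hk s)
    _ _ (fv_cyl hQm η) (hP η')
  have hQQ : KDom Qm Qm := fun η η' h => prod_dom hsmin (q := fvW r Λ (fun _ => smin) η)
    (q' := fvW r Λ (fun _ => smin) η')
    (fvW_nonneg hupd _ _ _) (fvW_sum hupd _ _ _)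
    (fvW_nonneg hupd _ _ _) (fvW_sum hupd _ _ _) (by
      intro k s
      by_cases hk : k ∈ Λ
      · have e : ∀ η, fvW r Λ (fun _ => smin) η k = r k (patchC Λ η fun _ => smin) := by
          intro η; funext s; simp [fvW, hk]
        rw [e, e]
        refine hatt k s fun j => ?_
        unfold patchC
        split_ifs
        · exact h j
        · exact le_rfl
      · exact tail_delta_min smin hsmin (fvW_nonneg hupd _ _ _ k) (fvW_sum hupd _ _ _ k)
          r Λ η k hk s)
    _ _ (fv_cyl hQm η) (fv_cyl hQm η')
  constructor
  · refine iter_dom Qm P hQQ hQP n _ _ (fun j => ?_) f hf hfm hb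
    unfold patchC
    split_ifs
    · exact le_rfl
    · exact hsmin _
  · refine iter_dom P Qp hPP hPQ n _ _ (fun j => ?_) f hf hfm hb
    unfold patchC
    split_ifs
    · exact le_rfl
    · exact hsmax _
end

section
/- (Reversibility of the explicit finite-volume measure for class-C PCA.) Let d ≥ 1, β > 0, K : ℤ^d → ℝ symmetric (K(k) = K(−k)) with finite range, Λ ⊂ ℤ^d finite, and τ ∈ {−1,+1}^{ℤ^d} a boundary condition. Then the probability measure ν_Λ^τ on {−1,+1}^Λ defined by ν_Λ^τ(σ) = (1/W_Λ^τ) Π_{k∈Λ} cosh(β Σ_{j∈ℤ^d} K(k−j) σ̃_j) · exp(β σ_k Σ_{j∈Λ^c} K(k−j) τ_j), with σ̃ = σ_Λτ_{Λ^c} and W_Λ^τ the normalisation, is reversible for the finite-volume class-C kernel P_Λ^τ; that is, for all σ, η ∈ {−1,+1}^Λ: ν_Λ^τ(σ) · P_Λ^τ(η|σ) = ν_Λ^τ(η) · P_Λ^τ(σ|η). -/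
open MeasureTheory ProbabilityTheory

namespace ClassC

/-- Sites of the lattice `ℤ^d`. -/
abbrev Site (d : ℕ) := Fin d → ℤ

/-- The spin space `{-1,+1} ⊂ ℝ`. -/
abbrev Spin : Type := ({-1, 1} : Finset ℝ)

/-- The spin `+1`. -/
def sPlus : Spin := ⟨1, by simp⟩
/-- The spin `-1`. -/
def sMinus : Spin := ⟨-1, by simp⟩

/-- Configuration space `{-1,+1}^{ℤ^d}`. -/
abbrev Config (d : ℕ) := Site d → Spin

variable {d : ℕ}

/-- The constant configuration `+1` (respectively `-1`). -/
def cPlus (d : ℕ) : Config d := fun _ => sPlus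
def cMinus (d : ℕ) : Config d := fun _ => sMinus

/-- `K` is symmetric with finite range `R`: `K(k) = K(-k)` and `K(k) = 0` as soon as
`Σᵢ |kᵢ| > R`. -/
def SymmFiniteRange (K : Site d → ℝ) (R : ℕ) : Prop :=
  (∀ k, K (-k) = K k) ∧ ∀ k : Site d, (R : ℤ) < ∑ i, |k i| → K k = 0

/-- The ball `B_L = {k : Σᵢ |kᵢ| ≤ L}` for the ℓ¹ norm on `ℤ^d`. -/
noncomputable def ball (d L : ℕ) : Finset (Site d) :=
  (Finset.Icc (fun _ => -(L : ℤ)) (fun _ => (L : ℤ))).filter fun k => ∑ i, |k i| ≤ (L : ℤ)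

lemma zero_mem_ball (d L : ℕ) : (0 : Site d) ∈ ball d L := by
  simp [ball, Finset.mem_filter, Finset.mem_Icc, Pi.le_def]

/-- `patch Λ σ τ` is the configuration `σ_Λ τ_{Λᶜ}`. -/
def patch (Λ : Finset (Site d)) (σ : ↥Λ → Spin) (τ : Config d) : Config d :=
  fun j => if h : j ∈ Λ then σ ⟨j, h⟩ else τ j

/-- The local mean field `β Σ_{k'} K(k'-k) η_{k'}` at site `k`. -/
noncomputable def field (β : ℝ) (K : Site d → ℝ) (k : Site d) (η : Config d) : ℝ :=
  β * ∑ᶠ k' : Site d, K (k' - k) * (η k' : ℝ)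

/-- The class-C updating rule `p_k(s|η) = ½ (1 + s tanh(β Σ_{k'} K(k'-k) η_{k'}))`. -/
noncomputable def upd (β : ℝ) (K : Site d → ℝ) (k : Site d) (η : Config d) (s : Spin) : ℝ :=
  (1 + (s : ℝ) * Real.tanh (field β K k η)) / 2

/-- Transition probabilities of the finite volume class-C dynamics `P_Λ^τ` on
`{-1,+1}^Λ`: `P_Λ^τ(σ|η) = Π_{k∈Λ} p_k(σ_k | η_Λ τ_{Λᶜ})`. -/
noncomputable def fvKer (β : ℝ) (K : Site d → ℝ) (Λ : Finset (Site d)) (τ : Config d)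
    (η σ : ↥Λ → Spin) : ℝ :=
  ∏ k : ↥Λ, upd β K (k : Site d) (patch Λ η τ) (σ k)

/-- The unnormalised weight of the finite volume reversible measure `ν_Λ^τ`:
`Π_{k∈Λ} cosh(β Σ_j K(k-j) σ̃_j) exp(β σ_k Σ_{j∈Λᶜ} K(k-j) τ_j)` with `σ̃ = σ_Λ τ_{Λᶜ}`. -/
noncomputable def nuWeight (β : ℝ) (K : Site d → ℝ) (Λ : Finset (Site d)) (τ : Config d)
    (σ : ↥Λ → Spin) : ℝ :=
  ∏ k : ↥Λ,
    Real.cosh (β * ∑ᶠ j : Site d, K ((k : Site d) - j) * ((patch Λ σ τ) j : ℝ)) *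
      Real.exp (β * (σ k : ℝ) * ∑ᶠ j ∈ {j : Site d | j ∉ Λ}, K ((k : Site d) - j) * (τ j : ℝ))

/-- The finite volume measure `ν_Λ^τ` (normalised weight). -/
noncomputable def nuFV (β : ℝ) (K : Site d → ℝ) (Λ : Finset (Site d)) (τ : Config d)
    (σ : ↥Λ → Spin) : ℝ :=
  nuWeight β K Λ τ σ / ∑ σ', nuWeight β K Λ τ σ'

/-- The finite volume Hamiltonian `Σ_{A ∩ Λ ≠ ∅} φ_A(σ_Λ τ_{Λᶜ})` for the potential `φ`
canonically associated to the dynamics: `φ_{U_k} = - log cosh(β Σ_j K(k-j) σ_j)` on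
`U_k = {j : K(k-j) ≠ 0}` and `φ_A = 0` otherwise; the sum over `A` meeting `Λ` is the
sum over those `k` with `U_k ∩ Λ ≠ ∅`. -/
noncomputable def ham (β : ℝ) (K : Site d → ℝ) (Λ : Finset (Site d)) (τ : Config d)
    (σ : ↥Λ → Spin) : ℝ :=
  ∑ᶠ (k : Site d) (_ : ∃ j ∈ Λ, K (k - j) ≠ 0),
    -Real.log (Real.cosh (β * ∑ᶠ j : Site d, K (k - j) * ((patch Λ σ τ) j : ℝ)))

/-- The finite volume Gibbs measure `μ_Λ^τ = exp(-H_Λ^τ)/Z_Λ^τ`. -/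
noncomputable def gibbsFV (β : ℝ) (K : Site d → ℝ) (Λ : Finset (Site d)) (τ : Config d)
    (σ : ↥Λ → Spin) : ℝ :=
  Real.exp (-ham β K Λ τ σ) / ∑ σ', Real.exp (-ham β K Λ τ σ')

/-- Mean value of the spin at the origin under a finite volume (probability) weight. -/
noncomputable def atZero {Λ : Finset (Site d)} (h : (0 : Site d) ∈ Λ)
    (ν : (↥Λ → Spin) → ℝ) : ℝ :=
  ∑ σ, ν σ * ((σ ⟨0, h⟩ : ℝ))

/-- The inner boundary `∂ᵢΔ = {k ∈ Δ : U_k ∩ Δᶜ ≠ ∅}`, `U_k = {j : K(k-j) ≠ 0}`. -/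
def ibdry (K : Site d → ℝ) (Δ : Finset (Site d)) : Set (Site d) :=
  {k | k ∈ Δ ∧ ∃ j ∉ Δ, K (k - j) ≠ 0}

end ClassC

namespace ClassC

lemma aux_cosh (s : Spin) (h : ℝ) :
    Real.cosh h * ((1 + (s : ℝ) * Real.tanh h) / 2) = Real.exp ((s : ℝ) * h) / 2 := by
  have hc : Real.cosh h ≠ 0 := (Real.cosh_pos h).ne'
  have hs : (s : ℝ) = -1 ∨ (s : ℝ) = 1 := by
    obtain ⟨x, hx⟩ := s
    simpa only [Finset.mem_insert, Finset.mem_singleton] using hx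
  rw [Real.tanh_eq_sinh_div_cosh]
  have e : Real.cosh h * ((1 + (s : ℝ) * (Real.sinh h / Real.cosh h)) / 2)
      = (Real.cosh h + s * Real.sinh h) / 2 := by
    field_simp
  rw [e]
  rcases hs with hs | hs <;> rw [hs]
  · rw [neg_one_mul, neg_one_mul, ← Real.cosh_sub_sinh]; ring
  · rw [one_mul, one_mul, Real.cosh_add_sinh]

lemma aux_finite {d : ℕ} {K : Site d → ℝ} {R : ℕ} (hK : SymmFiniteRange K R) (k : Site d) :
    {j : Site d | K (k - j) ≠ 0}.Finite := by
  have hK0 : {x : Site d | K x ≠ 0}.Finite := by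
    apply (Set.finite_Icc (fun _ : Fin d => -(R : ℤ)) (fun _ => (R : ℤ))).subset
    intro x hx
    have hle : ∑ i, |x i| ≤ (R : ℤ) := by
      by_contra hcon
      exact hx (hK.2 x (not_le.mp hcon))
    have hi : ∀ i, |x i| ≤ (R : ℤ) := fun i =>
      (Finset.single_le_sum (f := fun i => |x i|) (fun i _ => abs_nonneg (x i))
        (Finset.mem_univ i)).trans hle
    exact ⟨fun i => (abs_le.mp (hi i)).1, fun i => (abs_le.mp (hi i)).2⟩
  exact hK0.preimage (f := fun j => k - j) (fun a _ b _ hab => sub_right_injective hab)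

/-- The field splits into the inner and the boundary contributions. -/
lemma aux_split {d : ℕ} {K : Site d → ℝ} {R : ℕ} (hK : SymmFiniteRange K R)
    (Λ : Finset (Site d)) (τ : Config d) (σ : ↥Λ → Spin) (k : Site d) :
    ∑ᶠ j : Site d, K (k - j) * ((patch Λ σ τ) j : ℝ)
      = ∑ j : ↥Λ, K (k - j) * (σ j : ℝ)
        + ∑ᶠ j ∈ {j : Site d | j ∉ Λ}, K (k - j) * (τ j : ℝ) := by
  have hfin : (Function.support fun j : Site d =>
      K (k - j) * ((patch Λ σ τ) j : ℝ)).Finite :=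
    (aux_finite hK k).subset fun j hj => left_ne_zero_of_mul hj
  rw [← finsum_mem_univ, ← Set.union_compl_self (Λ : Set (Site d)),
    finsum_mem_union' disjoint_compl_right (hfin.subset Set.inter_subset_right)
      (hfin.subset Set.inter_subset_right)]
  congr 1
  · rw [finsum_mem_coe_finset, ← Finset.sum_coe_sort]
    refine Finset.sum_congr rfl fun j _ => ?_
    simp [patch]
  · refine finsum_mem_congr (by ext; simp) fun j hj => ?_
    have hj' : j ∉ Λ := hj
    simp [patch, hj']

lemma aux_key {d : ℕ} (β : ℝ) {K : Site d → ℝ} {R : ℕ} (hK : SymmFiniteRange K R)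
    (Λ : Finset (Site d)) (τ : Config d) (σ η : ↥Λ → Spin) :
    nuWeight β K Λ τ σ * fvKer β K Λ τ σ η = nuWeight β K Λ τ η * fvKer β K Λ τ η σ := by
  have hform : ∀ σ η : ↥Λ → Spin, nuWeight β K Λ τ σ * fvKer β K Λ τ σ η
      = Real.exp (∑ k : ↥Λ, (β * ∑ j : ↥Λ, (η k : ℝ) * (K ((k : Site d) - j) * (σ j : ℝ))
          + β * ((η k : ℝ) + σ k) *
            ∑ᶠ j ∈ {j : Site d | j ∉ Λ}, K ((k : Site d) - j) * (τ j : ℝ)))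
        * ∏ _k : ↥Λ, (1 / 2 : ℝ) := by
    intro σ η
    unfold nuWeight fvKer
    rw [Real.exp_sum, ← Finset.prod_mul_distrib, ← Finset.prod_mul_distrib]
    refine Finset.prod_congr rfl fun k _ => ?_
    have hf : field β K k (patch Λ σ τ)
        = β * ∑ᶠ j : Site d, K ((k : Site d) - j) * ((patch Λ σ τ) j : ℝ) := by
      unfold field
      congr 1
      refine finsum_congr fun j => ?_
      rw [← hK.1, neg_sub]
    unfold upd
    rw [hf, mul_right_comm, aux_cosh, aux_split hK, div_mul_eq_mul_div, ← Real.exp_add,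
      ← Finset.mul_sum, div_eq_mul_one_div]
    congr 2
    ring
  rw [hform, hform]
  congr 2
  rw [Finset.sum_add_distrib, Finset.sum_add_distrib]
  congr 1
  · rw [← Finset.mul_sum, ← Finset.mul_sum, Finset.sum_comm]
    congr 1
    refine Finset.sum_congr rfl fun k _ => Finset.sum_congr rfl fun j _ => ?_
    rw [← hK.1, neg_sub]
    ring
  · refine Finset.sum_congr rfl fun k _ => ?_
    ring

end ClassC

open ClassC in
/-- reversibility of the explicit finite-volume measure for class-C
PCA: `ν_Λ^τ(σ) P_Λ^τ(η|σ) = ν_Λ^τ(η) P_Λ^τ(σ|η)`. -/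
theorem stmt_8
    (d : ℕ) (hd : 1 ≤ d) (β : ℝ) (hβ : 0 < β)
    (K : Site d → ℝ) (R : ℕ) (hR : 1 ≤ R) (hK : SymmFiniteRange K R)
    (Λ : Finset (Site d)) (τ : Config d) :
    ∀ σ η : ↥Λ → Spin,
      nuFV β K Λ τ σ * fvKer β K Λ τ σ η = nuFV β K Λ τ η * fvKer β K Λ τ η σ := by
  intro σ η
  unfold nuFV
  rw [div_mul_eq_mul_div, div_mul_eq_mul_div, aux_key β hK]
end

section
/- (Conditional law of the finite-volume stationary measure is a finite-volume Gibbs measure.) Let d ≥ 1, β > 0 and K : ℤ^d → ℝ symmetric with finite range. For a finite set Δ ⊂ ℤ^d put ∂_iΔ = {k ∈ Δ : U_k ∩ Δ^c ≠ ∅}, where U_k = {j ∈ ℤ^d : K(k−j) ≠ 0}. Let Λ ⊂ Λ' be finite subsets of ℤ^d with ∂_iΛ ∩ ∂_iΛ' = ∅ and let τ ∈ {−1,+1}^{ℤ^d}. Then for every σ ∈ {−1,+1}^{Λ'}, the conditional probability of ν_{Λ'}^τ given the restriction σ_{Λ'∖Λ} satisfies ν_{Λ'}^τ(σ_Λ |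 σ_{Λ'∖Λ}) = μ_Λ^{σ_{Λ'∖Λ} τ_{Λ'^c}}(σ_Λ), where μ_Λ^{σ_{Λ'∖Λ} τ_{Λ'^c}} is the finite-volume Gibbs measure on {−1,+1}^Λ for the potential φ with boundary condition equal to σ on Λ'∖Λ and to τ off Λ'. -/
open MeasureTheory ProbabilityTheory

namespace ClassC

open Classical in
lemma exp_neg_ham {d : ℕ} (β : ℝ) (K : Site d → ℝ) (hsymm : ∀ k, K (-k) = K k)
    (Λ Λ' : Finset (Site d)) (hsub : Λ ⊆ Λ')
    (hbd : ibdry K Λ ∩ ibdry K Λ' = ∅) (τ : Config d) (σ : ↥Λ → Spin) :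
    Real.exp (-ham β K Λ τ σ) =
      ∏ k ∈ Λ'.filter (fun k => ∃ j ∈ Λ, K (k - j) ≠ 0),
        Real.cosh (β * ∑ᶠ j : Site d, K (k - j) * ((patch Λ σ τ) j : ℝ)) := by
  unfold ham
  rw [finsum_cond_eq_sum_of_cond_iff (fun k : Site d =>
      -Real.log (Real.cosh (β * ∑ᶠ j : Site d, K (k - j) * ((patch Λ σ τ) j : ℝ))))
    (p := fun k => ∃ j ∈ Λ, K (k - j) ≠ 0)
    (t := Λ'.filter (fun k => ∃ j ∈ Λ, K (k - j) ≠ 0))]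
  · rw [Finset.sum_neg_distrib, neg_neg, Real.exp_sum]
    refine Finset.prod_congr rfl fun k _ => ?_
    rw [Real.exp_log (Real.cosh_pos _)]
  · intro k _
    rw [Finset.mem_filter]
    refine ⟨fun h => ⟨?_, h⟩, fun h => h.2⟩
    by_contra hk
    obtain ⟨j, hj, hKj⟩ := h
    have hjk : K (j - k) ≠ 0 := by
      rw [← neg_sub, hsymm]; exact hKj
    have : j ∈ ibdry K Λ ∩ ibdry K Λ' :=
      ⟨⟨hj, k, fun h => hk (hsub h), hjk⟩, ⟨hsub hj, k, hk, hjk⟩⟩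
    rw [hbd] at this
    exact this

lemma patch_patch {d : ℕ} (Λ Λ' : Finset (Site d)) (hsub : Λ ⊆ Λ') (τ : Config d)
    (σ σ' : ↥Λ' → Spin) (h : ∀ j : ↥Λ', (j : Site d) ∉ Λ → σ' j = σ j) :
    patch Λ (fun k : ↥Λ => σ' ⟨(k : Site d), hsub k.2⟩) (patch Λ' σ τ) = patch Λ' σ' τ := by
  funext j
  unfold patch
  by_cases hj : j ∈ Λ
  · simp [hj, hsub hj]
  · by_cases hj' : j ∈ Λ'
    · simp [hj, hj', h ⟨j, hj'⟩ hj]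
    · simp [hj, hj']

open Classical in
/-- The factor of the weight that does not depend on the spins in `Λ`. -/
noncomputable def outer {d : ℕ} (β : ℝ) (K : Site d → ℝ)
    (Λ Λ' : Finset (Site d)) (τ : Config d) (σ : ↥Λ' → Spin) : ℝ :=
  (∏ k ∈ Λ'.filter (fun k => ¬ ∃ j ∈ Λ, K (k - j) ≠ 0),
    Real.cosh (β * ∑ᶠ j : Site d, K (k - j) * ((patch Λ' σ τ) j : ℝ))) *
  ∏ k : ↥Λ', Real.exp (β * (σ k : ℝ) *
    ∑ᶠ j ∈ {j : Site d | j ∉ Λ'}, K ((k : Site d) - j) * (τ j : ℝ))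

lemma outer_pos {d : ℕ} (β : ℝ) (K : Site d → ℝ)
    (Λ Λ' : Finset (Site d)) (τ : Config d) (σ : ↥Λ' → Spin) : 0 < outer β K Λ Λ' τ σ :=
  mul_pos (Finset.prod_pos fun _ _ => Real.cosh_pos _)
    (Finset.prod_pos fun _ _ => Real.exp_pos _)

lemma outer_congr {d : ℕ} (β : ℝ) (K : Site d → ℝ)
    (Λ Λ' : Finset (Site d)) (hbd : ibdry K Λ ∩ ibdry K Λ' = ∅) (hsub : Λ ⊆ Λ') (τ : Config d)
    (σ σ' : ↥Λ' → Spin) (h : ∀ j : ↥Λ', (j : Site d) ∉ Λ → σ' j = σ j) :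
    outer β K Λ Λ' τ σ' = outer β K Λ Λ' τ σ := by
  unfold outer
  congr 1
  · refine Finset.prod_congr rfl fun k hk => ?_
    have hk2 := (Finset.mem_filter.1 hk).2
    congr 2
    refine finsum_congr fun j => ?_
    by_cases hj : j ∈ Λ
    · have : K (k - j) = 0 := by
        by_contra hne
        exact hk2 ⟨j, hj, hne⟩
      simp [this]
    · unfold patch
      by_cases hj' : j ∈ Λ'
      · simp [hj', h ⟨j, hj'⟩ hj]
      · simp [hj']
  · refine Finset.prod_congr rfl fun k _ => ?_
    by_cases hk : (k : Site d) ∈ Λ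
    · have : ∑ᶠ j ∈ {j : Site d | j ∉ Λ'}, K ((k : Site d) - j) * (τ j : ℝ) = 0 := by
        refine finsum_mem_eq_zero_of_forall_eq_zero fun j hj => ?_
        have : K ((k : Site d) - j) = 0 := by
          by_contra hne
          have hm : (k : Site d) ∈ ibdry K Λ ∩ ibdry K Λ' :=
            ⟨⟨hk, j, fun h => hj (hsub h), hne⟩, ⟨k.2, j, hj, hne⟩⟩
          rw [hbd] at hm
          exact hm
        rw [this, zero_mul]
      rw [this, mul_zero, mul_zero]
    · rw [h k hk]

lemma nuWeight_eq {d : ℕ} (β : ℝ) (K : Site d → ℝ) (hsymm : ∀ k, K (-k) = K k)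
    (Λ Λ' : Finset (Site d)) (hsub : Λ ⊆ Λ')
    (hbd : ibdry K Λ ∩ ibdry K Λ' = ∅) (τ : Config d)
    (σ σ' : ↥Λ' → Spin) (h : ∀ j : ↥Λ', (j : Site d) ∉ Λ → σ' j = σ j) :
    nuWeight β K Λ' τ σ' = outer β K Λ Λ' τ σ *
      Real.exp (-ham β K Λ (patch Λ' σ τ) (fun k : ↥Λ => σ' ⟨(k : Site d), hsub k.2⟩)) := by
  classical
  rw [← outer_congr β K Λ Λ' hbd hsub τ σ σ' h, exp_neg_ham β K hsymm Λ Λ' hsub hbd,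
    patch_patch Λ Λ' hsub τ σ σ' h]
  unfold nuWeight outer
  rw [Finset.prod_mul_distrib,
    Finset.prod_coe_sort Λ' (fun k =>
      Real.cosh (β * ∑ᶠ j : Site d, K (k - j) * ((patch Λ' σ' τ) j : ℝ))),
    ← Finset.prod_filter_mul_prod_filter_not Λ' (fun k => ∃ j ∈ Λ, K (k - j) ≠ 0)]
  ring

end ClassC

open ClassC in
/-- the conditional law of the finite-volume stationary measure is a
finite-volume Gibbs measure: if `Λ ⊂ Λ'` with `∂ᵢΛ ∩ ∂ᵢΛ' = ∅`, then for every
`σ ∈ {-1,+1}^{Λ'}`,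
`ν_{Λ'}^τ(σ_Λ | σ_{Λ'∖Λ}) = μ_Λ^{σ_{Λ'∖Λ} τ_{Λ'ᶜ}}(σ_Λ)`. -/
theorem stmt_10
    (d : ℕ) (hd : 1 ≤ d) (β : ℝ) (hβ : 0 < β)
    (K : Site d → ℝ) (R : ℕ) (hR : 1 ≤ R) (hK : SymmFiniteRange K R)
    (Λ Λ' : Finset (Site d)) (hsub : Λ ⊆ Λ')
    (hbd : ibdry K Λ ∩ ibdry K Λ' = ∅)
    (τ : Config d) (σ : ↥Λ' → Spin) :
    nuFV β K Λ' τ σ /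
        ∑ σ' ∈ Finset.univ.filter
          (fun σ' : ↥Λ' → Spin => ∀ j : ↥Λ', (j : Site d) ∉ Λ → σ' j = σ j),
          nuFV β K Λ' τ σ' =
      gibbsFV β K Λ (fun j => if h : j ∈ Λ' then σ ⟨j, h⟩ else τ j)
        (fun k : ↥Λ => σ ⟨(k : Site d), hsub k.2⟩) := by
  have hw := nuWeight_eq β K hK.1 Λ Λ' hsub hbd τ σ
  have hc := outer_pos β K Λ Λ' τ σ
  have hW : 0 < ∑ σ', nuWeight β K Λ' τ σ' :=
    Finset.sum_pos (fun _ _ => Finset.prod_pos fun _ _ =>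
      mul_pos (Real.cosh_pos _) (Real.exp_pos _)) ⟨σ, Finset.mem_univ _⟩
  have hsum : ∑ σ' ∈ Finset.univ.filter
          (fun σ' : ↥Λ' → Spin => ∀ j : ↥Λ', (j : Site d) ∉ Λ → σ' j = σ j),
          nuWeight β K Λ' τ σ' =
      outer β K Λ Λ' τ σ * ∑ ρ, Real.exp (-ham β K Λ (patch Λ' σ τ) ρ) := by
    rw [Finset.mul_sum]
    refine Finset.sum_bij' (fun σ' _ => fun k : ↥Λ => σ' ⟨(k : Site d), hsub k.2⟩)
      (fun ρ _ => fun k : ↥Λ' => patch Λ ρ (patch Λ' σ τ) (k : Site d)) ?_ ?_ ?_ ?_ ?_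
    · intros; exact Finset.mem_univ _
    · intro ρ _
      rw [Finset.mem_filter]
      refine ⟨Finset.mem_univ _, fun j hj => ?_⟩
      simp [patch, hj]
    · intro σ' hσ'
      have h := (Finset.mem_filter.1 hσ').2
      funext k
      simp only [patch_patch Λ Λ' hsub τ σ σ' h]
      simp [patch]
    · intro ρ _
      funext k
      simp [patch]
    · intro σ' hσ'
      exact hw σ' (Finset.mem_filter.1 hσ').2
  unfold nuFV
  rw [← Finset.sum_div, div_div_div_cancel_right₀ hW.ne', hsum, hw σ (fun _ _ => rfl),
    mul_div_mul_left _ _ hc.ne']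
  rfl
end
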